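/- arXiv:2309.05011 — 2 statements merged into one kernel-verified Lean document; each statement's English description precedes it below -/
import Mathlib

section
/- Let G be a finite simple graph on vertex set {x_1,…,x_n} and let e = {e_1,…,e_t} be a set of t distinct edges of G such that: e, viewed as a subgraph of G with edge set {e_1,…,e_t}, is connected; the induced subgraph G[e] of G on the closed neighbourhood N[e] is bipartite; and the induced subgraph G[ē] of G on V(G) \ N[e] is weakly chordal. Let S = k[x_1,…,x_n] and let R be the polynomial ring over k in the variables corresponding to the vertices of G[ē]. Then depth(S/I(G)^{t+1}) ≤ 1 + depth(R/I(G[ē])). -/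
open MvPolynomial

/-- The maximal homogeneous ideal of the polynomial ring, generated by all variables. -/
noncomputable def maxHomIdeal (k : Type) [Field k] (V : Type) : Ideal (MvPolynomial V k) :=
  Ideal.span (Set.range (X : V → MvPolynomial V k))

/-- `depthQuot k I` is the depth of `S/I` where `S = k[x_v : v ∈ V]`, defined as
`min {i : H^i_m(S/I) ≠ 0}` where `m` is the maximal homogeneous ideal and `H^i_m` is
local cohomology. -/
noncomputable def depthQuot (k : Type) [Field k] {V : Type} (I : Ideal (MvPolynomial V k)) : ℕ :=
  sInf {i : ℕ |
    Nontrivial ((localCohomology (maxHomIdeal k V) i).obj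
      (ModuleCat.of (MvPolynomial V k) (MvPolynomial V k ⧸ I)))}

/-- The edge ideal of a simple graph `G`, generated by the monomials `x_i x_j` for
edges `{i, j}` of `G`. -/
noncomputable def edgeIdeal (k : Type) [Field k] {V : Type} (G : SimpleGraph V) :
    Ideal (MvPolynomial V k) :=
  Ideal.span {p | ∃ i j, G.Adj i j ∧ p = X i * X j}

/-- `H` has an induced cycle of length `m`, i.e. there is a graph embedding (an induced
subgraph inclusion) of the `m`-cycle into `H`. -/
def HasInducedCycle {V : Type} (H : SimpleGraph V) (m : ℕ) : Prop :=
  Nonempty (SimpleGraph.cycleGraph m ↪g H)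

/-- A graph is weakly chordal if neither it nor its complement has an induced cycle of
length at least `5`. -/
def WeaklyChordal {V : Type} (H : SimpleGraph V) : Prop :=
  ∀ m : ℕ, 5 ≤ m → ¬ HasInducedCycle H m ∧ ¬ HasInducedCycle Hᶜ m

/-! ### Localization away from one element -/

namespace LocalizedModule

variable {A A' : Type} [CommRing A] [CommRing A'] {M N : Type} [AddCommGroup M] [Module A M]
  [AddCommGroup N] [Module A' N] {r : A} {r' : A'}

lemma powers_smul_injective (n : ℕ) {a b : LocalizedModule (Submonoid.powers r) M}
    (h : r ^ n • a = r ^ n • b) : a = b :=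
  IsLocalizedModule.smul_injective (mkLinearMap (Submonoid.powers r) M)
    (⟨r ^ n, n, rfl⟩ : Submonoid.powers r) h

lemma exists_pow_smul_eq (a : LocalizedModule (Submonoid.powers r) M) :
    ∃ (n : ℕ) (m : M), r ^ n • a = mkLinearMap (Submonoid.powers r) M m := by
  obtain ⟨⟨m, ⟨_, n, rfl⟩⟩, h⟩ :=
    IsLocalizedModule.surj (Submonoid.powers r) (mkLinearMap (Submonoid.powers r) M) a
  exact ⟨n, m, h⟩

lemma exists_smul_eq_mk (m : M) (n : ℕ) :
    ∃ a : LocalizedModule (Submonoid.powers r) M,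
      r ^ n • a = mkLinearMap (Submonoid.powers r) M m := by
  refine ⟨mk m (⟨r ^ n, n, rfl⟩ : Submonoid.powers r), ?_⟩
  rw [smul'_mk, mkLinearMap_apply]
  exact mk_cancel (⟨r ^ n, n, rfl⟩ : Submonoid.powers r) m

lemma exists_smul_eq (a : LocalizedModule (Submonoid.powers r) M) :
    ∃ b : LocalizedModule (Submonoid.powers r) M, r • b = a := by
  obtain ⟨n, m, h⟩ := exists_pow_smul_eq a
  obtain ⟨b, hb⟩ := exists_smul_eq_mk (r := r) m (n + 1)
  refine ⟨b, powers_smul_injective n ?_⟩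
  rw [h, ← hb, smul_smul, pow_succ]

lemma mkLinearMap_eq_zero_iff (m : M) :
    mkLinearMap (Submonoid.powers r) M m = 0 ↔ ∃ n : ℕ, r ^ n • m = 0 := by
  rw [IsLocalizedModule.eq_zero_iff (Submonoid.powers r)]
  constructor
  · rintro ⟨⟨_, n, rfl⟩, h⟩
    exact ⟨n, h⟩
  · rintro ⟨n, h⟩
    exact ⟨⟨_, n, rfl⟩, h⟩

lemma map_pow_smul_of_map_smul (f : M → N) (hf : ∀ m, f (r • m) = r' • f m) (n : ℕ) (m : M) :
    f (r ^ n • m) = r' ^ n • f m := by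
  induction n generalizing m with
  | zero => simp
  | succ n ih => rw [pow_succ, mul_smul, ih, hf, pow_succ, mul_smul]

/-- The function induced on localizations away from `r` and `r'` by a map intertwining the
actions of `r` and `r'`. -/
noncomputable def awayMap (r : A) (r' : A') (f : M → N)
    (a : LocalizedModule (Submonoid.powers r) M) : LocalizedModule (Submonoid.powers r') N :=
  (exists_smul_eq_mk (r := r') (f (exists_pow_smul_eq a).choose_spec.choose)
    (exists_pow_smul_eq a).choose).choose

lemma awayMap_spec (f : M →+ N) (hf : ∀ m, f (r • m) = r' • f m) {n : ℕ} {m : M}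
    {a : LocalizedModule (Submonoid.powers r) M}
    (h : r ^ n • a = mkLinearMap (Submonoid.powers r) M m) :
    r' ^ n • awayMap r r' f a = mkLinearMap (Submonoid.powers r') N (f m) := by
  have h₁ := (exists_pow_smul_eq a).choose_spec.choose_spec
  have h₂ : r' ^ _ • awayMap r r' f a = _ :=
    (exists_smul_eq_mk (r := r') (f (exists_pow_smul_eq a).choose_spec.choose)
    (exists_pow_smul_eq a).choose).choose_spec
  set n₁ := (exists_pow_smul_eq a).choose
  set m₁ := (exists_pow_smul_eq a).choose_spec.choose
  have h₃ : mkLinearMap (Submonoid.powers r) M (r ^ n₁ • m - r ^ n • m₁) = 0 := by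
    rw [map_sub, map_smul, map_smul, ← h, ← h₁, smul_comm, sub_self]
  obtain ⟨q, hq⟩ := (mkLinearMap_eq_zero_iff _).1 h₃
  have hp := map_pow_smul_of_map_smul f hf
  have h₄ : mkLinearMap (Submonoid.powers r') N (r' ^ n₁ • f m - r' ^ n • f m₁) = 0 := by
    refine (mkLinearMap_eq_zero_iff _).2 ⟨q, ?_⟩
    rw [← hp, ← hp, ← map_sub, ← hp, hq, map_zero]
  rw [map_sub, map_smul, map_smul, ← h₂, sub_eq_zero] at h₄
  apply powers_smul_injective n₁
  rw [h₄, smul_comm]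

lemma awayMap_unique (f : M →+ N) (hf : ∀ m, f (r • m) = r' • f m) {n : ℕ} {m : M}
    {a : LocalizedModule (Submonoid.powers r) M} {b : LocalizedModule (Submonoid.powers r') N}
    (h : r ^ n • a = mkLinearMap (Submonoid.powers r) M m)
    (hb : r' ^ n • b = mkLinearMap (Submonoid.powers r') N (f m)) :
    awayMap r r' f a = b :=
  powers_smul_injective n ((awayMap_spec f hf h).trans hb.symm)

lemma awayMap_mkLinearMap (f : M →+ N) (hf : ∀ m, f (r • m) = r' • f m) (m : M) :
    awayMap r r' f (mkLinearMap (Submonoid.powers r) M m) =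
      mkLinearMap (Submonoid.powers r') N (f m) :=
  awayMap_unique f hf (n := 0) (m := m) (by simp) (by simp)

lemma awayMap_add (f : M →+ N) (hf : ∀ m, f (r • m) = r' • f m)
    (a b : LocalizedModule (Submonoid.powers r) M) :
    awayMap r r' f (a + b) = awayMap r r' f a + awayMap r r' f b := by
  obtain ⟨n, m, h⟩ := exists_pow_smul_eq a
  obtain ⟨n', m', h'⟩ := exists_pow_smul_eq b
  have hp := map_pow_smul_of_map_smul f hf
  refine awayMap_unique f hf (n := n + n') (m := r ^ n' • m + r ^ n • m') ?_ ?_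
  · rw [map_add, map_smul, map_smul, ← h, ← h', smul_add, smul_smul, smul_smul, pow_add,
      mul_comm (r ^ n')]
  · rw [map_add f, hp, hp, map_add, map_smul, map_smul, ← awayMap_spec f hf h,
      ← awayMap_spec f hf h', smul_add, smul_smul, smul_smul, pow_add, mul_comm (r' ^ n')]

lemma awayMap_smul (f : M →+ N) (hf : ∀ m, f (r • m) = r' • f m) {c : A} {c' : A'}
    (hc : ∀ m, f (c • m) = c' • f m) (a : LocalizedModule (Submonoid.powers r) M) :
    awayMap r r' f (c • a) = c' • awayMap r r' f a := by
  obtain ⟨n, m, h⟩ := exists_pow_smul_eq a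
  refine awayMap_unique f hf (n := n) (m := c • m) ?_ ?_
  · rw [smul_comm, h, map_smul]
  · rw [smul_comm, awayMap_spec f hf h, hc, map_smul]

lemma awayMap_injective (f : M →+ N) (hf : ∀ m, f (r • m) = r' • f m)
    (hinj : Function.Injective f) (a : LocalizedModule (Submonoid.powers r) M)
    (ha : awayMap r r' f a = 0) : a = 0 := by
  obtain ⟨n, m, h⟩ := exists_pow_smul_eq a
  have h' := awayMap_spec f hf h
  rw [ha, smul_zero, eq_comm, mkLinearMap_eq_zero_iff] at h'
  obtain ⟨q, hq⟩ := h'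
  rw [← map_pow_smul_of_map_smul f hf, map_eq_zero_iff f hinj] at hq
  apply powers_smul_injective n
  rw [h, smul_zero, mkLinearMap_eq_zero_iff]
  exact ⟨q, hq⟩

lemma awayMap_surjective (f : M →+ N) (hf : ∀ m, f (r • m) = r' • f m)
    (hsurj : Function.Surjective f) (b : LocalizedModule (Submonoid.powers r') N) :
    ∃ a : LocalizedModule (Submonoid.powers r) M, awayMap r r' f a = b := by
  obtain ⟨n, y, h⟩ := exists_pow_smul_eq b
  obtain ⟨m, rfl⟩ := hsurj y
  obtain ⟨a, ha⟩ := exists_smul_eq_mk (r := r) m n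
  exact ⟨a, awayMap_unique f hf ha h⟩

lemma awayMap_exact {A'' P : Type} [CommRing A''] [AddCommGroup P] [Module A'' P] {r'' : A''}
    (f : M →+ N) (hf : ∀ m, f (r • m) = r' • f m) (g : N →+ P)
    (hg : ∀ m, g (r' • m) = r'' • g m) (hfg : ∀ y, g y = 0 → ∃ x, f x = y)
    (b : LocalizedModule (Submonoid.powers r') N) (hb : awayMap r' r'' g b = 0) :
    ∃ a : LocalizedModule (Submonoid.powers r) M, awayMap r r' f a = b := by
  obtain ⟨n, y, h⟩ := exists_pow_smul_eq b
  have h' := awayMap_spec g hg h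
  rw [hb, smul_zero, eq_comm, mkLinearMap_eq_zero_iff] at h'
  obtain ⟨q, hq⟩ := h'
  rw [← map_pow_smul_of_map_smul g hg] at hq
  obtain ⟨x, hx⟩ := hfg _ hq
  obtain ⟨a, ha⟩ := exists_smul_eq_mk (r := r) x (q + n)
  refine ⟨a, awayMap_unique f hf ha ?_⟩
  rw [hx, map_smul, ← h, smul_smul, pow_add]

end LocalizedModule

/-! ### Families of operators and the depth predicate -/

section OperatorFamilies

open LocalizedModule

variable {ι A A' A'' : Type} [CommRing A''] [CommRing A'] [CommRing A]

/-- The product of the localizations of `M` away from the members of the family `s`. -/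
abbrev LocProd (s : ι → A) (M : Type) [AddCommGroup M] [Module A M] : Type :=
  ∀ i, LocalizedModule (Submonoid.powers (s i)) M

/-- The localization maps of `M` away from the members of `s`. -/
noncomputable def toLocProd (s : ι → A) (M : Type) [AddCommGroup M] [Module A M] :
    M →ₗ[A] LocProd s M :=
  LinearMap.pi fun i => mkLinearMap (Submonoid.powers (s i)) M

/-- The cokernel of `M → ∏ i, M[1 / s i]`. -/
abbrev LocCoker (s : ι → A) (M : Type) [AddCommGroup M] [Module A M] : Type :=
  LocProd s M ⧸ LinearMap.range (toLocProd s M)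

/-- `M` has no nonzero element annihilated by every member of `s`. -/
def NoSocle (s : ι → A) (M : Type) [AddCommGroup M] [Module A M] : Prop :=
  ∀ m : M, (∀ i, s i • m = 0) → m = 0

/-- `DepthGE s p M` expresses that the depth of `M` with respect to the ideal generated by the
family `s` is at least `p`, by recursion along `M → ∏ i, M[1 / s i]`. -/
def DepthGE (s : ι → A) : ℕ → ∀ (M : Type) [AddCommGroup M] [Module A M], Prop
  | 0, _, _, _ => True
  | p + 1, M, _, _ => NoSocle s M ∧ DepthGE s p (LocCoker s M)

/-- Additive maps intertwining the action of `s` on `M` with the action of `s'` on `N`. -/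
structure FamilyHom (s : ι → A) (s' : ι → A') (M N : Type) [AddCommGroup M] [Module A M]
    [AddCommGroup N] [Module A' N] extends M →+ N where
  map_smul' : ∀ i m, toFun (s i • m) = s' i • toFun m

variable {s : ι → A} {s' : ι → A'} {s'' : ι → A''} {M N P : Type}
  [AddCommGroup P] [Module A'' P] [AddCommGroup N] [Module A' N] [AddCommGroup M] [Module A M]

/-- The additive map underlying a linear map, for a fixed family of scalars. -/
def FamilyHom.ofLinear (s : ι → A) {M N : Type} [AddCommGroup M] [Module A M] [AddCommGroup N]
    [Module A N] (f : M →ₗ[A] N) : FamilyHom s s M N :=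
  { f.toAddMonoidHom with map_smul' := fun i m => f.map_smul (s i) m }

lemma toLocProd_apply (m : M) (i : ι) :
    toLocProd s M m i = mkLinearMap (Submonoid.powers (s i)) M m := rfl

lemma toLocProd_eq_zero_iff (m : M) :
    toLocProd s M m = 0 ↔ ∀ i, ∃ n : ℕ, s i ^ n • m = 0 := by
  rw [funext_iff]
  exact forall_congr' fun i => mkLinearMap_eq_zero_iff (r := s i) m

/-- Induction on the torsion order of an element killed by powers of all members of `s`. -/
lemma induction_of_toLocProd_eq_zero [Finite ι] {Q : M → Prop} (h0 : Q 0)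
    (hs : ∀ m, (∀ i, Q (s i • m)) → Q m) (m : M) (hm : toLocProd s M m = 0) : Q m := by
  classical
  have := Fintype.ofFinite ι
  rw [toLocProd_eq_zero_iff] at hm
  choose n hn using hm
  obtain ⟨c, hc⟩ : ∃ c, c = ∑ i, n i := ⟨_, rfl⟩
  induction c generalizing m n with
  | zero =>
    refine hs m fun i => ?_
    have h1 : n i = 0 := by
      have := Finset.single_le_sum (f := n) (fun _ _ => Nat.zero_le _) (Finset.mem_univ i)
      omega
    have h2 := hn i
    rw [h1, pow_zero, one_smul] at h2
    rwa [h2, smul_zero]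
  | succ c ih =>
    by_cases hz : ∃ i, n i = 0
    · obtain ⟨i, hi⟩ := hz
      have h2 := hn i
      rw [hi, pow_zero, one_smul] at h2
      rwa [h2]
    · push Not at hz
      refine hs m fun i => ih _ (Function.update n i (n i - 1)) (fun j => ?_) ?_
      · by_cases hj : j = i
        · subst hj
          rw [Function.update_self, smul_smul, ← pow_succ, Nat.sub_add_cancel, hn]
          exact Nat.pos_of_ne_zero (hz j)
        · rw [Function.update_of_ne hj, smul_comm, hn, smul_zero]
      · rw [Finset.sum_update_of_mem (Finset.mem_univ i)]
        have h3 := Finset.add_sum_erase Finset.univ n (Finset.mem_univ i)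
        rw [Finset.erase_eq] at h3
        have := Nat.pos_of_ne_zero (hz i)
        omega

lemma NoSocle.toLocProd_injective [Finite ι] (h : NoSocle s M) :
    Function.Injective (toLocProd s M) := by
  rw [injective_iff_map_eq_zero]
  intro m hm
  refine induction_of_toLocProd_eq_zero (s := s) (Q := fun m => m = 0) ?_ ?_ m hm
  exacts [rfl, h]

namespace FamilyHom

instance : CoeFun (FamilyHom s s' M N) fun _ => M → N := ⟨fun f => f.toAddMonoidHom⟩

lemma map_smul (f : FamilyHom s s' M N) (i : ι) (m : M) : f (s i • m) = s' i • f m :=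
  f.map_smul' i m

lemma map_sub (f : FamilyHom s s' M N) (a b : M) : f (a - b) = f a - f b :=
  _root_.map_sub f.toAddMonoidHom a b

lemma map_zero (f : FamilyHom s s' M N) : f 0 = 0 := _root_.map_zero f.toAddMonoidHom

/-- The map induced on products of localizations. -/
noncomputable def locProd (f : FamilyHom s s' M N) :
    FamilyHom s s' (LocProd s M) (LocProd s' N) where
  toFun e i := awayMap (s i) (s' i) f (e i)
  map_zero' := by
    funext i
    have := awayMap_mkLinearMap f.toAddMonoidHom (f.map_smul i) 0
    rw [_root_.map_zero, _root_.map_zero, _root_.map_zero] at this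
    exact this
  map_add' a b := funext fun i => awayMap_add f.toAddMonoidHom (f.map_smul i) _ _
  map_smul' j a := funext fun i =>
    awayMap_smul f.toAddMonoidHom (f.map_smul i) (f.map_smul j) _

lemma locProd_toLocProd (f : FamilyHom s s' M N) (m : M) :
    f.locProd (toLocProd s M m) = toLocProd s' N (f m) :=
  funext fun i => awayMap_mkLinearMap f.toAddMonoidHom (f.map_smul i) m

lemma locProd_injective (f : FamilyHom s s' M N) (hf : Function.Injective f)
    {e : LocProd s M} (he : f.locProd e = 0) : e = 0 := by
  funext i
  exact awayMap_injective f.toAddMonoidHom (f.map_smul i) hf (e i) (congrFun he i)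

lemma locProd_surjective (f : FamilyHom s s' M N) (hf : Function.Surjective f) :
    Function.Surjective f.locProd := by
  intro e
  choose a ha using fun i => awayMap_surjective f.toAddMonoidHom (f.map_smul i) hf (e i)
  exact ⟨a, funext ha⟩

lemma locProd_exact (f : FamilyHom s s' M N) (g : FamilyHom s' s'' N P)
    (hfg : ∀ y, g y = 0 → ∃ x, f x = y) {e : LocProd s' N} (he : g.locProd e = 0) :
    ∃ a, f.locProd a = e := by
  choose a ha using fun i => awayMap_exact f.toAddMonoidHom (f.map_smul i) g.toAddMonoidHom
    (g.map_smul i) hfg (e i) (congrFun he i)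
  exact ⟨a, funext ha⟩

lemma locProd_comp_eq_zero (f : FamilyHom s s' M N) (g : FamilyHom s' s'' N P)
    (hfg : ∀ x, g (f x) = 0) (e : LocProd s M) : g.locProd (f.locProd e) = 0 := by
  funext i
  obtain ⟨n, m, h⟩ := exists_pow_smul_eq (e i)
  refine awayMap_unique g.toAddMonoidHom (g.map_smul i)
    (awayMap_spec f.toAddMonoidHom (f.map_smul i) h) ?_
  rw [hfg]
  simp

lemma locProd_leftInverse (f : FamilyHom s s' M N) (g : FamilyHom s' s N M)
    (hfg : Function.LeftInverse g f) : Function.LeftInverse g.locProd f.locProd := by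
  intro e
  funext i
  obtain ⟨n, m, h⟩ := exists_pow_smul_eq (e i)
  refine awayMap_unique g.toAddMonoidHom (g.map_smul i)
    (awayMap_spec f.toAddMonoidHom (f.map_smul i) h) ?_
  rw [hfg m, h]

lemma locProd_smul_eq_zero (g : FamilyHom s s' M N) {c : A} (hc : ∀ m, g (c • m) = 0)
    (e : LocProd s M) : g.locProd (c • e) = 0 := by
  have h := fun i => awayMap_smul g.toAddMonoidHom (g.map_smul i) (c := c) (c' := 0)
    (fun m => by rw [zero_smul]; exact hc m) (e i)
  funext i
  exact (h i).trans (zero_smul _ _)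

/-- The map induced on the cokernels of the localization maps. -/
noncomputable def locCoker (f : FamilyHom s s' M N) :
    FamilyHom s s' (LocCoker s M) (LocCoker s' N) :=
  have hker : ∀ e ∈ (LinearMap.range (toLocProd s M)).toAddSubgroup,
      ((LinearMap.range (toLocProd s' N)).mkQ.toAddMonoidHom.comp f.locProd.toAddMonoidHom) e
        = 0 := by
    rintro _ ⟨m, rfl⟩
    refine (Submodule.Quotient.mk_eq_zero _).2 ⟨f m, ?_⟩
    exact (f.locProd_toLocProd m).symm
  { QuotientAddGroup.lift (LinearMap.range (toLocProd s M)).toAddSubgroup _ hker with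
    map_smul' := by
      intro i c
      obtain ⟨e, rfl⟩ := Submodule.Quotient.mk_surjective _ c
      exact congrArg (Submodule.Quotient.mk (p := LinearMap.range (toLocProd s' N)))
        (f.locProd.map_smul i e) }

lemma locCoker_mk (f : FamilyHom s s' M N) (e : LocProd s M) :
    f.locCoker (Submodule.Quotient.mk e) = Submodule.Quotient.mk (f.locProd e) := rfl

lemma locCoker_leftInverse (f : FamilyHom s s' M N) (g : FamilyHom s' s N M)
    (hfg : Function.LeftInverse g f) : Function.LeftInverse g.locCoker f.locCoker := by
  intro c
  obtain ⟨e, rfl⟩ := Submodule.Quotient.mk_surjective _ c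
  rw [locCoker_mk, locCoker_mk, locProd_leftInverse f g hfg e]

lemma locCoker_smul_eq_zero (g : FamilyHom s s' M N) {c : A} (hc : ∀ m, g (c • m) = 0)
    (x : LocCoker s M) : g.locCoker (c • x) = 0 := by
  obtain ⟨e, rfl⟩ := Submodule.Quotient.mk_surjective _ x
  rw [← Submodule.Quotient.mk_smul, locCoker_mk, locProd_smul_eq_zero g hc,
    Submodule.Quotient.mk_zero]

end FamilyHom

lemma LocCoker.mk_eq_zero_iff (e : LocProd s M) :
    (Submodule.Quotient.mk e : LocCoker s M) = 0 ↔ ∃ m, toLocProd s M m = e := by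
  rw [Submodule.Quotient.mk_eq_zero, LinearMap.mem_range]

/-- A short exact sequence of families. -/
structure FamilyShortExact (f : FamilyHom s s' M N) (g : FamilyHom s' s'' N P) : Prop where
  injective : Function.Injective f
  surjective : Function.Surjective g
  comp_eq_zero : ∀ x, g (f x) = 0
  exact : ∀ y, g y = 0 → ∃ x, f x = y

lemma FamilyShortExact.locCoker [Finite ι] {f : FamilyHom s s' M N} {g : FamilyHom s' s'' N P}
    (h : FamilyShortExact f g) (hP : NoSocle s'' P) :
    FamilyShortExact f.locCoker g.locCoker where
  injective := by
    refine (injective_iff_map_eq_zero f.locCoker.toAddMonoidHom).2 fun c hc => ?_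
    obtain ⟨e, rfl⟩ := Submodule.Quotient.mk_surjective _ c
    obtain ⟨n, hn⟩ := (LocCoker.mk_eq_zero_iff _).1 hc
    have hgn : g n = 0 := by
      apply hP.toLocProd_injective
      rw [_root_.map_zero, ← g.locProd_toLocProd, hn]
      exact FamilyHom.locProd_comp_eq_zero f g h.comp_eq_zero e
    obtain ⟨m, rfl⟩ := h.exact n hgn
    refine (LocCoker.mk_eq_zero_iff _).2 ⟨m, ?_⟩
    rw [← sub_eq_zero]
    apply f.locProd_injective h.injective
    rw [FamilyHom.map_sub, f.locProd_toLocProd, hn, sub_self]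
  surjective := by
    intro c
    obtain ⟨e, rfl⟩ := Submodule.Quotient.mk_surjective _ c
    obtain ⟨a, rfl⟩ := g.locProd_surjective h.surjective e
    exact ⟨Submodule.Quotient.mk a, rfl⟩
  comp_eq_zero := by
    intro c
    obtain ⟨e, rfl⟩ := Submodule.Quotient.mk_surjective _ c
    rw [FamilyHom.locCoker_mk, FamilyHom.locCoker_mk,
      FamilyHom.locProd_comp_eq_zero f g h.comp_eq_zero, Submodule.Quotient.mk_zero]
  exact := by
    intro c hc
    obtain ⟨e, rfl⟩ := Submodule.Quotient.mk_surjective _ c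
    obtain ⟨p, hp⟩ := (LocCoker.mk_eq_zero_iff _).1 hc
    obtain ⟨n, rfl⟩ := h.surjective p
    obtain ⟨a, ha⟩ := FamilyHom.locProd_exact f g h.exact (e := e - toLocProd s' N n) (by
      rw [FamilyHom.map_sub, g.locProd_toLocProd, hp, sub_self])
    refine ⟨Submodule.Quotient.mk a, ?_⟩
    rw [FamilyHom.locCoker_mk, ha, Submodule.Quotient.mk_sub, sub_eq_self]
    exact (LocCoker.mk_eq_zero_iff _).2 ⟨n, rfl⟩

lemma NoSocle.of_injective (f : FamilyHom s s' M N) (hf : Function.Injective f)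
    (h : NoSocle s' N) : NoSocle s M := by
  intro m hm
  apply hf
  rw [f.map_zero]
  refine h _ fun i => ?_
  rw [← f.map_smul, hm, f.map_zero]

lemma NoSocle.middle {f : FamilyHom s s' M N} {g : FamilyHom s' s'' N P}
    (h : FamilyShortExact f g) (hM : NoSocle s M) (hP : NoSocle s'' P) : NoSocle s' N := by
  intro n hn
  obtain ⟨m, rfl⟩ := h.exact n (hP _ fun i => by rw [← g.map_smul, hn, g.map_zero])
  rw [hM m fun i => h.injective (by rw [f.map_smul, hn, f.map_zero]), f.map_zero]

lemma NoSocle.right [Finite ι] {f : FamilyHom s s' M N} {g : FamilyHom s' s'' N P}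
    (h : FamilyShortExact f g) (hC : NoSocle s (LocCoker s M))
    (hN : NoSocle s' N) : NoSocle s'' P := by
  intro p hp
  obtain ⟨n, rfl⟩ := h.surjective p
  choose a ha using fun i => h.exact (s' i • n) (by rw [g.map_smul, hp])
  choose e he using fun i => exists_smul_eq_mk (r := s i) (a i) 1
  have hfe : f.locProd e = toLocProd s' N n := by
    funext i
    refine awayMap_unique f.toAddMonoidHom (f.map_smul i) (he i) ?_
    rw [ha, pow_one, toLocProd_apply, _root_.map_smul]
  have hse : ∀ j, s j • e = toLocProd s M (a j) := by
    intro j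
    rw [← sub_eq_zero]
    apply f.locProd_injective h.injective
    rw [FamilyHom.map_sub, f.locProd_toLocProd, ha, FamilyHom.map_smul, hfe,
      _root_.map_smul, sub_self]
  obtain ⟨m, hm⟩ := (LocCoker.mk_eq_zero_iff e).1 (hC _ fun j => by
    rw [← Submodule.Quotient.mk_smul, hse]
    exact (LocCoker.mk_eq_zero_iff _).2 ⟨_, rfl⟩)
  have : f m = n := by
    apply hN.toLocProd_injective
    rw [← f.locProd_toLocProd, hm, hfe]
  rw [← this, h.comp_eq_zero]

namespace DepthGE

lemma of_succ {p : ℕ} (h : DepthGE s (p + 1) M) : DepthGE s p M := by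
  induction p generalizing M with
  | zero => trivial
  | succ p ih => exact ⟨h.1, ih h.2⟩

lemma of_leftInverse {p : ℕ} (f : FamilyHom s s' M N) (g : FamilyHom s' s N M)
    (hfg : Function.LeftInverse g f) (h : DepthGE s' p N) : DepthGE s p M := by
  induction p generalizing M N with
  | zero => trivial
  | succ p ih =>
    exact ⟨h.1.of_injective f hfg.injective,
      ih f.locCoker g.locCoker (FamilyHom.locCoker_leftInverse f g hfg) h.2⟩

lemma left [Finite ι] {p : ℕ} {f : FamilyHom s s' M N} {g : FamilyHom s' s'' N P}
    (h : FamilyShortExact f g) (hN : DepthGE s' (p + 1) N) (hP : DepthGE s'' p P) :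
    DepthGE s (p + 1) M := by
  induction p generalizing M N P with
  | zero => exact ⟨hN.1.of_injective f h.injective, trivial⟩
  | succ p ih =>
    exact ⟨hN.1.of_injective f h.injective, ih (h.locCoker hP.1) hN.2 hP.2⟩

lemma middle [Finite ι] {p : ℕ} {f : FamilyHom s s' M N} {g : FamilyHom s' s'' N P}
    (h : FamilyShortExact f g) (hM : DepthGE s p M) (hP : DepthGE s'' p P) :
    DepthGE s' p N := by
  induction p generalizing M N P with
  | zero => trivial
  | succ p ih => exact ⟨NoSocle.middle h hM.1 hP.1, ih (h.locCoker hP.1) hM.2 hP.2⟩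

lemma right [Finite ι] {p : ℕ} {f : FamilyHom s s' M N} {g : FamilyHom s' s'' N P}
    (h : FamilyShortExact f g) (hM : DepthGE s (p + 1) M) (hN : DepthGE s' p N) :
    DepthGE s'' p P := by
  induction p generalizing M N P with
  | zero => trivial
  | succ p ih =>
    have hP := NoSocle.right h hM.2.1 hN.1
    exact ⟨hP, ih (h.locCoker hP) hM.2 hN.2⟩

end DepthGE

end OperatorFamilies

section OperatorFamilies

open LocalizedModule

variable {ι A A' : Type} [CommRing A] [CommRing A'] {s s₀ : ι → A} {s' : ι → A'}
  {M M₀ : Type} [AddCommGroup M] [Module A M] [AddCommGroup M₀] [Module A' M₀]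

lemma exists_linearEquiv_smul_locCoker {c : A} (e : M ≃ₗ[A] M) (he : ∀ m, e m = c • m) :
    ∃ e' : LocCoker s M ≃ₗ[A] LocCoker s M, ∀ x, e' x = c • x := by
  let f := FamilyHom.ofLinear s (e : M →ₗ[A] M)
  let g := FamilyHom.ofLinear s (e.symm : M →ₗ[A] M)
  have hf : ∀ x, f.locCoker x = c • x := by
    intro x
    obtain ⟨y, rfl⟩ := Submodule.Quotient.mk_surjective _ x
    rw [FamilyHom.locCoker_mk, ← Submodule.Quotient.mk_smul]
    congr 1
    funext i
    obtain ⟨n, m, h⟩ := exists_pow_smul_eq (y i)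
    refine awayMap_unique f.toAddMonoidHom (f.map_smul i) h ?_
    have : f m = c • m := he m
    rw [this, _root_.map_smul, ← h, Pi.smul_apply, smul_comm]
  have h₁ := FamilyHom.locCoker_leftInverse f g e.symm_apply_apply
  have h₂ := FamilyHom.locCoker_leftInverse g f e.apply_symm_apply
  refine ⟨LinearEquiv.ofBijective (LinearMap.lsmul A (LocCoker s M) c) ⟨fun x y hxy => ?_,
    fun y => ⟨g.locCoker y, ?_⟩⟩, fun x => rfl⟩
  · apply h₁.injective
    rw [hf, hf]
    exact hxy
  · exact (hf _).symm.trans (h₂ y)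

lemma DepthGE.of_linearEquiv_smul {i : ι} (p : ℕ) (e : M ≃ₗ[A] M) (he : ∀ m, e m = s i • m) :
    DepthGE s p M := by
  induction p generalizing M with
  | zero => trivial
  | succ p ih =>
    refine ⟨fun m hm => e.injective ?_, ?_⟩
    · rw [he, hm, _root_.map_zero]
    · obtain ⟨φ, hφ⟩ := exists_linearEquiv_smul_locCoker (s := s) e he
      exact ih φ hφ

/-- `s₀` is obtained from the family `s` by replacing the member of index `i₀` by zero. -/
structure IsZeroedAt (i₀ : ι) (s s₀ : ι → A) : Prop where
  self_eq : s₀ i₀ = 0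
  of_ne : ∀ i, i ≠ i₀ → s₀ i = s i

namespace IsZeroedAt

variable {i₀ : ι} (h : IsZeroedAt i₀ s s₀)

include h in
lemma eq_zero (a : LocalizedModule (Submonoid.powers (s₀ i₀)) M) : a = 0 := by
  have key : ∀ c : A, c = 0 → c ^ 1 • a = c ^ 1 • 0 := by
    rintro _ rfl
    rw [pow_one, zero_smul, zero_smul]
  exact powers_smul_injective 1 (key _ h.self_eq)

include h in
lemma isUnit (i : ι) (x : Submonoid.powers (s i)) :
    IsUnit ((algebraMap A (Module.End A (LocalizedModule (Submonoid.powers (s₀ i)) M))) x) := by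
  by_cases hi : i = i₀
  · subst hi
    have : Subsingleton (LocalizedModule (Submonoid.powers (s₀ i)) M) :=
      ⟨fun a b => (h.eq_zero a).trans (h.eq_zero b).symm⟩
    exact isUnit_of_subsingleton _
  · have hx : (x : A) ∈ Submonoid.powers (s₀ i) := by
      rw [h.of_ne i hi]
      exact x.2
    exact IsLocalizedModule.map_units (mkLinearMap (Submonoid.powers (s₀ i)) M) ⟨x, hx⟩

/-- The map forgetting the localization away from `s i₀`. -/
noncomputable def locProd : LocProd s M →ₗ[A] LocProd s₀ M :=
  LinearMap.pi fun i =>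
    (LocalizedModule.lift (Submonoid.powers (s i)) (mkLinearMap (Submonoid.powers (s₀ i)) M)
      (h.isUnit i)) ∘ₗ LinearMap.proj i

lemma locProd_apply (e : LocProd s M) (i : ι) :
    h.locProd e i = LocalizedModule.lift (Submonoid.powers (s i))
      (mkLinearMap (Submonoid.powers (s₀ i)) M) (h.isUnit i) (e i) := rfl

lemma locProd_apply_eq_zero {e : LocProd s M} {i : ι} (he : e i = 0) : h.locProd e i = 0 := by
  rw [h.locProd_apply, he, map_zero]

lemma locProd_toLocProd (m : M) : h.locProd (toLocProd s M m) = toLocProd s₀ M m := by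
  funext i
  exact LinearMap.congr_fun (LocalizedModule.lift_comp _ _ (h.isUnit i)) m

lemma pow_smul_locProd {e : LocProd s M} {i : ι} {n : ℕ} {m : M}
    (he : s i ^ n • e i = mkLinearMap (Submonoid.powers (s i)) M m) :
    s i ^ n • h.locProd e i = mkLinearMap (Submonoid.powers (s₀ i)) M m := by
  rw [h.locProd_apply, ← _root_.map_smul, he]
  exact congrFun (h.locProd_toLocProd m) i

lemma locProd_surjective : Function.Surjective (h.locProd (M := M)) := by
  intro b
  choose n m hb using fun i => exists_pow_smul_eq (b i)
  choose a ha using fun i => exists_smul_eq_mk (r := s i) (m i) (n i)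
  refine ⟨a, funext fun i => ?_⟩
  by_cases hi : i = i₀
  · subst hi
    rw [h.eq_zero (b i), h.eq_zero (h.locProd a i)]
  · apply powers_smul_injective (n i)
    rw [hb, ← h.pow_smul_locProd (ha i)]
    exact congrArg (fun c : A => c ^ n i • h.locProd a i) (h.of_ne i hi)

lemma apply_eq_zero_of_locProd_eq_zero {e : LocProd s M} (he : h.locProd e = 0) {i : ι}
    (hi : i ≠ i₀) : e i = 0 := by
  obtain ⟨n, m, hm⟩ := exists_pow_smul_eq (e i)
  have h₁ := h.pow_smul_locProd hm
  rw [he, Pi.zero_apply, smul_zero, eq_comm, mkLinearMap_eq_zero_iff] at h₁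
  simp only [h.of_ne i hi] at h₁
  rw [← mkLinearMap_eq_zero_iff] at h₁
  apply powers_smul_injective n
  rw [hm, h₁, smul_zero]

/-- The map on cokernels forgetting the localization away from `s i₀`. -/
noncomputable def locCoker : LocCoker s M →ₗ[A] LocCoker s₀ M :=
  Submodule.mapQ _ _ h.locProd <| by
    rintro _ ⟨m, rfl⟩
    exact ⟨m, (h.locProd_toLocProd m).symm⟩

lemma locCoker_mk (e : LocProd s M) :
    h.locCoker (Submodule.Quotient.mk e) = Submodule.Quotient.mk (h.locProd e) := rfl

lemma locCoker_surjective : Function.Surjective (h.locCoker (M := M)) := by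
  intro c
  obtain ⟨e, rfl⟩ := Submodule.Quotient.mk_surjective _ c
  obtain ⟨a, rfl⟩ := h.locProd_surjective e
  exact ⟨Submodule.Quotient.mk a, rfl⟩

lemma exists_mk_eq_of_locCoker_eq_zero {c : LocCoker s M} (hc : h.locCoker c = 0) :
    ∃ e : LocProd s M, (∀ i, i ≠ i₀ → e i = 0) ∧ Submodule.Quotient.mk e = c := by
  obtain ⟨e, rfl⟩ := Submodule.Quotient.mk_surjective _ c
  rw [locCoker_mk, LocCoker.mk_eq_zero_iff] at hc
  obtain ⟨m, hm⟩ := hc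
  refine ⟨e - toLocProd s M m, fun i hi => ?_, ?_⟩
  · refine h.apply_eq_zero_of_locProd_eq_zero ?_ hi
    rw [map_sub, h.locProd_toLocProd, hm, sub_self]
  · rw [Submodule.Quotient.mk_sub, sub_eq_self]
    exact (LocCoker.mk_eq_zero_iff _).2 ⟨m, rfl⟩

variable [Finite ι] (hM : NoSocle s M) (hC : NoSocle s (LocCoker s M))

include h hM hC in
/-- Torsion with respect to `s₀` is divisible by `s i₀`. -/
lemma exists_smul_eq_of_toLocProd_eq_zero (m : M) (hm : toLocProd s₀ M m = 0) :
    ∃ m', toLocProd s₀ M m' = 0 ∧ s i₀ • m' = m := by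
  classical
  refine induction_of_toLocProd_eq_zero (s := s₀)
    (Q := fun m => toLocProd s₀ M m = 0 → ∃ m', toLocProd s₀ M m' = 0 ∧ s i₀ • m' = m)
    (fun _ => ⟨0, map_zero _, smul_zero _⟩) (fun m ih hm => ?_) m hm hm
  choose d hd hdm using fun i => ih i (by rw [map_smul, hm, smul_zero])
  have hzero : ∀ m : M, toLocProd s₀ M m = 0 → ∀ i, i ≠ i₀ → toLocProd s M m i = 0 :=
    fun m hm i hi => h.apply_eq_zero_of_locProd_eq_zero (by rw [h.locProd_toLocProd, hm]) hi
  obtain ⟨a, ha⟩ := exists_smul_eq_mk (r := s i₀) m 1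
  rw [pow_one] at ha
  obtain ⟨e, he₀, he⟩ : ∃ e : LocProd s M, e i₀ = a ∧ ∀ j ≠ i₀, e j = 0 :=
    ⟨Pi.single i₀ a, Pi.single_eq_same _ _, fun j hj => Pi.single_eq_of_ne hj _⟩
  have hse : ∀ i, ∃ y, toLocProd s M y = s i • e := by
    intro i
    by_cases hi : i = i₀
    · subst hi
      refine ⟨m, funext fun j => ?_⟩
      by_cases hj : j = i
      · subst hj
        rw [Pi.smul_apply, he₀, ha]
        rfl
      · rw [Pi.smul_apply, he j hj, smul_zero, hzero m hm j hj]
    · refine ⟨d i, funext fun j => ?_⟩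
      by_cases hj : j = i₀
      · subst hj
        rw [Pi.smul_apply, he₀]
        apply powers_smul_injective 1
        rw [pow_one, smul_comm, ha, toLocProd_apply, ← map_smul, ← map_smul, hdm, h.of_ne i hi]
      · rw [Pi.smul_apply, he j hj, smul_zero, hzero _ (hd i) j hj]
  obtain ⟨m', hm'⟩ := (LocCoker.mk_eq_zero_iff e).1 (hC _ fun i => by
    rw [← Submodule.Quotient.mk_smul, LocCoker.mk_eq_zero_iff]
    exact hse i)
  refine ⟨m', ?_, hM.toLocProd_injective (funext fun j => ?_)⟩
  · rw [← h.locProd_toLocProd, hm']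
    funext j
    by_cases hj : j = i₀
    · subst hj
      exact h.eq_zero _
    · exact h.locProd_apply_eq_zero (he j hj)
  · rw [map_smul, hm', Pi.smul_apply]
    by_cases hj : j = i₀
    · subst hj
      rw [he₀, ha]
      rfl
    · rw [he j hj, smul_zero, hzero m hm j hj]

include hM hC in
lemma exists_linearEquiv_smul_ker :
    ∃ e : LinearMap.ker (h.locCoker (M := M)) ≃ₗ[A] LinearMap.ker (h.locCoker (M := M)),
      ∀ x, e x = s i₀ • x := by
  classical
  refine ⟨LinearEquiv.ofBijective (LinearMap.lsmul A _ (s i₀)) ⟨?_, ?_⟩, fun x => rfl⟩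
  · refine (injective_iff_map_eq_zero _).2 ?_
    rintro ⟨c, hc⟩ hsc
    replace hsc : s i₀ • c = 0 := congrArg Subtype.val hsc
    rw [Subtype.ext_iff]
    change c = 0
    obtain ⟨e, he, rfl⟩ := h.exists_mk_eq_of_locCoker_eq_zero hc
    rw [← Submodule.Quotient.mk_smul, LocCoker.mk_eq_zero_iff] at hsc
    obtain ⟨m, hm⟩ := hsc
    have hm₀ : toLocProd s₀ M m = 0 := by
      rw [← h.locProd_toLocProd, hm]
      funext j
      by_cases hj : j = i₀
      · subst hj
        exact h.eq_zero _
      · exact h.locProd_apply_eq_zero (by rw [Pi.smul_apply, he j hj, smul_zero])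
    obtain ⟨m', hm', rfl⟩ := h.exists_smul_eq_of_toLocProd_eq_zero hM hC m hm₀
    refine (LocCoker.mk_eq_zero_iff e).2 ⟨m', funext fun j => ?_⟩
    by_cases hj : j = i₀
    · subst hj
      apply powers_smul_injective 1
      have := congrFun hm j
      rw [map_smul] at this
      rw [pow_one]
      exact this
    · rw [he j hj]
      exact h.apply_eq_zero_of_locProd_eq_zero (by rw [h.locProd_toLocProd, hm']) hj
  · rintro ⟨c, hc⟩
    obtain ⟨e, he, rfl⟩ := h.exists_mk_eq_of_locCoker_eq_zero hc
    obtain ⟨b, hb⟩ := exists_smul_eq (e i₀)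
    obtain ⟨e', he'₀, he'⟩ : ∃ e' : LocProd s M, e' i₀ = b ∧ ∀ j ≠ i₀, e' j = 0 :=
      ⟨Pi.single i₀ b, Pi.single_eq_same _ _, fun j hj => Pi.single_eq_of_ne hj _⟩
    refine ⟨⟨Submodule.Quotient.mk e', ?_⟩, Subtype.ext ?_⟩
    · rw [LinearMap.mem_ker, locCoker_mk, LocCoker.mk_eq_zero_iff]
      refine ⟨0, funext fun j => ?_⟩
      rw [map_zero]
      by_cases hj : j = i₀
      · subst hj
        exact (h.eq_zero _).symm
      · exact (h.locProd_apply_eq_zero (he' j hj)).symm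
    · change s i₀ • Submodule.Quotient.mk e' = Submodule.Quotient.mk e
      rw [← Submodule.Quotient.mk_smul]
      congr 1
      funext j
      by_cases hj : j = i₀
      · subst hj
        rw [Pi.smul_apply, he'₀, hb]
      · rw [Pi.smul_apply, he' j hj, smul_zero, he j hj]

omit [Finite ι] in
lemma familyShortExact_locCoker :
    FamilyShortExact
      (FamilyHom.ofLinear s (LinearMap.ker (h.locCoker (M := M))).subtype)
      (FamilyHom.ofLinear s h.locCoker) where
  injective := Subtype.val_injective
  surjective := h.locCoker_surjective
  comp_eq_zero x := x.2
  exact y hy := ⟨⟨y, hy⟩, rfl⟩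

end IsZeroedAt

/-- If `M₀` is a retract of `M` compatibly with all operators but `s i₀`, and the retraction kills
the image of `s i₀`, then the depth drops by at most one from `M` to `M₀`. -/
lemma DepthGE.of_retract [Finite ι] {p : ℕ} {i₀ : ι} (h : IsZeroedAt i₀ s s₀)
    (α : FamilyHom s' s₀ M₀ M) (β : FamilyHom s₀ s' M M₀) (hβα : Function.LeftInverse β α)
    (hβ : ∀ m, β (s i₀ • m) = 0) (hM : DepthGE s (p + 1) M) : DepthGE s' p M₀ := by
  induction p generalizing M M₀ with
  | zero => trivial
  | succ p ih =>
    refine ⟨fun m hm => ?_, ih α.locCoker β.locCoker (FamilyHom.locCoker_leftInverse α β hβα)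
      (FamilyHom.locCoker_smul_eq_zero β hβ) ?_⟩
    · have hα : toLocProd s₀ M (α m) = 0 := by
        rw [toLocProd_eq_zero_iff]
        refine fun i => ⟨1, ?_⟩
        rw [pow_one, ← α.map_smul, hm, α.map_zero]
      obtain ⟨m', -, h₁⟩ := h.exists_smul_eq_of_toLocProd_eq_zero hM.1 hM.2.1 _ hα
      rw [← hβα m, ← h₁, hβ]
    · obtain ⟨e, he⟩ := h.exists_linearEquiv_smul_ker hM.1 hM.2.1
      exact (DepthGE.right h.familyShortExact_locCoker
        (DepthGE.of_linearEquiv_smul _ e he) hM.2 :)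

end OperatorFamilies

section ExtCocycles

open CategoryTheory Limits Opposite

variable {A : Type} [CommRing A]

/-- The map induced by a chain map on complexes of morphisms to `Z`. -/
noncomputable def linearYonedaObjMap {P Q : ChainComplex (ModuleCat.{0} A) ℕ} (φ : P ⟶ Q)
    (Z : ModuleCat.{0} A) : Q.linearYonedaObj A Z ⟶ P.linearYonedaObj A Z :=
  (HomologicalComplex.unopFunctor _ _).map
    ((((linearYoneda A (ModuleCat.{0} A)).obj Z).rightOp.mapHomologicalComplex _).map φ).op

lemma homologyUnop_hom_naturality {K L : HomologicalComplex (ModuleCat.{0} A)ᵒᵖ (ComplexShape.down ℕ)}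
    (φ : K ⟶ L) (i : ℕ) :
    HomologicalComplex.homologyMap ((HomologicalComplex.unopFunctor _ _).map φ.op) i ≫
        (K.homologyUnop i).hom =
      (L.homologyUnop i).hom ≫ (HomologicalComplex.homologyMap φ i).unop :=
  congrArg Quiver.Hom.unop (HomologicalComplex.homologyOp_hom_naturality
    ((HomologicalComplex.unopFunctor _ _).map φ.op) i).symm

lemma isoExt_hom_naturality {X Y : ModuleCat.{0} A} (f : X ⟶ Y) (P : ProjectiveResolution X)
    (Q : ProjectiveResolution Y) (φ : P.complex ⟶ Q.complex)
    (comm : φ.f 0 ≫ Q.π.f 0 = P.π.f 0 ≫ f) (i : ℕ) (Z : ModuleCat.{0} A) :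
    (((Ext A (ModuleCat.{0} A) i).map f.op).app Z) ≫ (P.isoExt i Z).hom =
      (Q.isoExt i Z).hom ≫ HomologicalComplex.homologyMap (linearYonedaObjMap φ Z) i := by
  rw [← Iso.inv_comp_eq, ← Category.assoc, ← Iso.eq_comp_inv]
  have h₁ := homologyUnop_hom_naturality
    ((((linearYoneda A (ModuleCat.{0} A)).obj Z).rightOp.mapHomologicalComplex _).map φ) i
  have h₂ := congrArg Quiver.Hom.unop (ProjectiveResolution.isoLeftDerivedObj_hom_naturality f P Q φ comm
    ((linearYoneda A (ModuleCat.{0} A)).obj Z).rightOp i)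
  have key : ∀ {X₁ X₂ X₃ Y₁ Y₂ Y₃ : ModuleCat.{0} A} {a : X₁ ⟶ X₂} {b : X₂ ⟶ X₃} {c : Y₁ ⟶ Y₂}
      {d : Y₂ ⟶ Y₃} {u : X₁ ⟶ Y₁} {v : X₂ ⟶ Y₂} {w : X₃ ⟶ Y₃}, u ≫ c = a ≫ v → b ≫ w = v ≫ d →
      (a ≫ b) ≫ w = u ≫ c ≫ d := by
    intro X₁ X₂ X₃ Y₁ Y₂ Y₃ a b c d u v w h h'
    rw [Category.assoc, h', ← Category.assoc, ← h, Category.assoc]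
  exact key h₁ h₂

lemma exists_homologyπ_eq (K : CochainComplex (ModuleCat.{0} A) ℕ) (i : ℕ) (x : K.homology i) :
    ∃ z : K.cycles i, K.homologyπ i z = x :=
  (ModuleCat.epi_iff_surjective _).1 inferInstance x

lemma d_iCycles_apply (K : CochainComplex (ModuleCat.{0} A) ℕ) (i j : ℕ) (z : K.cycles i) :
    K.d i j (K.iCycles i z) = 0 := by
  rw [← ModuleCat.comp_apply, HomologicalComplex.iCycles_d]
  rfl

lemma exists_iCycles_eq (K : CochainComplex (ModuleCat.{0} A) ℕ) (i : ℕ) (c : K.X i)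
    (hc : K.d i (i + 1) c = 0) : ∃ z : K.cycles i, K.iCycles i z = c := by
  have hk : ModuleCat.ofHom (LinearMap.toSpanSingleton A _ c) ≫ K.d i (i + 1) = 0 := by
    ext
    simpa using hc
  refine ⟨K.liftCycles _ (i + 1) (by simp) hk (1 : A), ?_⟩
  rw [← ModuleCat.comp_apply, HomologicalComplex.liftCycles_i]
  simp

lemma homologyπ_eq_zero_iff (K : CochainComplex (ModuleCat.{0} A) ℕ) (i : ℕ) (z : K.cycles i) :
    K.homologyπ i z = 0 ↔ ∃ y : K.X (i - 1), K.d (i - 1) i y = K.iCycles i z := by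
  have hprev : (ComplexShape.up ℕ).prev i = i - 1 := by cases i <;> simp
  have hex := ShortComplex.exact_of_g_is_cokernel
    (ShortComplex.mk _ _ (K.toCycles_comp_homologyπ (i - 1) i)) (K.homologyIsCokernel (i - 1) i hprev)
  rw [ShortComplex.moduleCat_exact_iff] at hex
  have hinj : Function.Injective (K.iCycles i) := (ModuleCat.mono_iff_injective _).1 inferInstance
  constructor
  · intro hz
    obtain ⟨y, hy⟩ := hex z hz
    refine ⟨y, ?_⟩
    rw [← hy, ← K.toCycles_i (i - 1) i]
    rfl
  · rintro ⟨y, hy⟩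
    have : K.toCycles (i - 1) i y = z := by
      apply hinj
      rw [← hy, ← K.toCycles_i (i - 1) i]
      rfl
    rw [← this, ← ModuleCat.comp_apply, K.toCycles_comp_homologyπ]
    rfl

lemma homologyMap_homologyπ_eq_zero_iff {K K' : CochainComplex (ModuleCat.{0} A) ℕ} (φ : K ⟶ K')
    (i : ℕ) (z : K.cycles i) :
    HomologicalComplex.homologyMap φ i (K.homologyπ i z) = 0 ↔
      ∃ y : K'.X (i - 1), K'.d (i - 1) i y = φ.f i (K.iCycles i z) := by
  rw [← ModuleCat.comp_apply, HomologicalComplex.homologyπ_naturality, ModuleCat.comp_apply,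
    homologyπ_eq_zero_iff, ← ModuleCat.comp_apply, HomologicalComplex.cyclesMap_i]
  rfl

/-- The cocycle `c` represents the class `x` in the `Ext` module computed by `Q`. -/
def RepresentsExt {Y : ModuleCat.{0} A} (Q : ProjectiveResolution Y) (i : ℕ) {Z : ModuleCat.{0} A}
    (c : Q.complex.X i ⟶ Z) (x : ((Ext A (ModuleCat.{0} A) i).obj (op Y)).obj Z) : Prop :=
  ∃ z : (Q.complex.linearYonedaObj A Z).cycles i,
    (Q.complex.linearYonedaObj A Z).iCycles i z = c ∧
      (Q.complex.linearYonedaObj A Z).homologyπ i z = (Q.isoExt i Z).hom x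

lemma exists_representsExt_left {Y : ModuleCat.{0} A} (Q : ProjectiveResolution Y) (i : ℕ)
    {Z : ModuleCat.{0} A} (c : Q.complex.X i ⟶ Z) (hc : Q.complex.d (i + 1) i ≫ c = 0) :
    ∃ x, RepresentsExt Q i c x := by
  obtain ⟨z, hz⟩ := exists_iCycles_eq (Q.complex.linearYonedaObj A Z) i c hc
  refine ⟨(Q.isoExt i Z).inv ((Q.complex.linearYonedaObj A Z).homologyπ i z), z, hz, ?_⟩
  rw [← ModuleCat.comp_apply, Iso.inv_hom_id]
  rfl

lemma exists_representsExt_right {Y : ModuleCat.{0} A} (Q : ProjectiveResolution Y) (i : ℕ)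
    {Z : ModuleCat.{0} A} (x : ((Ext A (ModuleCat.{0} A) i).obj (op Y)).obj Z) :
    ∃ c : Q.complex.X i ⟶ Z, Q.complex.d (i + 1) i ≫ c = 0 ∧ RepresentsExt Q i c x := by
  obtain ⟨z, hz⟩ := exists_homologyπ_eq (Q.complex.linearYonedaObj A Z) i ((Q.isoExt i Z).hom x)
  exact ⟨_, d_iCycles_apply (Q.complex.linearYonedaObj A Z) i (i + 1) z, z, rfl, hz⟩

lemma RepresentsExt.map_apply_eq_zero_iff {X Y : ModuleCat.{0} A} {Q : ProjectiveResolution Y} {i : ℕ}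
    {Z : ModuleCat.{0} A} {c : Q.complex.X i ⟶ Z}
    {x : ((Ext A (ModuleCat.{0} A) i).obj (op Y)).obj Z} (h : RepresentsExt Q i c x)
    (f : X ⟶ Y) (P : ProjectiveResolution X) (φ : P.complex ⟶ Q.complex)
    (comm : φ.f 0 ≫ Q.π.f 0 = P.π.f 0 ≫ f) :
    (((Ext A (ModuleCat.{0} A) i).map f.op).app Z) x = 0 ↔
      ∃ k : P.complex.X (i - 1) ⟶ Z, P.complex.d i (i - 1) ≫ k = φ.f i ≫ c := by
  obtain ⟨z, rfl, hx⟩ := h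
  refine Iff.trans ?_ (homologyMap_homologyπ_eq_zero_iff (linearYonedaObjMap φ Z) i z)
  have hinj : Function.Injective (P.isoExt (R := A) i Z).hom :=
    (ModuleCat.mono_iff_injective _).1 inferInstance
  have hnat := congrArg (fun g => g x) (isoExt_hom_naturality f P Q φ comm i Z)
  rw [hx, ← map_eq_zero_iff _ hinj]
  exact Eq.congr_left hnat

end ExtCocycles

section LocalCohomologyVanishing

open CategoryTheory Limits Opposite

variable {A : Type} [CommRing A]
open localCohomology

/-- The quotient map `A ⧸ J ^ m → A ⧸ J ^ n` for `n ≤ m`. -/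
noncomputable def powQuotMap (J : Ideal A) {n m : ℕ} (h : n ≤ m) :
    ModuleCat.of A (A ⧸ J ^ m) ⟶ ModuleCat.of A (A ⧸ J ^ n) :=
  (ringModIdeals (idealPowersDiagram J)).map (homOfLE h).op

lemma subsingleton_localCohomology_iff_ext (J : Ideal A) (i : ℕ) (M : ModuleCat.{0} A) :
    Subsingleton ((localCohomology J i).obj M) ↔
      ∀ (n : ℕ) (x : ((Ext A (ModuleCat.{0} A) i).obj (op (ModuleCat.of A (A ⧸ J ^ n)))).obj M),
        ∃ (m : ℕ) (h : n ≤ m),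
          (((Ext A (ModuleCat.{0} A) i).map (powQuotMap J h).op).app M) x = 0 := by
  let F := diagram (idealPowersDiagram J) i ⋙ (evaluation _ _).obj M
  have e : (localCohomology J i).obj M ≅ colimit F :=
    colimitObjIsoColimitCompEvaluation (diagram (idealPowersDiagram J) i) M
  have h₁ : Subsingleton ((localCohomology J i).obj M) ↔ Subsingleton (colimit F : ModuleCat A) :=
    e.toLinearEquiv.toEquiv.subsingleton_congr
  rw [h₁]
  constructor
  · intro h n x
    obtain ⟨m, g, hg⟩ := Concrete.colimit_rep_eq_zero A F (op (op n)) x (Subsingleton.elim _ _)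
    exact ⟨m.unop.unop, leOfHom g.unop.unop, hg⟩
  · intro h
    refine subsingleton_of_forall_eq 0 fun y => ?_
    obtain ⟨j, x, rfl⟩ := Concrete.colimit_exists_rep F y
    obtain ⟨m, hm, hx⟩ := h j.unop.unop x
    let g : j ⟶ op (op m) := (homOfLE hm).op.op
    have h₂ : F.map g x = 0 := hx
    rw [← colimit.w F g, ModuleCat.comp_apply, h₂, map_zero]

/-- Vanishing of local cohomology in terms of cocycles. -/
lemma subsingleton_localCohomology_iff (J : Ideal A) (i : ℕ) (M : ModuleCat.{0} A) :
    Subsingleton ((localCohomology J i).obj M) ↔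
      ∀ (n : ℕ) (c : (projectiveResolution (ModuleCat.of A (A ⧸ J ^ n))).complex.X i ⟶ M),
        (projectiveResolution (ModuleCat.of A (A ⧸ J ^ n))).complex.d (i + 1) i ≫ c = 0 →
        ∃ (m : ℕ) (h : n ≤ m)
          (k : (projectiveResolution (ModuleCat.of A (A ⧸ J ^ m))).complex.X (i - 1) ⟶ M),
          (projectiveResolution (ModuleCat.of A (A ⧸ J ^ m))).complex.d i (i - 1) ≫ k =
            (ProjectiveResolution.lift (powQuotMap J h) _ _).f i ≫ c := by
  rw [subsingleton_localCohomology_iff_ext]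
  refine forall_congr' fun n => ⟨fun h c hc => ?_, fun h x => ?_⟩
  · obtain ⟨x, hx⟩ := exists_representsExt_left _ i c hc
    obtain ⟨m, hm, h₀⟩ := h x
    exact ⟨m, hm, (hx.map_apply_eq_zero_iff _ _ _ (ProjectiveResolution.lift_commutes_zero _ _ _)).1 h₀⟩
  · obtain ⟨c, hc, hx⟩ := exists_representsExt_right
      (projectiveResolution (ModuleCat.of A (A ⧸ J ^ n))) i x
    obtain ⟨m, hm, h₀⟩ := h c hc
    exact ⟨m, hm, (hx.map_apply_eq_zero_iff _ _ _ (ProjectiveResolution.lift_commutes_zero _ _ _)).2 h₀⟩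

end LocalCohomologyVanishing

section LocalCohomologyDepth

open CategoryTheory Limits Opposite

variable {A : Type} [CommRing A]

/-- The chosen projective resolution of `A ⧸ J ^ n`. -/
noncomputable abbrev powRes (J : Ideal A) (n : ℕ) :
    ProjectiveResolution (ModuleCat.of A (A ⧸ J ^ n)) :=
  projectiveResolution (ModuleCat.of A (A ⧸ J ^ n))

/-- The chosen lift of `A ⧸ J ^ m → A ⧸ J ^ n` to projective resolutions. -/
noncomputable abbrev powResMap (J : Ideal A) {n m : ℕ} (h : n ≤ m) :
    (powRes J m).complex ⟶ (powRes J n).complex :=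
  ProjectiveResolution.lift (powQuotMap J h) _ _

lemma subsingleton_localCohomology_succ_iff (J : Ideal A) (i : ℕ) {S : ShortComplex (ModuleCat.{0} A)}
    (hS : S.ShortExact)
    (hE : ∀ (n j : ℕ) (c : (powRes J n).complex.X j ⟶ S.X₂),
      (powRes J n).complex.d (j + 1) j ≫ c = 0 →
        ∃ k : (powRes J n).complex.X (j - 1) ⟶ S.X₂, (powRes J n).complex.d j (j - 1) ≫ k = c) :
    Subsingleton ((localCohomology J (i + 1)).obj S.X₁) ↔
      Subsingleton ((localCohomology J i).obj S.X₃) := by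
  have := hS.mono_f
  have := hS.epi_g
  rw [subsingleton_localCohomology_iff, subsingleton_localCohomology_iff]
  constructor
  · intro h n c hc
    obtain ⟨c', rfl⟩ : ∃ c', c' ≫ S.g = c := ⟨_, Projective.factorThru_comp c S.g⟩
    obtain ⟨f, hf⟩ : ∃ f, f ≫ S.f = (powRes J n).complex.d (i + 1) i ≫ c' :=
      ⟨_, hS.exact.lift_f _ (by rw [Category.assoc, hc])⟩
    obtain ⟨m, hm, (k : (powRes J m).complex.X i ⟶ S.X₁), hk⟩ := h n f (by
      rw [← cancel_mono S.f, Category.assoc, hf, ← Category.assoc, HomologicalComplex.d_comp_d,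
        zero_comp, zero_comp])
    obtain ⟨l, hl⟩ := hE m i ((powResMap J hm).f i ≫ c' - k ≫ S.f) (by
      rw [Preadditive.comp_sub, ← Category.assoc, ← Category.assoc, ← HomologicalComplex.Hom.comm,
        Category.assoc, ← hf, ← Category.assoc, ← hk]
      exact sub_self _)
    refine ⟨m, hm, l ≫ S.g, ?_⟩
    rw [← Category.assoc, hl, Preadditive.sub_comp, Category.assoc, Category.assoc, S.zero,
      comp_zero, sub_zero]
  · intro h n c hc
    obtain ⟨k, hk⟩ := hE n (i + 1) (c ≫ S.f) (by rw [← Category.assoc, hc, zero_comp])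
    obtain ⟨m, hm, l, hl⟩ := h n (k ≫ S.g) (by
      rw [← Category.assoc]
      exact (congrArg (· ≫ S.g) hk).trans (by rw [Category.assoc, S.zero, comp_zero]))
    obtain ⟨l', rfl⟩ : ∃ l', l' ≫ S.g = l := ⟨_, Projective.factorThru_comp l S.g⟩
    obtain ⟨k', hk'⟩ : ∃ k', k' ≫ S.f =
        (powResMap J hm).f i ≫ k - (powRes J m).complex.d i (i - 1) ≫ l' :=
      ⟨_, hS.exact.lift_f _ (by
        rw [Preadditive.sub_comp, Category.assoc, Category.assoc, hl, sub_self])⟩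
    refine ⟨m, hm, k', ?_⟩
    rw [← cancel_mono S.f, Category.assoc, Category.assoc, ← hk]
    change (powRes J m).complex.d (i + 1) i ≫ k' ≫ S.f =
      (powResMap J hm).f (i + 1) ≫ (powRes J n).complex.d (i + 1) i ≫ k
    rw [hk', Preadditive.comp_sub, ← Category.assoc, ← Category.assoc _ _ l',
      HomologicalComplex.d_comp_d, zero_comp, sub_zero, ← HomologicalComplex.Hom.comm,
      Category.assoc]

/-- Cocycles with values in a module on which some element of `J` acts bijectively are
coboundaries. -/
lemma exists_coboundary_of_bijective (J : Ideal A) {r : A} (hr : r ∈ J) {N : Type}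
    [AddCommGroup N] [Module A N] (hN : Function.Bijective fun x : N => r • x) (n i : ℕ)
    (c : (powRes J n).complex.X i ⟶ ModuleCat.of A N)
    (hc : (powRes J n).complex.d (i + 1) i ≫ c = 0) :
    ∃ k : (powRes J n).complex.X (i - 1) ⟶ ModuleCat.of A N,
      (powRes J n).complex.d i (i - 1) ≫ k = c := by
  have h0 : ∀ x : A ⧸ J ^ n, r ^ n • x = 0 := by
    intro x
    obtain ⟨a, rfl⟩ := Ideal.Quotient.mk_surjective x
    exact Ideal.Quotient.eq_zero_iff_mem.2 (Ideal.mul_mem_right _ _ (Ideal.pow_mem_pow hr n))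
  have hπ : (r ^ n • 𝟙 (powRes J n).complex) ≫ (powRes J n).π = 0 := by
    refine HomologicalComplex.to_single_hom_ext ?_
    ext x
    change (powRes J n).π.f 0 (r ^ n • x) = 0
    rw [map_smul]
    exact h0 ((powRes J n).π.f 0 x)
  let H : Homotopy (r ^ n • 𝟙 (powRes J n).complex) 0 :=
    ProjectiveResolution.liftHomotopy 0 _ _ (hπ.trans (by simp)) (by simp)
  have hpow : Function.Bijective fun x : N => r ^ n • x := by
    have := hN.iterate n
    rwa [smul_iterate] at this
  let e : N ≃ₗ[A] N := LinearEquiv.ofBijective (LinearMap.lsmul A N (r ^ n)) hpow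
  have hcomm := H.comm i
  refine ⟨H.hom (i - 1) i ≫ c ≫ ModuleCat.ofHom e.symm.toLinearMap, ?_⟩
  have h₁ : r ^ n • c = (powRes J n).complex.d i (i - 1) ≫ H.hom (i - 1) i ≫ c := by
    have h₃ : r ^ n • 𝟙 _ = (powRes J n).complex.d i (i - 1) ≫ H.hom (i - 1) i +
        H.hom i (i + 1) ≫ (powRes J n).complex.d (i + 1) i := by
      refine hcomm.trans ?_
      rw [HomologicalComplex.zero_f, add_zero, Homotopy.prevD_chainComplex]
      congr 1
      cases i with
      | zero => rw [Homotopy.dNext_zero_chainComplex, HomologicalComplex.shape _ _ _ (by simp),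
          zero_comp]
      | succ i => exact Homotopy.dNext_succ_chainComplex _ i
    rw [← Category.id_comp c, ← Linear.smul_comp, h₃, Preadditive.add_comp, Category.assoc,
      Category.assoc, hc, comp_zero, add_zero, Category.id_comp]
  ext x
  apply e.injective
  have h₂ := congrArg (fun g => g x) h₁
  exact (e.apply_symm_apply _).trans h₂.symm

lemma exists_coboundary_locProd {ι : Type} {s : ι → A} {J : Ideal A} (hs : ∀ j, s j ∈ J)
    {N : Type} [AddCommGroup N] [Module A N] (n i : ℕ)
    (c : (powRes J n).complex.X i ⟶ ModuleCat.of A (LocProd s N))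
    (hc : (powRes J n).complex.d (i + 1) i ≫ c = 0) :
    ∃ k : (powRes J n).complex.X (i - 1) ⟶ ModuleCat.of A (LocProd s N),
      (powRes J n).complex.d i (i - 1) ≫ k = c := by
  have hbij : ∀ j, Function.Bijective
      fun x : LocalizedModule (Submonoid.powers (s j)) N => s j • x := fun j =>
    ⟨fun a b hab => LocalizedModule.powers_smul_injective 1 (by simpa using hab),
      LocalizedModule.exists_smul_eq⟩
  choose k hk using fun j => exists_coboundary_of_bijective J (hs j) (hbij j) n i
    (c ≫ ModuleCat.ofHom (LinearMap.proj j)) (by rw [← Category.assoc, hc, zero_comp])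
  refine ⟨ModuleCat.ofHom (LinearMap.pi fun j => (k j).hom), ?_⟩
  ext x j
  exact congrArg (fun g => g x) (hk j)

/-- The augmentation of the chosen projective resolution of `A ⧸ J ^ n`. -/
noncomputable def powResAug (J : Ideal A) (n : ℕ) :
    (powRes J n).complex.X 0 ⟶ ModuleCat.of A (A ⧸ J ^ n) :=
  (powRes J n).π.f 0

lemma d_comp_powResAug (J : Ideal A) (n : ℕ) :
    (powRes J n).complex.d 1 0 ≫ powResAug J n = 0 :=
  (powRes J n).complex_d_comp_π_f_zero

instance epi_powResAug (J : Ideal A) (n : ℕ) : Epi (powResAug J n) :=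
  inferInstanceAs (Epi ((powRes J n).π.f 0))

lemma powResMap_comp_powResAug (J : Ideal A) {n m : ℕ} (h : n ≤ m) :
    (powResMap J h).f 0 ≫ powResAug J n = powResAug J m ≫ powQuotMap J h :=
  ProjectiveResolution.lift_commutes_zero _ _ _

lemma exists_powResAug_comp_eq (J : Ideal A) (n : ℕ) {Z : ModuleCat.{0} A}
    (c : (powRes J n).complex.X 0 ⟶ Z) (hc : (powRes J n).complex.d 1 0 ≫ c = 0) :
    ∃ g : ModuleCat.of A (A ⧸ J ^ n) ⟶ Z, powResAug J n ≫ g = c :=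
  ⟨(powRes J n).exact₀.desc c hc, (powRes J n).exact₀.g_desc c hc⟩

lemma subsingleton_localCohomology_zero_iff {ι : Type} [Finite ι] (s : ι → A)
    (M : Type) [AddCommGroup M] [Module A M] :
    Subsingleton ((localCohomology (Ideal.span (Set.range s)) 0).obj (ModuleCat.of A M)) ↔
      NoSocle s M := by
  rw [subsingleton_localCohomology_iff]
  constructor
  · intro h m hm
    have hle : Ideal.span (Set.range s) ^ 1 ≤ LinearMap.ker (LinearMap.toSpanSingleton A M m) := by
      rw [pow_one, Ideal.span_le]
      rintro _ ⟨i, rfl⟩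
      exact hm i
    let g : ModuleCat.of A (A ⧸ Ideal.span (Set.range s) ^ 1) ⟶ ModuleCat.of A M :=
      ModuleCat.ofHom (Submodule.liftQ _ (LinearMap.toSpanSingleton A M m) hle)
    obtain ⟨n, hn, k, hk⟩ := h 1 (powResAug _ 1 ≫ g) (by
      rw [← Category.assoc, d_comp_powResAug, zero_comp])
    rw [HomologicalComplex.shape _ _ _ (by simp), zero_comp, ← Category.assoc,
      powResMap_comp_powResAug, Category.assoc] at hk
    have hz : powQuotMap (Ideal.span (Set.range s)) hn ≫ g = 0 :=
      (cancel_epi (powResAug _ n)).1 (hk.symm.trans comp_zero.symm)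
    have := congrArg (fun f => f (Ideal.Quotient.mk _ 1)) hz
    exact (one_smul A m).symm.trans this
  · intro h n c hc
    obtain ⟨g, rfl⟩ := exists_powResAug_comp_eq _ n c hc
    have hz : g = 0 := by
      refine ModuleCat.hom_ext (LinearMap.ext fun x => ?_)
      obtain ⟨a, rfl⟩ := Ideal.Quotient.mk_surjective x
      apply h.toLocProd_injective
      change toLocProd s M (g (Ideal.Quotient.mk _ a)) = toLocProd s M 0
      rw [map_zero, toLocProd_eq_zero_iff]
      refine fun i => ⟨n, ?_⟩
      rw [← map_smul]
      have : s i ^ n • (Ideal.Quotient.mk (Ideal.span (Set.range s) ^ n) a) = 0 :=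
        Ideal.Quotient.eq_zero_iff_mem.2 (Ideal.mul_mem_right _ _
          (Ideal.pow_mem_pow (Ideal.subset_span (Set.mem_range_self i)) n))
      exact (congrArg g this).trans (map_zero _)
    exact ⟨n, le_rfl, 0, by rw [hz, comp_zero, comp_zero, comp_zero]⟩

/-- `DepthGE` is characterized by the vanishing of local cohomology. -/
theorem depthGE_iff_subsingleton_localCohomology {ι : Type} [Finite ι] (s : ι → A) (p : ℕ)
    (M : Type) [AddCommGroup M] [Module A M] :
    DepthGE s p M ↔ ∀ i < p,
      Subsingleton ((localCohomology (Ideal.span (Set.range s)) i).obj (ModuleCat.of A M)) := by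
  induction p generalizing M with
  | zero => exact ⟨fun _ i hi => absurd hi i.not_lt_zero, fun _ => trivial⟩
  | succ p ih =>
    rw [Nat.forall_lt_succ_left, subsingleton_localCohomology_zero_iff]
    refine and_congr_right fun hM => ?_
    rw [ih]
    refine forall₂_congr fun i _ => ?_
    let S : ShortComplex (ModuleCat.{0} A) := ShortComplex.mk
      (ModuleCat.ofHom (toLocProd s M)) (ModuleCat.ofHom (LinearMap.range (toLocProd s M)).mkQ)
      (by ext m; exact (LocCoker.mk_eq_zero_iff (toLocProd s M m)).2 ⟨m, rfl⟩)
    have hS : S.ShortExact :=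
      { exact := (ShortComplex.moduleCat_exact_iff S).2 fun x hx => (LocCoker.mk_eq_zero_iff x).1 hx
        mono_f := (ModuleCat.mono_iff_injective _).2 hM.toLocProd_injective
        epi_g := (ModuleCat.epi_iff_surjective _).2 (Submodule.mkQ_surjective _) }
    exact (subsingleton_localCohomology_succ_iff _ i hS
      (exists_coboundary_locProd fun j => Ideal.subset_span (Set.mem_range_self j))).symm

end LocalCohomologyDepth

section MonomialIdeals

variable {k : Type} [Field k] {V : Type}

/-- An ideal of a polynomial ring is monomial if it contains all monomials occurring in its
members. -/
def IsMonomialIdeal (I : Ideal (MvPolynomial V k)) : Prop :=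
  ∀ p ∈ I, ∀ d ∈ p.support, monomial d 1 ∈ I

lemma mem_of_forall_monomial_mem {I : Ideal (MvPolynomial V k)} {p : MvPolynomial V k}
    (h : ∀ d ∈ p.support, monomial d (1 : k) ∈ I) : p ∈ I := by
  rw [p.as_sum]
  refine I.sum_mem fun d hd => ?_
  rw [show monomial d (coeff d p) = C (coeff d p) * monomial d 1 by rw [C_mul_monomial, mul_one]]
  exact I.mul_mem_left _ (h d hd)

lemma monomial_mem_of_le {I : Ideal (MvPolynomial V k)} {d d' : V →₀ ℕ} (h : d ≤ d')
    (hd : monomial d (1 : k) ∈ I) : monomial d' (1 : k) ∈ I := by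
  obtain ⟨c, rfl⟩ := le_iff_exists_add.1 h
  rw [← one_mul (1 : k), ← monomial_mul]
  exact I.mul_mem_right _ hd

lemma monomial_mem_span_iff {s : Set (V →₀ ℕ)} {d : V →₀ ℕ} :
    monomial d (1 : k) ∈ Ideal.span ((fun d => monomial d (1 : k)) '' s) ↔ ∃ a ∈ s, a ≤ d := by
  classical
  rw [mem_ideal_span_monomial_image, support_monomial, if_neg one_ne_zero]
  simp

lemma isMonomialIdeal_span (s : Set (V →₀ ℕ)) :
    IsMonomialIdeal (Ideal.span ((fun d => monomial d (1 : k)) '' s)) := fun _ hp d hd =>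
  monomial_mem_span_iff.2 (mem_ideal_span_monomial_image.1 hp d hd)

lemma isMonomialIdeal_span_X (s : Set V) :
    IsMonomialIdeal (Ideal.span (X '' s : Set (MvPolynomial V k))) := by
  have := isMonomialIdeal_span (k := k) ((fun i => Finsupp.single i 1) '' s)
  rwa [Set.image_image] at this

namespace IsMonomialIdeal

variable {I J : Ideal (MvPolynomial V k)}

lemma le (hI : IsMonomialIdeal I) (h : ∀ d, monomial d (1 : k) ∈ I → monomial d (1 : k) ∈ J) :
    I ≤ J := fun p hp => mem_of_forall_monomial_mem fun d hd => h d (hI p hp d hd)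

lemma inf (hI : IsMonomialIdeal I) (hJ : IsMonomialIdeal J) : IsMonomialIdeal (I ⊓ J) :=
  fun p hp d hd => ⟨hI p hp.1 d hd, hJ p hp.2 d hd⟩

lemma sup (hI : IsMonomialIdeal I) (hJ : IsMonomialIdeal J) : IsMonomialIdeal (I ⊔ J) := by
  classical
  intro p hp d hd
  obtain ⟨a, ha, b, hb, rfl⟩ := Submodule.mem_sup.1 hp
  rcases Finset.mem_union.1 (support_add hd) with h | h
  exacts [Ideal.mem_sup_left (hI a ha d h), Ideal.mem_sup_right (hJ b hb d h)]

lemma monomial_mem_sup (hI : IsMonomialIdeal I) (hJ : IsMonomialIdeal J) {d : V →₀ ℕ}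
    (h : monomial d (1 : k) ∈ I ⊔ J) : monomial d (1 : k) ∈ I ∨ monomial d (1 : k) ∈ J := by
  classical
  obtain ⟨a, ha, b, hb, hab⟩ := Submodule.mem_sup.1 h
  have hd : d ∈ (a + b).support := by
    rw [hab, support_monomial, if_neg one_ne_zero]
    exact Finset.mem_singleton_self d
  rcases Finset.mem_union.1 (support_add hd) with h | h
  exacts [Or.inl (hI a ha d h), Or.inr (hJ b hb d h)]

lemma colon_monomial (hI : IsMonomialIdeal I) (c : V →₀ ℕ) :
    IsMonomialIdeal (Submodule.colon I {monomial c (1 : k)}) := by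
  intro p hp d hd
  rw [Submodule.mem_colon_singleton] at hp ⊢
  have h := hI _ hp (d + c) (by
    rw [mem_support_iff, smul_eq_mul, coeff_mul_monomial, mul_one]
    exact mem_support_iff.1 hd)
  rwa [smul_eq_mul, monomial_mul, one_mul]

lemma aeval_update_zero_mem [DecidableEq V] (hI : IsMonomialIdeal I) (v : V)
    {p : MvPolynomial V k} (hp : p ∈ I) :
    aeval (Function.update (X : V → MvPolynomial V k) v 0) p ∈ I := by
  rw [p.as_sum, map_sum]
  refine I.sum_mem fun d hd => ?_
  have hd' := hI p hp d hd
  rw [aeval_monomial]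
  refine I.mul_mem_left _ ?_
  by_cases hv : d v = 0
  · convert hd' using 1
    rw [monomial_eq, C_1, one_mul]
    refine Finsupp.prod_congr fun i hi => ?_
    rw [Function.update_of_ne]
    rintro rfl
    exact Finsupp.mem_support_iff.1 hi hv
  · rw [Finsupp.prod, Finset.prod_eq_zero (Finsupp.mem_support_iff.2 hv)]
    · exact I.zero_mem
    · rw [Function.update_self, zero_pow hv]

end IsMonomialIdeal

lemma aeval_update_zero_sub_mem [DecidableEq V] (v : V) (p : MvPolynomial V k) :
    aeval (Function.update (X : V → MvPolynomial V k) v 0) p - p ∈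
      Ideal.span {(X v : MvPolynomial V k)} := by
  rw [← Ideal.Quotient.eq]
  have h : (Ideal.Quotient.mkₐ k (Ideal.span {(X v : MvPolynomial V k)})).comp
      (aeval (Function.update (X : V → MvPolynomial V k) v 0)) =
      Ideal.Quotient.mkₐ k (Ideal.span {(X v : MvPolynomial V k)}) := by
    refine algHom_ext fun i => ?_
    rw [AlgHom.comp_apply, aeval_X]
    by_cases hi : i = v
    · subst hi
      rw [Function.update_self, map_zero]
      exact (Ideal.Quotient.eq_zero_iff_mem.2 (Ideal.mem_span_singleton_self _)).symm
    · rw [Function.update_of_ne hi]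
  exact congrArg (fun f => f p) h

/-- Killing one variable lowers the depth of the quotient by a monomial ideal by at most one. -/
lemma DepthGE.sup_span_X [Finite V] {I : Ideal (MvPolynomial V k)} (hI : IsMonomialIdeal I)
    (v : V) {p : ℕ} (h : DepthGE (X : V → MvPolynomial V k) (p + 1) (MvPolynomial V k ⧸ I)) :
    DepthGE (X : V → MvPolynomial V k) p
      (MvPolynomial V k ⧸ (I ⊔ Ideal.span {(X v : MvPolynomial V k)})) := by
  classical
  let σ : MvPolynomial V k →ₐ[k] MvPolynomial V k :=
    aeval (Function.update (X : V → MvPolynomial V k) v 0)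
  let α : MvPolynomial V k ⧸ (I ⊔ Ideal.span {(X v : MvPolynomial V k)}) →+*
      MvPolynomial V k ⧸ I := Ideal.quotientMap I σ.toRingHom (by
    refine sup_le (fun q hq => hI.aeval_update_zero_mem v hq) ?_
    rw [Ideal.span_le, Set.singleton_subset_iff]
    change σ (X v) ∈ I
    rw [aeval_X, Function.update_self]
    exact I.zero_mem)
  let β : MvPolynomial V k ⧸ I →+* MvPolynomial V k ⧸
    (I ⊔ Ideal.span {(X v : MvPolynomial V k)}) := Ideal.Quotient.factor le_sup_left
  have hX : Ideal.Quotient.mk (I ⊔ Ideal.span {(X v : MvPolynomial V k)}) (X v) = 0 :=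
    Ideal.Quotient.eq_zero_iff_mem.2 (Ideal.mem_sup_right (Ideal.mem_span_singleton_self _))
  have hβX : ∀ m, β ((X v : MvPolynomial V k) • m) = 0 := by
    intro m
    obtain ⟨q, rfl⟩ := Ideal.Quotient.mk_surjective m
    exact (map_mul _ _ _).trans ((congrArg (· * _) hX).trans (zero_mul _))
  refine DepthGE.of_retract (i₀ := v) (s := X) (s₀ := Function.update X v 0)
    ⟨Function.update_self .., fun i hi => Function.update_of_ne hi ..⟩
    { α.toAddMonoidHom with map_smul' := ?_ } { β.toAddMonoidHom with map_smul' := ?_ }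
    ?_ hβX h
  · intro i m
    obtain ⟨q, rfl⟩ := Ideal.Quotient.mk_surjective m
    exact congrArg (Ideal.Quotient.mk I)
      ((map_mul σ (X i) q).trans (congrArg (· * σ q) (aeval_X _ i)))
  · intro i m
    obtain ⟨q, rfl⟩ := Ideal.Quotient.mk_surjective m
    by_cases hi : i = v
    · subst hi
      rw [Function.update_self, zero_smul]
      exact (map_zero β).trans (hβX (Ideal.Quotient.mk I q)).symm
    · rw [Function.update_of_ne hi]
      rfl
  · intro m
    obtain ⟨q, rfl⟩ := Ideal.Quotient.mk_surjective m
    exact Ideal.Quotient.eq.2 (Ideal.mem_sup_right (aeval_update_zero_sub_mem v q))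

lemma DepthGE.sup_span_X_image [Finite V] {I : Ideal (MvPolynomial V k)} (hI : IsMonomialIdeal I)
    (T : Finset V) {p : ℕ}
    (h : DepthGE (X : V → MvPolynomial V k) (p + T.card) (MvPolynomial V k ⧸ I)) :
    DepthGE (X : V → MvPolynomial V k) p
      (MvPolynomial V k ⧸ (I ⊔ Ideal.span (X '' (T : Set V) : Set (MvPolynomial V k)))) := by
  classical
  induction T using Finset.induction_on generalizing p with
  | empty => rwa [Finset.coe_empty, Set.image_empty, Ideal.span_empty, sup_bot_eq]
  | insert v T hv ih =>
    rw [Finset.card_insert_of_notMem hv, ← add_assoc, add_right_comm] at h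
    have hsup := (ih h).sup_span_X (hI.sup (isMonomialIdeal_span_X _)) v
    rwa [sup_assoc, sup_comm (Ideal.span (X '' _)), ← Ideal.span_union, ← Set.image_singleton,
      ← Set.image_union, ← Set.insert_eq, ← Finset.coe_insert] at hsup

/-- The sequence `S ⧸ (I : f) → S ⧸ I → S ⧸ (I + f)` given by multiplication by `f`. -/
lemma DepthGE.of_colon {ι A : Type} [CommRing A] [Finite ι] {s : ι → A} {I : Ideal A} (f : A) {p : ℕ}
    (hN : DepthGE s (p + 1) (A ⧸ I)) (hP : DepthGE s p (A ⧸ (I ⊔ Ideal.span {f}))) :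
    DepthGE s (p + 1) (A ⧸ Submodule.colon I {f}) := by
  let a : A ⧸ Submodule.colon I {f} →ₗ[A] A ⧸ I :=
    Submodule.mapQ _ _ (LinearMap.mulRight A f) fun q hq => Submodule.mem_colon_singleton.1 hq
  let b : A ⧸ I →ₗ[A] A ⧸ (I ⊔ Ideal.span {f}) := Submodule.mapQ _ _ LinearMap.id le_sup_left
  refine DepthGE.left (f := FamilyHom.ofLinear s a) (g := FamilyHom.ofLinear s b)
    ⟨?_, ?_, ?_, ?_⟩ hN hP
  · refine (injective_iff_map_eq_zero a).2 fun m hm => ?_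
    obtain ⟨q, rfl⟩ := Ideal.Quotient.mk_surjective m
    exact Ideal.Quotient.eq_zero_iff_mem.2
      (Submodule.mem_colon_singleton.2 (Ideal.Quotient.eq_zero_iff_mem.1 hm))
  · intro m
    obtain ⟨q, rfl⟩ := Ideal.Quotient.mk_surjective m
    exact ⟨Ideal.Quotient.mk I q, rfl⟩
  · intro m
    obtain ⟨q, rfl⟩ := Ideal.Quotient.mk_surjective m
    exact Ideal.Quotient.eq_zero_iff_mem.2
      (Ideal.mem_sup_right (Ideal.mul_mem_left _ q (Ideal.mem_span_singleton_self f)))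
  · intro m hm
    obtain ⟨q, rfl⟩ := Ideal.Quotient.mk_surjective m
    obtain ⟨x, hx, y, hy, hxy⟩ := Submodule.mem_sup.1 (Ideal.Quotient.eq_zero_iff_mem.1 hm)
    obtain ⟨c, rfl⟩ := Ideal.mem_span_singleton'.1 hy
    refine ⟨Ideal.Quotient.mk _ c, Ideal.Quotient.eq.2 ?_⟩
    change c * f - q ∈ I
    have : q = x + c * f := hxy.symm
    rw [this, sub_add_cancel_right]
    exact I.neg_mem hx

lemma colon_monomial_add (I : Ideal (MvPolynomial V k)) (a b : V →₀ ℕ) :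
    Submodule.colon I {monomial (a + b) (1 : k)} =
      Submodule.colon (Submodule.colon I {monomial a (1 : k)}) {monomial b (1 : k)} := by
  ext p
  rw [Submodule.mem_colon_singleton, Submodule.mem_colon_singleton, Submodule.mem_colon_singleton,
    smul_eq_mul, smul_eq_mul, smul_eq_mul, mul_assoc, monomial_mul, one_mul, add_comm]

lemma colon_monomial_zero (I : Ideal (MvPolynomial V k)) :
    Submodule.colon I {monomial (0 : V →₀ ℕ) (1 : k)} = I := by
  ext p
  rw [Submodule.mem_colon_singleton, smul_eq_mul, monomial_zero', C_1, mul_one]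

/-- The depth does not decrease on passing to the colon ideal by a monomial. -/
lemma DepthGE.colon_monomial [Finite V] {p : ℕ} (d : V →₀ ℕ) {I : Ideal (MvPolynomial V k)}
    (hI : IsMonomialIdeal I)
    (h : DepthGE (X : V → MvPolynomial V k) p (MvPolynomial V k ⧸ I)) :
    DepthGE (X : V → MvPolynomial V k) p
      (MvPolynomial V k ⧸ Submodule.colon I {monomial d (1 : k)}) := by
  cases p with
  | zero => trivial
  | succ p =>
  induction d using Finsupp.induction_linear generalizing I with
  | zero => rwa [colon_monomial_zero]
  | add a b iha ihb =>
    rw [colon_monomial_add]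
    exact ihb (hI.colon_monomial a) (iha hI h)
  | single v n =>
    induction n with
    | zero => rwa [Finsupp.single_zero, colon_monomial_zero]
    | succ n ih =>
      rw [Finsupp.single_add, colon_monomial_add]
      exact ih.of_colon _ (ih.sup_span_X (hI.colon_monomial _) v)

lemma one_notMem_maxHomIdeal : (1 : MvPolynomial V k) ∉ maxHomIdeal k V := by
  intro h
  have hker : maxHomIdeal k V ≤ RingHom.ker (constantCoeff (R := k) (σ := V)) := by
    rw [maxHomIdeal, Ideal.span_le]
    rintro _ ⟨i, rfl⟩
    exact constantCoeff_X k i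
  exact one_ne_zero (constantCoeff.map_one.symm.trans (hker h))

/-- The quotient by a proper monomial ideal has finite depth. -/
lemma exists_not_depthGE [Finite V] {I : Ideal (MvPolynomial V k)} (hI : IsMonomialIdeal I)
    (hle : I ≤ maxHomIdeal k V) :
    ∃ p, ¬ DepthGE (X : V → MvPolynomial V k) p (MvPolynomial V k ⧸ I) := by
  have := Fintype.ofFinite V
  refine ⟨1 + (Finset.univ : Finset V).card, fun h => one_notMem_maxHomIdeal (k := k) (V := V) ?_⟩
  have h₁ := (h.sup_span_X_image hI Finset.univ).1 (Ideal.Quotient.mk _ 1) fun i =>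
    Ideal.Quotient.eq_zero_iff_mem.2 (Ideal.mul_mem_right _ _
      (Ideal.mem_sup_right (Ideal.subset_span ⟨i, by simp, rfl⟩)))
  refine sup_le hle ?_ (Ideal.Quotient.eq_zero_iff_mem.1 h₁)
  rw [Finset.coe_univ, Set.image_univ]
  rfl

/-- The depth of the quotient by a proper monomial ideal in terms of `DepthGE`. -/
lemma le_depthQuot_iff [Finite V] {I : Ideal (MvPolynomial V k)} (hI : IsMonomialIdeal I)
    (hle : I ≤ maxHomIdeal k V) (p : ℕ) :
    p ≤ depthQuot k I ↔ DepthGE (X : V → MvPolynomial V k) p (MvPolynomial V k ⧸ I) := by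
  rw [depthGE_iff_subsingleton_localCohomology]
  constructor
  · intro h i hi
    exact not_nontrivial_iff_subsingleton.1 (Nat.notMem_of_lt_sInf (hi.trans_le h))
  · intro h
    obtain ⟨q, hq⟩ := exists_not_depthGE hI hle
    rw [depthGE_iff_subsingleton_localCohomology] at hq
    push Not at hq
    obtain ⟨i, -, hi⟩ := hq
    refine le_csInf ⟨i, ?_⟩ fun j hj => ?_
    · exact hi
    · by_contra hjp
      exact not_subsingleton_iff_nontrivial.2 hj (h j (not_le.1 hjp))

end MonomialIdeals

section EdgeIdealPowers

variable (k : Type) [Field k] {V : Type}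

/-- The exponent vectors of the products of `n` edges of `G`. -/
def edgeSums (G : SimpleGraph V) : ℕ → Set (V →₀ ℕ)
  | 0 => {0}
  | n + 1 => {d | ∃ a ∈ edgeSums G n, ∃ i j, G.Adj i j ∧
      d = a + (Finsupp.single i 1 + Finsupp.single j 1)}

lemma edgeIdeal_pow (G : SimpleGraph V) (n : ℕ) :
    edgeIdeal k G ^ n = Ideal.span ((fun d => monomial d (1 : k)) '' edgeSums G n) := by
  induction n with
  | zero => simp [edgeSums]
  | succ n ih =>
    rw [pow_succ, ih, edgeIdeal, Ideal.span_mul_span']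
    congr 1
    ext p
    constructor
    · rintro ⟨_, ⟨a, ha, rfl⟩, _, ⟨i, j, hij, rfl⟩, rfl⟩
      exact ⟨_, ⟨a, ha, i, j, hij, rfl⟩, by simp [X, monomial_mul]⟩
    · rintro ⟨_, ⟨a, ha, i, j, hij, rfl⟩, rfl⟩
      exact ⟨_, ⟨a, ha, rfl⟩, _, ⟨i, j, hij, rfl⟩, by simp [X, monomial_mul]⟩

lemma isMonomialIdeal_edgeIdeal_pow (G : SimpleGraph V) (n : ℕ) :
    IsMonomialIdeal (edgeIdeal k G ^ n) := by
  rw [edgeIdeal_pow]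
  exact isMonomialIdeal_span _

lemma isMonomialIdeal_edgeIdeal (G : SimpleGraph V) : IsMonomialIdeal (edgeIdeal k G) := by
  simpa using isMonomialIdeal_edgeIdeal_pow k G 1

lemma edgeIdeal_le_maxHomIdeal (G : SimpleGraph V) : edgeIdeal k G ≤ maxHomIdeal k V := by
  rw [edgeIdeal, Ideal.span_le]
  rintro _ ⟨i, j, -, rfl⟩
  exact Ideal.mul_mem_right _ _ (Ideal.subset_span ⟨i, rfl⟩)

lemma monomial_pair_mem_edgeIdeal {G : SimpleGraph V} {i j : V} (h : G.Adj i j) :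
    monomial (Finsupp.single i 1 + Finsupp.single j 1) (1 : k) ∈ edgeIdeal k G :=
  Ideal.subset_span ⟨i, j, h, by simp [X, monomial_mul]⟩

lemma monomial_add_mem_pow {I : Ideal (MvPolynomial V k)} {a b : V →₀ ℕ} {m n : ℕ}
    (ha : monomial a (1 : k) ∈ I ^ m) (hb : monomial b (1 : k) ∈ I ^ n) :
    monomial (a + b) (1 : k) ∈ I ^ (m + n) := by
  rw [← one_mul (1 : k), ← monomial_mul, pow_add]
  exact Ideal.mul_mem_mul ha hb

lemma single_add_single_le {d : V →₀ ℕ} {i j : V} (hij : i ≠ j) (hi : d i ≠ 0) (hj : d j ≠ 0) :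
    Finsupp.single i 1 + Finsupp.single j 1 ≤ d := by
  classical
  intro x
  simp only [Finsupp.add_apply, Finsupp.single_apply]
  split_ifs <;> subst_vars <;> first | omega | exact absurd rfl hij

/-- The exponent vector of an edge. -/
noncomputable def edgeExp : Sym2 V → V →₀ ℕ :=
  Sym2.lift ⟨fun i j => Finsupp.single i 1 + Finsupp.single j 1, fun _ _ => add_comm _ _⟩

lemma edgeExp_mk (i j : V) : edgeExp s(i, j) = Finsupp.single i 1 + Finsupp.single j 1 := rfl

lemma monomial_sum_edgeExp_mem {G : SimpleGraph V} {F : Finset (Sym2 V)}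
    (hF : ∀ z ∈ F, z ∈ G.edgeSet) :
    monomial (∑ z ∈ F, edgeExp z) (1 : k) ∈ edgeIdeal k G ^ F.card := by
  classical
  induction F using Finset.induction_on with
  | empty => simp
  | insert z F hz ih =>
    rw [Finset.sum_insert hz, Finset.card_insert_of_notMem hz, add_comm (edgeExp z)]
    refine monomial_add_mem_pow k (ih fun w hw => hF w (Finset.mem_insert_of_mem hw)) ?_
    rw [pow_one]
    have := hF z (Finset.mem_insert_self z F)
    induction z with | _ i j => exact monomial_pair_mem_edgeIdeal k this

/-- The number of factors, counted with multiplicity, lying in `Q`. -/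
noncomputable def partDegree (Q : Set V) : (V →₀ ℕ) →+ ℕ :=
  Finsupp.weight (Q.indicator 1)

lemma partDegree_single_of_mem {Q : Set V} {i : V} (h : i ∈ Q) :
    partDegree Q (Finsupp.single i 1) = 1 := by
  simp [partDegree, Finsupp.weight_single, h]

lemma partDegree_single_of_notMem {Q : Set V} {i : V} (h : i ∉ Q) :
    partDegree Q (Finsupp.single i 1) = 0 := by
  simp [partDegree, Finsupp.weight_single, h]

lemma partDegree_mono {Q : Set V} {a b : V →₀ ℕ} (h : a ≤ b) :
    partDegree Q a ≤ partDegree Q b := by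
  obtain ⟨c, rfl⟩ := le_iff_exists_add.1 h
  rw [map_add]
  exact Nat.le_add_right _ _

lemma partDegree_eq_zero {Q : Set V} {d : V →₀ ℕ} (h : ∀ i ∈ Q, d i = 0) :
    partDegree Q d = 0 := by
  rw [partDegree, Finsupp.weight_apply, Finsupp.sum]
  refine Finset.sum_eq_zero fun i hi => ?_
  rw [Set.indicator_of_notMem fun hQ => Finsupp.mem_support_iff.1 hi (h i hQ), smul_zero]

/-- A product of more than `deg_Q d` edges dividing `d` involves an edge avoiding `Q`. -/
lemma exists_adj_of_partDegree_lt {G : SimpleGraph V} {Q : Set V} {n : ℕ} {a d : V →₀ ℕ}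
    (ha : a ∈ edgeSums G n) (had : a ≤ d) (hd : partDegree Q d < n) :
    ∃ i j, G.Adj i j ∧ i ∉ Q ∧ j ∉ Q ∧ d i ≠ 0 ∧ d j ≠ 0 := by
  suffices h : n ≤ partDegree Q a ∨ ∃ i j, G.Adj i j ∧ i ∉ Q ∧ j ∉ Q ∧ a i ≠ 0 ∧ a j ≠ 0 by
    rcases h with h | ⟨i, j, hij, hi, hj, hi', hj'⟩
    · have := partDegree_mono (Q := Q) had
      omega
    · exact ⟨i, j, hij, hi, hj, fun h => hi' (Nat.le_zero.1 (h ▸ had i)),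
        fun h => hj' (Nat.le_zero.1 (h ▸ had j))⟩
  clear had hd
  induction n generalizing a with
  | zero => exact Or.inl (Nat.zero_le _)
  | succ n ih =>
    obtain ⟨b, hb, i, j, hij, rfl⟩ := ha
    rcases ih hb with h | ⟨i', j', h, hi, hj, hi', hj'⟩
    · by_cases hi : i ∈ Q
      · left
        rw [map_add, map_add, partDegree_single_of_mem hi]
        omega
      by_cases hj : j ∈ Q
      · left
        rw [map_add, map_add, partDegree_single_of_mem hj]
        omega
      exact Or.inr ⟨i, j, hij, hi, hj, by simp, by simp⟩
    · exact Or.inr ⟨i', j', h, hi, hj, by simp only [Finsupp.add_apply]; omega, by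
        simp only [Finsupp.add_apply]; omega⟩

/-- If `f` has `Q`-degree `t`, then no monomial outside `I + (Q)` can be multiplied into
`I ^ (t + 1)` by `f u`, provided every neighbour of a factor of `f u` outside `Q` lies in `Q`. -/
lemma mem_edgeIdeal_or_of_add_mem_pow {G : SimpleGraph V} {Q : Set V} {t : ℕ} {f w : V →₀ ℕ} {u : V}
    (hf : partDegree Q f = t) (hu : u ∉ Q)
    (hnbr : ∀ i j, (f + Finsupp.single u 1 : V →₀ ℕ) i ≠ 0 → i ∉ Q → G.Adj i j → j ∈ Q)
    (h : monomial (w + (f + Finsupp.single u 1)) (1 : k) ∈ edgeIdeal k G ^ (t + 1)) :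
    monomial w (1 : k) ∈ edgeIdeal k G ∨ ∃ q ∈ Q, w q ≠ 0 := by
  by_contra! hw
  obtain ⟨hw, hQ⟩ := hw
  rw [edgeIdeal_pow, monomial_mem_span_iff] at h
  obtain ⟨a, ha, had⟩ := h
  obtain ⟨i, j, hij, hi, hj, hi', hj'⟩ := exists_adj_of_partDegree_lt ha had (Q := Q) (by
    rw [map_add, map_add, partDegree_eq_zero hQ, hf, partDegree_single_of_notMem hu]
    omega)
  refine hw (monomial_mem_of_le (single_add_single_le hij.ne ?_ ?_)
    (monomial_pair_mem_edgeIdeal k hij))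
  · intro h0
    rw [Finsupp.add_apply, h0, zero_add] at hi'
    exact hj (hnbr i j hi' hi hij)
  · intro h0
    rw [Finsupp.add_apply, h0, zero_add] at hj'
    exact hi (hnbr j i hj' hj hij.symm)

/-- Multiplying the edges of a walk in a bipartite graph by suitable end vertices produces one
more edge. -/
lemma monomial_walk_mem_pow {G H : SimpleGraph V} (hHG : H ≤ G) {P Q : Set V} (hPQ : Disjoint P Q)
    (hP : ∀ i j, H.Adj i j → i ∈ P → j ∈ Q) (hQ : ∀ i j, H.Adj i j → i ∈ Q → j ∈ P)
    {y x b : V} (p : H.Walk y x) (hx : x ∈ P) (hb : G.Adj b x) :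
    (∀ a, y ∈ Q → G.Adj a y →
      monomial (Finsupp.single a 1 + (p.edges.map edgeExp).sum + Finsupp.single b 1) (1 : k) ∈
        edgeIdeal k G ^ (p.length + 1)) ∧
    (y ∈ P → monomial (Finsupp.single y 1 + (p.edges.map edgeExp).sum + Finsupp.single b 1)
      (1 : k) ∈ edgeIdeal k G ^ (p.length + 1)) := by
  induction p with
  | nil =>
    refine ⟨fun a hxQ => absurd hxQ (hPQ.notMem_of_mem_left hx), fun _ => ?_⟩
    simpa using monomial_pair_mem_edgeIdeal k hb.symm
  | @cons y z x h p ih =>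
    obtain ⟨ih₁, ih₂⟩ := ih hx hb
    rw [SimpleGraph.Walk.edges_cons, List.map_cons, List.sum_cons, SimpleGraph.Walk.length_cons,
      edgeExp_mk]
    constructor
    · intro a hy ha
      have h₁ := monomial_add_mem_pow k (ih₂ (hQ _ _ h hy))
        ((pow_one (edgeIdeal k G)).symm ▸ monomial_pair_mem_edgeIdeal k ha)
      convert h₁ using 3
      abel
    · intro hy
      have h₁ := monomial_add_mem_pow k (ih₁ y (hP _ _ h hy) (hHG h))
        ((pow_one (edgeIdeal k G)).symm ▸ monomial_pair_mem_edgeIdeal k (hHG h))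
      convert h₁ using 3
      abel

end EdgeIdealPowers

section DepthQuotients

variable {ι A : Type} [CommRing A]

lemma DepthGE.prod [Finite ι] {s : ι → A} {M N : Type} [AddCommGroup M] [Module A M]
    [AddCommGroup N] [Module A N] {p : ℕ} (hM : DepthGE s p M) (hN : DepthGE s p N) :
    DepthGE s p (M × N) :=
  DepthGE.middle (f := FamilyHom.ofLinear s (LinearMap.inl A M N))
    (g := FamilyHom.ofLinear s (LinearMap.snd A M N))
    ⟨LinearMap.inl_injective (R := A), LinearMap.snd_surjective (R := A), fun _ => rfl,
      fun y hy => ⟨y.1, Prod.ext rfl hy.symm⟩⟩ hM hN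

/-- The sequence `A ⧸ I ⊓ J → A ⧸ I × A ⧸ J → A ⧸ I ⊔ J`. -/
lemma DepthGE.sup_of_inf [Finite ι] {s : ι → A} {I J : Ideal A} {p : ℕ}
    (h : DepthGE s (p + 1) (A ⧸ (I ⊓ J))) (hI : DepthGE s p (A ⧸ I)) (hJ : DepthGE s p (A ⧸ J)) :
    DepthGE s p (A ⧸ (I ⊔ J)) := by
  let a : A ⧸ (I ⊓ J) →ₗ[A] (A ⧸ I) × (A ⧸ J) :=
    (Submodule.mapQ _ _ LinearMap.id inf_le_left).prod
      (Submodule.mapQ _ _ LinearMap.id inf_le_right)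
  let b : (A ⧸ I) × (A ⧸ J) →ₗ[A] A ⧸ (I ⊔ J) :=
    (Submodule.mapQ _ _ LinearMap.id le_sup_left).comp (LinearMap.fst _ _ _) -
      (Submodule.mapQ _ _ LinearMap.id le_sup_right).comp (LinearMap.snd _ _ _)
  refine DepthGE.right (f := FamilyHom.ofLinear s a) (g := FamilyHom.ofLinear s b)
    ⟨?_, ?_, ?_, ?_⟩ h (hI.prod hJ)
  · refine (injective_iff_map_eq_zero a).2 fun m hm => ?_
    obtain ⟨q, rfl⟩ := Ideal.Quotient.mk_surjective m
    exact Ideal.Quotient.eq_zero_iff_mem.2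
      ⟨Ideal.Quotient.eq_zero_iff_mem.1 (congrArg Prod.fst hm),
        Ideal.Quotient.eq_zero_iff_mem.1 (congrArg Prod.snd hm)⟩
  · intro m
    obtain ⟨q, rfl⟩ := Ideal.Quotient.mk_surjective m
    exact ⟨(Ideal.Quotient.mk I q, 0), sub_zero (Ideal.Quotient.mk (I ⊔ J) q)⟩
  · intro m
    obtain ⟨q, rfl⟩ := Ideal.Quotient.mk_surjective m
    exact sub_self (Ideal.Quotient.mk (I ⊔ J) q)
  · rintro ⟨m, m'⟩ hm
    obtain ⟨q, rfl⟩ := Ideal.Quotient.mk_surjective m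
    obtain ⟨q', rfl⟩ := Ideal.Quotient.mk_surjective m'
    replace hm : Ideal.Quotient.mk (I ⊔ J) q - Ideal.Quotient.mk (I ⊔ J) q' = 0 := hm
    obtain ⟨x, hx, y, hy, hxy⟩ := Submodule.mem_sup.1 (Ideal.Quotient.eq.1 (sub_eq_zero.1 hm))
    refine ⟨Ideal.Quotient.mk _ (q - x), Prod.ext (Ideal.Quotient.eq.2 ?_)
      (Ideal.Quotient.eq.2 ?_)⟩
    · change q - x - q ∈ I
      rw [sub_sub_cancel_left]
      exact I.neg_mem hx
    · change q - x - q' ∈ J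
      rw [sub_right_comm, ← hxy]
      simpa using hy

lemma depthGE_congr_of_span_eq [Finite ι] {ι' : Type} [Finite ι'] {s : ι → A} {s' : ι' → A}
    (h : Ideal.span (Set.range s) = Ideal.span (Set.range s')) (p : ℕ) {M : Type} [AddCommGroup M]
    [Module A M] : DepthGE s p M ↔ DepthGE s' p M := by
  rw [depthGE_iff_subsingleton_localCohomology, depthGE_iff_subsingleton_localCohomology, h]

end DepthQuotients

section EdgeIdealDepth

variable {k : Type} [Field k] {V : Type} {G : SimpleGraph V}

lemma monomial_mem_span_X_of_ne_zero {Q : Set V} {w : V →₀ ℕ} {q : V} (hq : q ∈ Q)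
    (hw : w q ≠ 0) : monomial w (1 : k) ∈ Ideal.span (X '' Q : Set (MvPolynomial V k)) :=
  monomial_mem_of_le (Finsupp.single_le_iff.2 (Nat.one_le_iff_ne_zero.2 hw))
    (Ideal.subset_span ⟨q, hq, rfl⟩)

lemma exists_ne_zero_of_monomial_mem_span_X {Q : Set V} {w : V →₀ ℕ}
    (h : monomial w (1 : k) ∈ Ideal.span (X '' Q : Set (MvPolynomial V k))) :
    ∃ q ∈ Q, w q ≠ 0 := by
  classical
  exact mem_ideal_span_X_image.1 h w (by
    rw [support_monomial, if_neg one_ne_zero]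
    exact Finset.mem_singleton_self w)

lemma monomial_mem_colon_iff {I : Ideal (MvPolynomial V k)} {w c : V →₀ ℕ} :
    monomial w (1 : k) ∈ Submodule.colon I {monomial c (1 : k)} ↔
      monomial (w + c) (1 : k) ∈ I := by
  rw [Submodule.mem_colon_singleton, smul_eq_mul, monomial_mul, one_mul]

lemma colon_edgeIdeal_pow_eq {Q D : Set V} {t : ℕ} {f : V →₀ ℕ} {u : V}
    (hf : monomial f (1 : k) ∈ edgeIdeal k G ^ t) (hfQ : partDegree Q f = t)
    (hfD : ∀ i, f i ≠ 0 → i ∈ D) (huD : u ∈ D) (hu : u ∉ Q)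
    (hnbr : ∀ i ∈ D, ∀ j, i ∉ Q → G.Adj i j → j ∈ Q)
    (hQ : ∀ q ∈ Q, monomial (Finsupp.single u 1 + f + Finsupp.single q 1) (1 : k) ∈
      edgeIdeal k G ^ (t + 1)) :
    Submodule.colon (edgeIdeal k G ^ (t + 1)) {monomial (f + Finsupp.single u 1) (1 : k)} =
      edgeIdeal k G ⊔ Ideal.span (X '' Q) := by
  have hI := isMonomialIdeal_edgeIdeal k G
  refine le_antisymm (((isMonomialIdeal_edgeIdeal_pow k G _).colon_monomial _).le fun w hw => ?_)
    ((hI.sup (isMonomialIdeal_span_X Q)).le fun w hw => ?_)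
  · rw [monomial_mem_colon_iff] at hw
    rcases mem_edgeIdeal_or_of_add_mem_pow k hfQ hu (fun i j hi => hnbr i (by
      by_cases hfi : f i = 0
      · rw [Finsupp.add_apply, hfi, zero_add] at hi
        rwa [(Finsupp.single_apply_ne_zero.1 hi).1]
      · exact hfD i hfi) j) hw with h | ⟨q, hq, hwq⟩
    exacts [Ideal.mem_sup_left h, Ideal.mem_sup_right (monomial_mem_span_X_of_ne_zero hq hwq)]
  · rw [monomial_mem_colon_iff]
    rcases hI.monomial_mem_sup (isMonomialIdeal_span_X Q) hw with h | h
    · rw [← add_assoc, add_comm w]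
      exact monomial_mem_of_le le_self_add (monomial_add_mem_pow k hf
        ((pow_one (edgeIdeal k G)).symm ▸ h))
    · obtain ⟨q, hq, hwq⟩ := exists_ne_zero_of_monomial_mem_span_X h
      refine monomial_mem_of_le ?_ (hQ q hq)
      rw [add_comm, add_comm (Finsupp.single u 1)]
      exact add_le_add_left (Finsupp.single_le_iff.2 (Nat.one_le_iff_ne_zero.2 hwq)) _

/-- Passing from `I ^ (t + 1)` to `I + (P ∪ Q)` lowers the depth by at most one, where `f` is a
product of `t` edges whose factors together with their neighbours form the bipartite graph on
`P ∪ Q`. -/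
lemma DepthGE.sup_span_X_of_edgeIdeal_pow [Finite V] {P Q D : Set V} {t p : ℕ} {f : V →₀ ℕ}
    {u v : V} (hPQ : Disjoint P Q) (hf : monomial f (1 : k) ∈ edgeIdeal k G ^ t)
    (hfP : partDegree P f = t) (hfQ : partDegree Q f = t) (hfD : ∀ i, f i ≠ 0 → i ∈ D)
    (huD : u ∈ D) (hu : u ∈ P) (hvD : v ∈ D) (hv : v ∈ Q)
    (hnbrP : ∀ i ∈ D, ∀ j, i ∉ P → G.Adj i j → j ∈ P)
    (hnbrQ : ∀ i ∈ D, ∀ j, i ∉ Q → G.Adj i j → j ∈ Q)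
    (hpair : ∀ a ∈ P, ∀ b ∈ Q, monomial (Finsupp.single a 1 + f + Finsupp.single b 1) (1 : k) ∈
      edgeIdeal k G ^ (t + 1))
    (h : DepthGE (X : V → MvPolynomial V k) (p + 1)
      (MvPolynomial V k ⧸ edgeIdeal k G ^ (t + 1))) :
    DepthGE (X : V → MvPolynomial V k) p
      (MvPolynomial V k ⧸ (edgeIdeal k G ⊔ Ideal.span (X '' (P ∪ Q)))) := by
  have hI := isMonomialIdeal_edgeIdeal k G
  have hIt := isMonomialIdeal_edgeIdeal_pow k G (t + 1)
  have hA := colon_edgeIdeal_pow_eq hf hfQ hfD huD (hPQ.notMem_of_mem_left hu) hnbrQ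
    fun q hq => hpair u hu q hq
  have hB := colon_edgeIdeal_pow_eq hf hfP hfD hvD (hPQ.notMem_of_mem_right hv) hnbrP
    fun q hq => by
      rw [add_right_comm, add_comm (Finsupp.single v 1), add_right_comm]
      exact hpair q hq v hv
  have hJ : Submodule.colon (edgeIdeal k G ^ (t + 1)) {monomial f (1 : k)} =
      (edgeIdeal k G ⊔ Ideal.span (X '' Q)) ⊓ (edgeIdeal k G ⊔ Ideal.span (X '' P)) := by
    refine le_antisymm ((hIt.colon_monomial f).le fun w hw => ?_)
      (((hI.sup (isMonomialIdeal_span_X Q)).inf (hI.sup (isMonomialIdeal_span_X P))).le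
        fun w hw => ?_)
    · rw [← hA, ← hB]
      rw [monomial_mem_colon_iff] at hw
      refine ⟨monomial_mem_colon_iff.2 ?_, monomial_mem_colon_iff.2 ?_⟩ <;>
      · rw [← add_assoc]
        exact monomial_mem_of_le le_self_add hw
    · rw [monomial_mem_colon_iff]
      have hmem : monomial w (1 : k) ∈ edgeIdeal k G →
          monomial (w + f) (1 : k) ∈ edgeIdeal k G ^ (t + 1) := fun h => by
        rw [add_comm w]
        exact monomial_add_mem_pow k hf ((pow_one (edgeIdeal k G)).symm ▸ h)
      rcases hI.monomial_mem_sup (isMonomialIdeal_span_X Q) hw.1 with h | h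
      · exact hmem h
      rcases hI.monomial_mem_sup (isMonomialIdeal_span_X P) hw.2 with h' | h'
      · exact hmem h'
      obtain ⟨b, hb, hwb⟩ := exists_ne_zero_of_monomial_mem_span_X h
      obtain ⟨a, ha, hwa⟩ := exists_ne_zero_of_monomial_mem_span_X h'
      refine monomial_mem_of_le ?_ (hpair a ha b hb)
      rw [add_right_comm]
      exact add_le_add_left (single_add_single_le (hPQ.ne_of_mem ha hb) hwa hwb) f
  have hsup : (edgeIdeal k G ⊔ Ideal.span (X '' Q)) ⊔ (edgeIdeal k G ⊔ Ideal.span (X '' P)) =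
      edgeIdeal k G ⊔ Ideal.span (X '' (P ∪ Q)) := by
    rw [← sup_sup_distrib_left, ← Ideal.span_union, ← Set.image_union, Set.union_comm]
  rw [← hsup]
  refine DepthGE.sup_of_inf (hJ ▸ h.colon_monomial f hIt) ?_ ?_
  · exact hA ▸ (h.colon_monomial _ hIt).of_succ
  · exact hB ▸ (h.colon_monomial _ hIt).of_succ

/-- The substitution sending the variables in `N` to zero. -/
noncomputable def restrictVars (k : Type) [Field k] (N : Set V) [DecidablePred (· ∈ N)] (v : V) :
    MvPolynomial ↥(Nᶜ) k :=
  if h : v ∈ N then 0 else X ⟨v, h⟩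

lemma restrictVars_val (N : Set V) [DecidablePred (· ∈ N)] (v : ↥(Nᶜ)) :
    restrictVars k N v = X v :=
  dif_neg v.2

lemma restrictVars_of_mem {N : Set V} [DecidablePred (· ∈ N)] {v : V} (h : v ∈ N) :
    restrictVars k N v = 0 :=
  dif_pos h

lemma span_range_restrictVars (N : Set V) [DecidablePred (· ∈ N)] :
    Ideal.span (Set.range (restrictVars k N)) = Ideal.span (Set.range X) := by
  refine le_antisymm (Ideal.span_le.2 ?_) (Ideal.span_mono ?_)
  · rintro _ ⟨v, rfl⟩
    by_cases h : v ∈ N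
    · rw [restrictVars_of_mem h]
      exact Ideal.zero_mem _
    · exact Ideal.subset_span ⟨⟨v, h⟩, (restrictVars_val N ⟨v, h⟩).symm⟩
  · rintro _ ⟨v, rfl⟩
    exact ⟨v, restrictVars_val N v⟩

/-- Comparison of `S ⧸ (I(G) + (N))` with the quotient by the edge ideal of the induced subgraph
on the complement of `N`. -/
lemma DepthGE.induce_compl [Finite V] (N : Set V) {p : ℕ}
    (h : DepthGE (X : V → MvPolynomial V k) p
      (MvPolynomial V k ⧸ (edgeIdeal k G ⊔ Ideal.span (X '' N)))) :
    DepthGE (X : ↥(Nᶜ) → MvPolynomial ↥(Nᶜ) k) p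
      (MvPolynomial ↥(Nᶜ) k ⧸ edgeIdeal k (G.induce Nᶜ)) := by
  classical
  let φ : MvPolynomial V k →ₐ[k] MvPolynomial ↥(Nᶜ) k := aeval (restrictVars k N)
  let ψ : MvPolynomial ↥(Nᶜ) k →ₐ[k] MvPolynomial V k := rename Subtype.val
  have hφψ : ∀ q, φ (ψ q) = q := by
    intro q
    have : φ.comp ψ = AlgHom.id k _ := algHom_ext fun v => by
      rw [AlgHom.comp_apply, rename_X, aeval_X, restrictVars_val, AlgHom.id_apply]
    exact congrArg (fun g => g q) this
  let α : MvPolynomial ↥(Nᶜ) k ⧸ edgeIdeal k (G.induce Nᶜ) →+*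
      MvPolynomial V k ⧸ (edgeIdeal k G ⊔ Ideal.span (X '' N)) :=
    Ideal.quotientMap _ ψ.toRingHom (by
      rw [edgeIdeal, Ideal.span_le]
      rintro _ ⟨i, j, hij, rfl⟩
      refine Ideal.mem_sup_left (Ideal.subset_span ⟨i, j, hij, ?_⟩)
      exact (map_mul ψ _ _).trans (by rw [rename_X, rename_X]))
  let β : MvPolynomial V k ⧸ (edgeIdeal k G ⊔ Ideal.span (X '' N)) →+*
      MvPolynomial ↥(Nᶜ) k ⧸ edgeIdeal k (G.induce Nᶜ) :=
    Ideal.quotientMap _ φ.toRingHom (by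
      refine sup_le ?_ ?_
      · rw [edgeIdeal, Ideal.span_le]
        rintro _ ⟨i, j, hij, rfl⟩
        change φ (X i * X j) ∈ edgeIdeal k (G.induce Nᶜ)
        rw [map_mul, aeval_X, aeval_X]
        by_cases hi : i ∈ N
        · rw [restrictVars_of_mem hi, zero_mul]
          exact Ideal.zero_mem _
        by_cases hj : j ∈ N
        · rw [restrictVars_of_mem hj, mul_zero]
          exact Ideal.zero_mem _
        exact Ideal.subset_span ⟨⟨i, hi⟩, ⟨j, hj⟩, hij,
          by rw [← restrictVars_val N ⟨i, hi⟩, ← restrictVars_val N ⟨j, hj⟩]⟩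
      · rw [Ideal.span_le]
        rintro _ ⟨i, hi, rfl⟩
        change φ (X i) ∈ edgeIdeal k (G.induce Nᶜ)
        rw [aeval_X, restrictVars_of_mem hi]
        exact Ideal.zero_mem _)
  rw [← depthGE_congr_of_span_eq (span_range_restrictVars N)]
  refine DepthGE.of_leftInverse (s' := X) { α.toAddMonoidHom with map_smul' := ?_ }
    { β.toAddMonoidHom with map_smul' := ?_ } ?_ h
  · intro i m
    obtain ⟨q, rfl⟩ := Ideal.Quotient.mk_surjective m
    by_cases hi : i ∈ N
    · rw [restrictVars_of_mem hi, zero_smul]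
      refine (map_zero α).trans (Eq.symm ?_)
      exact Ideal.Quotient.eq_zero_iff_mem.2
        (Ideal.mul_mem_right (ψ q) _ (Ideal.mem_sup_right (Ideal.subset_span ⟨i, hi, rfl⟩)))
    · rw [show restrictVars k N i = X ⟨i, hi⟩ from restrictVars_val N ⟨i, hi⟩]
      exact congrArg (Ideal.Quotient.mk _)
        ((map_mul ψ (X _) q).trans (congrArg (· * ψ q) (rename_X _ _)))
  · intro i m
    obtain ⟨q, rfl⟩ := Ideal.Quotient.mk_surjective m
    exact congrArg (Ideal.Quotient.mk _)
      ((map_mul φ (X i) q).trans (congrArg (· * φ q) (aeval_X _ i)))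
  · intro m
    obtain ⟨q, rfl⟩ := Ideal.Quotient.mk_surjective m
    exact congrArg (Ideal.Quotient.mk _) (hφψ q)

end EdgeIdealDepth

section BipartiteEdgeSets

variable (k : Type) [Field k] {V : Type} {G : SimpleGraph V}

lemma partDegree_sum_edgeExp {P Q : Set V} (hPQ : Disjoint P Q) {E : Finset (Sym2 V)}
    (hE : ∀ i j, s(i, j) ∈ E → (i ∈ P ∧ j ∈ Q) ∨ (i ∈ Q ∧ j ∈ P)) :
    partDegree P (∑ z ∈ E, edgeExp z) = E.card := by
  rw [map_sum, Finset.card_eq_sum_ones]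
  refine Finset.sum_congr rfl fun z hz => ?_
  induction z with | _ i j
  rw [edgeExp_mk, map_add]
  rcases hE i j hz with ⟨hi, hj⟩ | ⟨hi, hj⟩
  · rw [partDegree_single_of_mem hi,
      partDegree_single_of_notMem (hPQ.notMem_of_mem_right hj)]
  · rw [partDegree_single_of_mem hj,
      partDegree_single_of_notMem (hPQ.notMem_of_mem_right hi)]

lemma mem_support_of_sum_edgeExp_ne_zero (e : G.Subgraph) {E : Finset (Sym2 V)}
    (hE : ∀ z ∈ E, z ∈ e.edgeSet) {x : V} (hx : (∑ z ∈ E, edgeExp z : V →₀ ℕ) x ≠ 0) :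
    x ∈ e.support := by
  rw [Finsupp.finsetSum_apply] at hx
  obtain ⟨z, hz, hzx⟩ := Finset.exists_ne_zero_of_sum_ne_zero hx
  have hze := hE z hz
  induction z with | _ i j
  rw [edgeExp_mk, Finsupp.add_apply] at hzx
  by_cases hi : i = x
  · exact ⟨j, hi ▸ hze⟩
  by_cases hj : j = x
  · exact ⟨i, hj ▸ SimpleGraph.Subgraph.Adj.symm hze⟩
  exact absurd (by rw [Finsupp.single_eq_of_ne' hi, Finsupp.single_eq_of_ne' hj, add_zero]) hzx

/-- In a connected bipartite set of edges, the product of all edges becomes a product of one more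
edge after multiplication by neighbours of opposite parts. -/
lemma monomial_add_sum_edgeExp_add_mem_pow {e : G.Subgraph} (he : e.Connected) {P Q : Set V}
    (hPQ : Disjoint P Q) (hP : ∀ i j, e.Adj i j → i ∈ P → j ∈ Q)
    (hQ : ∀ i j, e.Adj i j → i ∈ Q → j ∈ P) {E : Finset (Sym2 V)} (hE : ↑E = e.edgeSet)
    {a b x y : V} (hy : y ∈ e.verts) (hyQ : y ∈ Q) (hay : G.Adj a y)
    (hx : x ∈ e.verts) (hxP : x ∈ P) (hbx : G.Adj b x) :
    monomial (Finsupp.single a 1 + ∑ z ∈ E, edgeExp z + Finsupp.single b 1) (1 : k) ∈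
      edgeIdeal k G ^ (E.card + 1) := by
  classical
  have hr : e.spanningCoe.Reachable y x :=
    (he.coe.preconnected ⟨y, hy⟩ ⟨x, hx⟩).map (⟨Subtype.val, fun h => h⟩ : e.coe →g e.spanningCoe)
  obtain ⟨p, hp⟩ := hr.exists_isPath
  have hw := (monomial_walk_mem_pow k e.spanningCoe_le hPQ hP hQ p hxP hbx).1 a hyQ hay
  set F := p.edges.toFinset
  have hF : F.card = p.length := by
    rw [List.toFinset_card_of_nodup hp.isTrail.edges_nodup, p.length_edges]
  have hFE : F ⊆ E := fun z hz => by
    rw [← Finset.mem_coe, hE]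
    simpa using p.edges_subset_edgeSet (List.mem_toFinset.1 hz)
  have hrest : monomial (∑ z ∈ E \ F, edgeExp z) (1 : k) ∈ edgeIdeal k G ^ (E \ F).card :=
    monomial_sum_edgeExp_mem k fun z hz =>
      e.edgeSet_subset (hE ▸ Finset.mem_coe.2 (Finset.sdiff_subset hz))
  have hcard : p.length + 1 + (E \ F).card = E.card + 1 := by
    rw [← Finset.card_sdiff_add_card_eq_card hFE, hF]
    omega
  have h := monomial_add_mem_pow k hw hrest
  rw [← List.sum_toFinset _ hp.isTrail.edges_nodup, hcard] at h
  rw [← Finset.sum_sdiff hFE]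
  convert h using 3
  abel

end BipartiteEdgeSets

/-- Let `e` be a set of `t` distinct edges of `G` (formalized as a subgraph `e` of `G` whose
vertices are exactly the endpoints of its `t` edges) which is connected as a subgraph of `G`.
Let `Ne = N[e]` be the closed neighbourhood of `e` in `G`.  If the induced subgraph `G[e]` of
`G` on `Ne` is bipartite (2-colorable) and the induced subgraph `G[ē]` on the complement of
`Ne` is weakly chordal, then `depth S/I(G)^{t+1} ≤ 1 + depth R/I(G[ē])`, where `R` is the
polynomial ring on the vertices of `G[ē]`. -/
theorem depth_power_upper_bound_of_connected_edge_set (k : Type) [Field k] (n t : ℕ)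
    (G : SimpleGraph (Fin n)) (e : G.Subgraph)
    (he_card : e.edgeSet.ncard = t) (he_supp : e.verts = e.support) (he_conn : e.Connected)
    (Ne : Set (Fin n)) (hNe : Ne = ⋃ v ∈ e.support, insert v (G.neighborSet v))
    (hbip : (G.induce Ne).Colorable 2)
    (hwc : WeaklyChordal (G.induce Neᶜ)) :
    depthQuot k ((edgeIdeal k G) ^ (t + 1)) ≤ 1 + depthQuot k (edgeIdeal k (G.induce Neᶜ)) := by
  classical
  obtain ⟨c⟩ := hbip
  let P : Set (Fin n) := {x | ∃ h : x ∈ Ne, c ⟨x, h⟩ = 0}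
  let Q : Set (Fin n) := {x | ∃ h : x ∈ Ne, c ⟨x, h⟩ = 1}
  have hunion : P ∪ Q = Ne := by
    ext x
    refine ⟨fun h => h.elim Exists.fst Exists.fst, fun h => ?_⟩
    rcases Fin.exists_fin_two.1 ⟨c ⟨x, h⟩, rfl⟩ with h' | h'
    exacts [Or.inl ⟨h, h'⟩, Or.inr ⟨h, h'⟩]
  have hPQ : Disjoint P Q := Set.disjoint_left.2 fun x ⟨h, h₀⟩ ⟨_, h₁⟩ =>
    zero_ne_one (h₀.symm.trans h₁)
  have hsupp : ∀ i ∈ e.support, i ∈ Ne := fun i hi => by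
    rw [hNe]
    exact Set.mem_biUnion hi (Set.mem_insert i _)
  have hnbr : ∀ i ∈ e.support, ∀ j, G.Adj i j → j ∈ Ne := fun i hi j hij => by
    rw [hNe]
    exact Set.mem_biUnion hi (Set.mem_insert_of_mem i hij)
  have hcolor : ∀ {i j} (hi : i ∈ Ne) (hj : j ∈ Ne), G.Adj i j → c ⟨i, hi⟩ ≠ c ⟨j, hj⟩ :=
    fun _ _ h => c.valid h
  have hadjP : ∀ i j, j ∈ Ne → G.Adj i j → i ∈ P → j ∈ Q := fun i j hj hij ⟨hi, hci⟩ =>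
    ⟨hj, by have := hcolor hi hj hij; omega⟩
  have hadjQ : ∀ i j, j ∈ Ne → G.Adj i j → i ∈ Q → j ∈ P := fun i j hj hij ⟨hi, hci⟩ =>
    ⟨hj, by have := hcolor hi hj hij; omega⟩
  have hnear : ∀ a ∈ Ne, ∃ y ∈ e.support, G.Adj a y := fun a ha => by
    rw [hNe] at ha
    obtain ⟨v, hv, rfl | hva⟩ := Set.mem_iUnion₂.1 ha
    · obtain ⟨w, hw⟩ := hv
      exact ⟨w, ⟨a, hw.symm⟩, hw.adj_sub⟩
    · exact ⟨v, hv, hva.symm⟩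
  have heP : ∀ i j, e.Adj i j → i ∈ P → j ∈ Q := fun i j h =>
    hadjP i j (hsupp j ⟨i, h.symm⟩) h.adj_sub
  have heQ : ∀ i j, e.Adj i j → i ∈ Q → j ∈ P := fun i j h =>
    hadjQ i j (hsupp j ⟨i, h.symm⟩) h.adj_sub
  let E := e.edgeSet.toFinset
  have hE : ↑E = e.edgeSet := Set.coe_toFinset _
  have hEcard : E.card = t := by rw [← he_card, Set.ncard_eq_toFinset_card']
  have hends : ∀ i j, s(i, j) ∈ E → (i ∈ P ∧ j ∈ Q) ∨ (i ∈ Q ∧ j ∈ P) := fun i j h => by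
    replace h : s(i, j) ∈ e.edgeSet := Set.mem_toFinset.1 h
    rw [SimpleGraph.Subgraph.mem_edgeSet] at h
    rcases hunion.ge (hsupp i ⟨j, h⟩) with hi | hi
    exacts [Or.inl ⟨hi, heP i j h hi⟩, Or.inr ⟨hi, heQ i j h hi⟩]
  obtain ⟨u, v, hu, huP, hv, hvQ⟩ :
      ∃ u v, u ∈ e.support ∧ u ∈ P ∧ v ∈ e.support ∧ v ∈ Q := by
    obtain ⟨x, hx⟩ := he_conn.nonempty
    rw [he_supp] at hx
    obtain ⟨y, hxy⟩ := hx
    rcases hends x y (Set.mem_toFinset.2 hxy) with ⟨h, h'⟩ | ⟨h, h'⟩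
    exacts [⟨x, y, ⟨y, hxy⟩, h, ⟨x, hxy.symm⟩, h'⟩, ⟨y, x, ⟨x, hxy.symm⟩, h', ⟨y, hxy⟩, h⟩]
  by_contra! hlt
  have hdepth := (le_depthQuot_iff (isMonomialIdeal_edgeIdeal_pow k G (t + 1))
    ((Ideal.pow_le_self t.succ_ne_zero).trans (edgeIdeal_le_maxHomIdeal k G)) _).1
    (Nat.succ_le_of_lt hlt)
  have hstep := hdepth.sup_span_X_of_edgeIdeal_pow (D := e.support) hPQ
    (hEcard ▸ monomial_sum_edgeExp_mem k fun z hz => e.edgeSet_subset (Set.mem_toFinset.1 hz))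
    ((partDegree_sum_edgeExp hPQ hends).trans hEcard)
    ((partDegree_sum_edgeExp hPQ.symm fun i j h => (hends i j h).symm).trans hEcard)
    (fun i => mem_support_of_sum_edgeExp_ne_zero e fun z hz => Set.mem_toFinset.1 hz)
    hu huP hv hvQ
    (fun i hi j hiP hij => hadjQ i j (hnbr i hi j hij) hij
      ((hunion.ge (hsupp i hi)).resolve_left hiP))
    (fun i hi j hiQ hij => hadjP i j (hnbr i hi j hij) hij
      ((hunion.ge (hsupp i hi)).resolve_right hiQ))
    (fun a ha b hb => by
      obtain ⟨y, hy, hay⟩ := hnear a ha.1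
      obtain ⟨x, hx, hbx⟩ := hnear b hb.1
      rw [← hEcard]
      exact monomial_add_sum_edgeExp_add_mem_pow k he_conn hPQ heP heQ hE (he_supp ▸ hy)
        (hadjP a y (hsupp y hy) hay ha) hay (he_supp ▸ hx) (hadjQ b x (hsupp x hx) hbx hb) hbx)
  rw [hunion] at hstep
  have := (le_depthQuot_iff (isMonomialIdeal_edgeIdeal k _) (edgeIdeal_le_maxHomIdeal k _) _).2
    (hstep.induce_compl Ne)
  omega
end

section
/- Let T be a forest on n vertices x_1,…,x_n, let U ⊆ V(T) be a subset of its vertices, and let G be the forest obtained by adding a whisker to each vertex in U: V(G) = V(T) ∪ {y_i : x_i ∈ U} and E(G) = E(T) ∪ {{x_i,y_i} : x_i ∈ U}. Let R = k[x_1,…,x_n, y_j : x_j ∈ U] be the polynomial ring over k in the variables corresponding to the vertices of G. Then for all integers t ≥ 1, depth(R/I(G)^t) ≥ |U| − t + 1. -/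
open MvPolynomial

/-- The graph obtained from a graph `T` on `Fin n` by adding a whisker `{x_i, y_i}` at each
vertex `x_i` in `U`: the vertex set is `Fin n ⊕ ↥U` and the edges are those of `T` together
with the whisker edges. -/
def whiskerOn {n : ℕ} (T : SimpleGraph (Fin n)) (U : Finset (Fin n)) :
    SimpleGraph (Fin n ⊕ {x : Fin n // x ∈ U}) :=
  SimpleGraph.fromRel (fun u v =>
    (∃ i j, T.Adj i j ∧ u = Sum.inl i ∧ v = Sum.inl j) ∨
    (∃ w : {x : Fin n // x ∈ U}, u = Sum.inl ↑w ∧ v = Sum.inr w))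

section Depth

open CategoryTheory Limits Opposite

variable {R : Type} [CommRing R]

theorem CategoryTheory.ProjectiveResolution.extMk_zero_degree_eq_zero_iff {X Y : ModuleCat.{0} R} (P : ProjectiveResolution X)
    (f : P.complex.X 0 ⟶ Y) (hf : P.complex.d 1 0 ≫ f = 0) :
    P.extMk f 1 rfl hf = 0 ↔ f = 0 := by
  refine ⟨fun h ↦ ?_, fun h ↦ by subst h; exact P.extMk_zero 1 rfl⟩
  simp only [← P.extEquivCohomologyClass.apply_eq_iff_eq,
    ProjectiveResolution.extEquivCohomologyClass_extMk, ProjectiveResolution.extEquivCohomologyClass_zero,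
    CochainComplex.HomComplex.CohomologyClass.mk_eq_zero_iff] at h
  rw [CochainComplex.HomComplex.Cocycle.toSingleMk_mem_coboundaries_iff _ _ _ _ _ 1 (by simp)] at h
  obtain ⟨g, hg⟩ := h
  have : g = 0 := by
    apply IsZero.eq_of_src
    exact P.cochainComplex.isZero_of_isStrictlyLE 0 1
  rw [this, comp_zero] at hg
  rw [← cancel_epi (P.cochainComplexXIso (-(0:ℕ)) 0 rfl).hom]
  simpa using hg.symm

theorem extMk_eq_zero_iff_mem_range {X Y : ModuleCat.{0} R} (P : ProjectiveResolution X) (n : ℕ)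
    (f : P.complex.X n ⟶ Y) (hf : P.complex.d (n+1) n ≫ f = 0) :
    P.extMk f (n+1) rfl hf = 0 ↔
      ∃ g, ((P.complex.linearYonedaObj R Y).d ((ComplexShape.up ℕ).prev n) n).hom g = f := by
  cases n with
  | zero =>
    have : (P.complex.linearYonedaObj R Y).d ((ComplexShape.up ℕ).prev 0) 0 = 0 :=
      HomologicalComplex.shape _ _ _ (by simp)
    rw [P.extMk_zero_degree_eq_zero_iff, this]
    constructor
    · rintro rfl; exact ⟨0, rfl⟩
    · rintro ⟨g, rfl⟩; rfl
  | succ n =>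
    rw [P.extMk_eq_zero_iff f _ rfl hf n rfl, CochainComplex.prev_nat_succ]
    rfl

theorem exactAt_iff_subsingleton {X Y : ModuleCat.{0} R} (P : ProjectiveResolution X) (n : ℕ) :
    (P.complex.linearYonedaObj R Y).ExactAt n ↔ Subsingleton (Abelian.Ext X Y n) := by
  rw [HomologicalComplex.exactAt_iff' _ _ n (n+1) rfl (by simp), ShortComplex.moduleCat_exact_iff]
  constructor
  · intro H
    refine subsingleton_of_forall_eq 0 fun α => ?_
    obtain ⟨f, hf, rfl⟩ := P.extMk_surjective α (n+1) rfl
    exact (extMk_eq_zero_iff_mem_range P n f hf).2 (H f hf)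
  · intro H f hf
    exact (extMk_eq_zero_iff_mem_range P n f hf).1 (Subsingleton.elim _ _)

theorem isZero_ext_iff (X Y : ModuleCat.{0} R) (n : ℕ)  :
    IsZero (((Ext R (ModuleCat.{0} R) n).obj (op X)).obj Y) ↔ Subsingleton (Abelian.Ext X Y n) := by
  rw [((projectiveResolution X).isoExt n Y).isZero_iff, ← HomologicalComplex.exactAt_iff_isZero_homology, exactAt_iff_subsingleton]

theorem mono_homologyMap_of_elements {K L : CochainComplex (ModuleCat.{0} R) ℕ} (ψ : K ⟶ L) (n : ℕ)
    (h : ∀ x : K.X n, (K.d n (n+1)).hom x = 0 →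
      (∃ y, (L.d ((ComplexShape.up ℕ).prev n) n).hom y = (ψ.f n).hom x) →
      ∃ y, (K.d ((ComplexShape.up ℕ).prev n) n).hom y = x) :
    Mono (HomologicalComplex.homologyMap ψ n) := by
  rw [HomologicalComplex.mono_homologyMap_iff_up_to_refinements ψ _ n (n+1) rfl (by simp)]
  intro A x hx y hy
  let S : Submodule R (A × K.X ((ComplexShape.up ℕ).prev n)) :=
    LinearMap.eqLocus (x.hom ∘ₗ LinearMap.fst R _ _)
      ((K.d ((ComplexShape.up ℕ).prev n) n).hom ∘ₗ LinearMap.snd R _ _)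
  refine ⟨ModuleCat.of R S, ModuleCat.ofHom (LinearMap.fst R _ _ ∘ₗ S.subtype), ?_,
    ModuleCat.ofHom (LinearMap.snd R _ _ ∘ₗ S.subtype), ?_⟩
  · rw [ModuleCat.epi_iff_surjective]
    intro a
    obtain ⟨b, hb⟩ := h (x.hom a) (congr($hx a)) ⟨y.hom a, congr($hy.symm a)⟩
    exact ⟨⟨(a, b), hb.symm⟩, rfl⟩
  · ext s
    exact s.2

theorem epi_homologyMap_op {K L : CochainComplex (ModuleCat.{0} R) ℕ} (ψ : K ⟶ L) (n : ℕ)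
    [Mono (HomologicalComplex.homologyMap ψ n)] :
    Epi (HomologicalComplex.homologyMap ((HomologicalComplex.opFunctor (ModuleCat R)
      (ComplexShape.up ℕ)).map ψ.op) n) := by
  have h := HomologicalComplex.homologyOp_hom_naturality ψ n
  have e := (Iso.eq_comp_inv (K.homologyOp n)).2 h
  have : Epi (((L.homologyOp n).hom ≫ (HomologicalComplex.homologyMap ψ n).op) ≫
    (K.homologyOp n).inv) := inferInstance
  exact e ▸ this

theorem mono_ext_map {X X' : ModuleCat.{0} R} (Y : ModuleCat.{0} R) (g : X' ⟶ X) (n : ℕ)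
    (h : Function.Injective ((Abelian.Ext.mk₀ g).precomp Y (zero_add n))) :
    Mono (((Ext R (ModuleCat.{0} R) n).map g.op).app Y) := by
  let P := projectiveResolution X
  let P' := projectiveResolution X'
  let φ : P'.complex ⟶ P.complex := ProjectiveResolution.lift g P' P
  have w : φ ≫ P.π = P'.π ≫ (ChainComplex.single₀ _).map g := ProjectiveResolution.lift_commutes _ _ _
  let F := ((linearYoneda R (ModuleCat.{0} R)).obj Y).rightOp
  let φH : ProjectiveResolution.Hom P' P g := ⟨φ, by simpa using congr(($w).f 0)⟩
  suffices Mono ((F.leftDerived n).map g).unop from this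
  have := Functor.leftDerived_map_eq F n g φ w
  rw [this]
  suffices Epi (HomologicalComplex.homologyMap ((F.mapHomologicalComplex (ComplexShape.down ℕ)).map φ) n) by
    have : Epi ((F.mapHomologicalComplex (ComplexShape.down ℕ) ⋙ HomologicalComplex.homologyFunctor (ModuleCat R)ᵒᵖ (ComplexShape.down ℕ) n).map φ) := this
    have : Epi ((P'.isoLeftDerivedObj F n).hom ≫
        (F.mapHomologicalComplex (ComplexShape.down ℕ) ⋙
                HomologicalComplex.homologyFunctor (ModuleCat R)ᵒᵖ (ComplexShape.down ℕ) n).map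
            φ ≫ (P.isoLeftDerivedObj F n).inv) := inferInstance
    exact unop_mono_of_epi _
  let ψ : P.complex.linearYonedaObj R Y ⟶ P'.complex.linearYonedaObj R Y :=
    (HomologicalComplex.unopFunctor _ _).map ((F.mapHomologicalComplex (ComplexShape.down ℕ)).map φ).op
  have hm : Mono (HomologicalComplex.homologyMap ψ n) := by
    apply mono_homologyMap_of_elements
    intro x hx hy
    rw [← extMk_eq_zero_iff_mem_range P n x hx]
    apply h
    rw [map_zero]
    refine (P.mk₀_comp_extMk x (n+1) rfl hx φH).trans ?_
    exact (extMk_eq_zero_iff_mem_range P' n _ _).2 hy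
  exact epi_homologyMap_op ψ n

/-- `R ⧸ J` has vanishing `Ext^i(N, R ⧸ J)` for `i < d` and all `N` killed by a power of `m`. -/
def DepthAtLeast (m : Ideal R) (d : ℕ) (J : Ideal R) : Prop :=
  ∀ i < d, ∀ N : ModuleCat.{0} R, (∃ s, ∀ r ∈ m ^ s, ∀ x : N, r • x = 0) →
    Subsingleton (Abelian.Ext N (ModuleCat.of R (R ⧸ J)) i)

theorem DepthAtLeast.zero (m J : Ideal R) : DepthAtLeast m 0 J := fun _ h ↦ absurd h (Nat.not_lt_zero _)

theorem DepthAtLeast.mono {m J : Ideal R} {d e : ℕ} (h : DepthAtLeast m d J) (hed : e ≤ d) :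
    DepthAtLeast m e J := fun i hi ↦ h i (hi.trans_le hed)

theorem DepthAtLeast.top (m : Ideal R) (d : ℕ) : DepthAtLeast m d ⊤ := by
  intro i _ N _
  have : IsZero (ModuleCat.of R (R ⧸ (⊤ : Ideal R))) := ModuleCat.isZero_of_subsingleton _
  refine subsingleton_of_forall_eq 0 fun x ↦ ?_
  rw [← x.comp_mk₀_id, this.eq_of_src (𝟙 _) 0, Abelian.Ext.mk₀_zero, Abelian.Ext.comp_zero]

/-- The sequence `R ⧸ (J : f) → R ⧸ J → R ⧸ (J + (f))`. -/
noncomputable def colonSequence (f : R) (K J : Ideal R) (h : ∀ r, r ∈ K ↔ f * r ∈ J) :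
    ShortComplex (ModuleCat.{0} R) :=
  ShortComplex.mk
    (ModuleCat.ofHom (Submodule.mapQ K J (LinearMap.mulLeft R f) fun r hr ↦ (h r).1 hr))
    (ModuleCat.ofHom (Submodule.mapQ J (J ⊔ Ideal.span {f}) LinearMap.id
      fun _ hr ↦ Ideal.mem_sup_left hr)) (by
      refine ModuleCat.hom_ext (LinearMap.ext fun x ↦ ?_)
      obtain ⟨x, rfl⟩ := Submodule.Quotient.mk_surjective _ x
      exact (Submodule.Quotient.mk_eq_zero _).2
        (Ideal.mem_sup_right (Ideal.mul_mem_right x _ (Ideal.mem_span_singleton_self f))))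

theorem colonSequence_shortExact (f : R) (K J : Ideal R) (h : ∀ r, r ∈ K ↔ f * r ∈ J) :
    (colonSequence f K J h).ShortExact := by
  apply ModuleCat.shortComplex_shortExact
  · intro x
    obtain ⟨x, rfl⟩ := Submodule.Quotient.mk_surjective _ x
    constructor
    · intro hx
      have hx : x ∈ J ⊔ Ideal.span {f} := (Submodule.Quotient.mk_eq_zero _).1 hx
      obtain ⟨y, hy, z, hz, rfl⟩ := Submodule.mem_sup.1 hx
      obtain ⟨r, rfl⟩ := Ideal.mem_span_singleton'.1 hz
      refine ⟨Submodule.Quotient.mk r, ?_⟩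
      refine (Submodule.Quotient.eq J).2 ?_
      simpa [mul_comm] using hy
    · rintro ⟨y, hy⟩
      obtain ⟨y, rfl⟩ := Submodule.Quotient.mk_surjective _ y
      have hy : f * y - x ∈ J := (Submodule.Quotient.eq J).1 hy
      refine (Submodule.Quotient.mk_eq_zero _).2 ?_
      have := Submodule.sub_mem _ (Ideal.mem_sup_right (Ideal.mul_mem_right y _
        (Ideal.mem_span_singleton_self f))) (Ideal.mem_sup_left (T := Ideal.span {f}) hy)
      simpa using! this
  · refine (injective_iff_map_eq_zero (Submodule.mapQ K J (LinearMap.mulLeft R f) fun r hr ↦ (h r).1 hr)).2 ?_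
    intro x hx
    obtain ⟨x, rfl⟩ := Submodule.Quotient.mk_surjective _ x
    exact (Submodule.Quotient.mk_eq_zero _).2 ((h x).2 ((Submodule.Quotient.mk_eq_zero _).1 hx))
  · intro x
    obtain ⟨x, rfl⟩ := Submodule.Quotient.mk_surjective _ x
    exact ⟨Submodule.Quotient.mk x, rfl⟩

theorem ext_comp_eq_zero_of_subsingleton {X Y Z : ModuleCat.{0} R} {a b c : ℕ}
    (h : Subsingleton (Abelian.Ext X Y a)) (x : Abelian.Ext X Y a) (y : Abelian.Ext Y Z b)
    (habc : a + b = c) : x.comp y habc = 0 := by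
  rw [Subsingleton.elim x 0, Abelian.Ext.zero_comp]

theorem DepthAtLeast.of_colon {m : Ideal R} {d : ℕ} {f : R} {K J : Ideal R}
    (h : ∀ r, r ∈ K ↔ f * r ∈ J) (hK : DepthAtLeast m d K)
    (hJ : DepthAtLeast m d (J ⊔ Ideal.span {f})) : DepthAtLeast m d J := by
  intro i hi N hN
  refine subsingleton_of_forall_eq 0 fun x ↦ ?_
  obtain ⟨y, rfl⟩ := Abelian.Ext.covariant_sequence_exact₂ N (colonSequence_shortExact f K J h) x
    (@Subsingleton.elim _ (hJ i hi N hN) _ _)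
  exact ext_comp_eq_zero_of_subsingleton (hK i hi N hN) y _ _

theorem smul_injective_of_depth {m : Ideal R} {d : ℕ} {f : R} {J : Ideal R}
    (h : ∀ r, r ∈ J ↔ f * r ∈ J) (hJ : DepthAtLeast m d (J ⊔ Ideal.span {f})) {i : ℕ} (hi : i < d + 1)
    (N : ModuleCat.{0} R) (hN : ∃ s, ∀ r ∈ m ^ s, ∀ x : N, r • x = 0)
    (x : Abelian.Ext N (ModuleCat.of R (R ⧸ J)) i) (hx : f • x = 0) : x = 0 := by
  have e : (colonSequence f J J h).f = f • 𝟙 (ModuleCat.of R (R ⧸ J)) :=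
    ModuleCat.hom_ext (LinearMap.ext fun y ↦ by
      obtain ⟨y, rfl⟩ := Submodule.Quotient.mk_surjective _ y
      rfl)
  have hx₀ : x.comp (Abelian.Ext.mk₀ (f • 𝟙 (ModuleCat.of R (R ⧸ J)))) (add_zero i) = 0 := by
    rw [Abelian.Ext.mk₀_smul, Abelian.Ext.comp_smul, Abelian.Ext.comp_mk₀_id, hx]
  have hx' : x.comp (Abelian.Ext.mk₀ (colonSequence f J J h).f) (add_zero i) = 0 := e ▸ hx₀
  cases i with
  | zero =>
    have := (colonSequence_shortExact f J J h).mono_f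
    exact Abelian.Ext.postcomp_mk₀_injective_of_mono N (colonSequence f J J h).f
      (hx'.trans (map_zero _).symm)
  | succ i =>
    obtain ⟨y, rfl⟩ := Abelian.Ext.covariant_sequence_exact₁ N (colonSequence_shortExact f J J h) x
      hx' rfl
    exact ext_comp_eq_zero_of_subsingleton (hJ i (by omega) N hN) y _ _

theorem smul_ext_eq_zero {N M : ModuleCat.{0} R} {r : R} (h : ∀ x : N, r • x = 0) {i : ℕ}
    (x : Abelian.Ext N M i) : r • x = 0 := by
  have e : r • 𝟙 N = 0 := by
    ext y
    exact h y
  rw [← x.mk₀_id_comp, ← Abelian.Ext.smul_comp, ← Abelian.Ext.mk₀_smul, e, Abelian.Ext.mk₀_zero, Abelian.Ext.zero_comp]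

theorem DepthAtLeast.succ {m : Ideal R} {d : ℕ} {f : R} (hf : f ∈ m) {J : Ideal R}
    (h : ∀ r, r ∈ J ↔ f * r ∈ J) (hJ : DepthAtLeast m d (J ⊔ Ideal.span {f})) :
    DepthAtLeast m (d + 1) J := by
  intro i hi N hN
  obtain ⟨s, hs⟩ := id hN
  refine subsingleton_of_forall_eq 0 fun x ↦ ?_
  have key : ∀ (t : ℕ), f ^ t • x = 0 → x = 0 := by
    intro t
    induction t with
    | zero => simp
    | succ t ih =>
      intro ht
      rw [pow_succ', mul_smul] at ht
      exact ih (smul_injective_of_depth h hJ hi N hN _ ht)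
  exact key s (smul_ext_eq_zero (hs _ (Ideal.pow_mem_pow hf s)) x)

theorem exists_ext_nontrivial [IsNoetherianRing R] (m J : Ideal R) [m.IsMaximal] (hJ : J ≤ m) :
    ∃ i, DepthAtLeast m i J ∧
      Nontrivial (Abelian.Ext (ModuleCat.of R (R ⧸ m)) (ModuleCat.of R (R ⧸ J)) i) := by
  induction J using IsNoetherian.induction with
  | hgt J ih =>
  by_cases hx : ∃ f ∈ m, ∀ r, f * r ∈ J → r ∈ J
  · obtain ⟨f, hf, hreg⟩ := hx
    have h : ∀ r, r ∈ J ↔ f * r ∈ J := fun r ↦ ⟨Ideal.mul_mem_left J f, hreg r⟩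
    have hfJ : f ∉ J := fun hfJ ↦ by
      have := hreg 1 (by simpa)
      exact (Ideal.ne_top_iff_one m).1 (Ideal.IsPrime.ne_top inferInstance) (hJ this)
    obtain ⟨i, hi, hn⟩ := ih (J ⊔ Ideal.span {f})
      (lt_of_le_of_ne le_sup_left fun e ↦ hfJ (e ▸ Ideal.mem_sup_right (Ideal.mem_span_singleton_self f)))
      (sup_le hJ (by simpa [Ideal.span_le] using hf))
    have hd := DepthAtLeast.succ hf h hi
    refine ⟨i + 1, hd, ?_⟩
    by_contra hcon
    rw [not_nontrivial_iff_subsingleton] at hcon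
    obtain ⟨x, hx⟩ := exists_ne (0 : Abelian.Ext (ModuleCat.of R (R ⧸ m)) (ModuleCat.of R (R ⧸ (J ⊔ Ideal.span {f}))) i)
    obtain ⟨y, hy⟩ := Abelian.Ext.covariant_sequence_exact₃ _ (colonSequence_shortExact f J J h) x
      (n₁ := i + 1) rfl (@Subsingleton.elim _ hcon _ _)
    refine hx (hy.symm.trans (ext_comp_eq_zero_of_subsingleton (hd i (by omega) _ ⟨1, fun r hr x ↦ ?_⟩) y _ _))
    obtain ⟨x, rfl⟩ := Ideal.Quotient.mk_surjective x
    exact Ideal.Quotient.eq_zero_iff_mem.2 (Ideal.mul_mem_right _ _ (by simpa using hr))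
  · refine ⟨0, .zero _ _, ?_⟩
    push Not at hx
    have hle : (m : Set R) ⊆ ⋃ p ∈ associatedPrimes R (R ⧸ J), p := by
      rw [biUnion_associatedPrimes_eq_compl_regular]
      intro f hf hreg
      obtain ⟨r, hr, hr'⟩ := hx f hf
      apply hr'
      rw [← Ideal.Quotient.eq_zero_iff_mem]
      apply hreg
      simpa using! Ideal.Quotient.eq_zero_iff_mem.2 hr
    have hfin := associatedPrimes.finite R (R ⧸ J)
    obtain ⟨p, hp, hmp⟩ := (Ideal.subset_union_prime_finite hfin ⊥ ⊥ fun p hp _ _ ↦ IsAssociatedPrime.isPrime hp).1 hle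
    have hpm : m = p := Ideal.IsMaximal.eq_of_le inferInstance (IsAssociatedPrime.isPrime hp).ne_top hmp
    obtain ⟨_, g, hg⟩ := (isAssociatedPrime_iff_exists_injective_linearMap _ _).1 hp
    have : Nontrivial (ModuleCat.of R (R ⧸ m) ⟶ ModuleCat.of R (R ⧸ J)) := by
      subst hpm
      refine ⟨⟨ModuleCat.ofHom g, 0, fun h0 ↦ ?_⟩⟩
      have h1 : g 1 = g 0 := by
        rw [map_zero]
        exact congr($h0 (1 : R ⧸ m))
      exact one_ne_zero (hg h1)
    exact Abelian.Ext.addEquiv₀.toEquiv.nontrivial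

theorem precomp_mk₀_injective_of_ker {X X' Y : ModuleCat.{0} R} (g : X' ⟶ X)
    (hg : Function.Surjective g) (n : ℕ)
    (h : ∀ i < n, Subsingleton (Abelian.Ext (ModuleCat.of R (LinearMap.ker g.hom)) Y i)) :
    Function.Injective ((Abelian.Ext.mk₀ g).precomp Y (zero_add n)) := by
  cases n with
  | zero =>
    have : Epi g := (ModuleCat.epi_iff_surjective g).2 hg
    exact Abelian.Ext.precomp_mk₀_injective_of_epi Y g
  | succ n =>
    let S : ShortComplex (ModuleCat.{0} R) :=
      ShortComplex.mk (ModuleCat.ofHom (LinearMap.ker g.hom).subtype) g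
        (ModuleCat.hom_ext (LinearMap.ext fun x ↦ x.2))
    have hS : S.ShortExact := ModuleCat.shortComplex_shortExact S
      (fun x ↦ ⟨fun hx ↦ ⟨⟨x, hx⟩, rfl⟩, fun ⟨y, hy⟩ ↦ hy ▸ y.2⟩)
      (LinearMap.ker g.hom).injective_subtype hg
    refine (injective_iff_map_eq_zero _).2 fun x hx ↦ ?_
    obtain ⟨y, rfl⟩ := Abelian.Ext.contravariant_sequence_exact₃ hS Y x hx (add_comm 1 n)
    have hy : Subsingleton (Abelian.Ext S.X₁ Y n) := h n n.lt_succ_self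
    rw [Subsingleton.elim y 0, Abelian.Ext.comp_zero]

/-- Local cohomology as a colimit of `Ext` modules, evaluated at a module. -/
noncomputable def localCohomologyObjIso (m : Ideal R) (i : ℕ) (Y : ModuleCat.{0} R) :
    (localCohomology m i).obj Y ≅
      colimit (localCohomology.diagram (localCohomology.idealPowersDiagram m) i ⋙
        (evaluation _ _).obj Y) :=
  preservesColimitIso ((evaluation _ _).obj Y)
    (localCohomology.diagram (localCohomology.idealPowersDiagram m) i)

theorem smul_quotient_eq_zero {I : Ideal R} {r : R} (hr : r ∈ I) (x : R ⧸ I) : r • x = 0 := by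
  obtain ⟨x, rfl⟩ := Ideal.Quotient.mk_surjective x
  exact Ideal.Quotient.eq_zero_iff_mem.2 (Ideal.mul_mem_right _ _ hr)

theorem subsingleton_localCohomology {m J : Ideal R} {d i : ℕ} (h : DepthAtLeast m d J)
    (hi : i < d) : Subsingleton ((localCohomology m i).obj (ModuleCat.of R (R ⧸ J))) := by
  rw [← ModuleCat.isZero_iff_subsingleton]
  refine IsZero.of_iso ?_ (localCohomologyObjIso m i _)
  rw [IsZero.iff_id_eq_zero]
  refine colimit.hom_ext fun t ↦ IsZero.eq_of_src ?_ _ _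
  refine (isZero_ext_iff _ _ _).2 (h i hi _ ⟨t.unop.unop, fun r hr x ↦ smul_quotient_eq_zero hr x⟩)

theorem nontrivial_localCohomology {m J : Ideal R} {i : ℕ} (h : DepthAtLeast m i J)
    (hn : Nontrivial (Abelian.Ext (ModuleCat.of R (R ⧸ m)) (ModuleCat.of R (R ⧸ J)) i)) :
    Nontrivial ((localCohomology m i).obj (ModuleCat.of R (R ⧸ J))) := by
  set Y := ModuleCat.of R (R ⧸ J)
  let F := localCohomology.diagram (localCohomology.idealPowersDiagram m) i ⋙
        (evaluation _ _).obj Y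
  let t : ℕᵒᵖᵒᵖ := op (op 1)
  have ht : Nontrivial (F.obj t) := by
    rw [← not_subsingleton_iff_nontrivial]
    intro hs
    have hz : IsZero (F.obj t) := (ModuleCat.isZero_iff_subsingleton).2 hs
    have := (isZero_ext_iff (ModuleCat.of R (R ⧸ m ^ 1)) Y i).1 hz
    rw [pow_one] at this
    exact not_subsingleton_iff_nontrivial.2 hn this
  rw [← not_subsingleton_iff_nontrivial]
  intro hs
  have hz : IsZero (colimit F) :=
    IsZero.of_iso ((ModuleCat.isZero_iff_subsingleton).2 hs) (localCohomologyObjIso m i _).symm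
  have hs' := (ModuleCat.isZero_iff_subsingleton).1 hz
  obtain ⟨x, hx⟩ := exists_ne (0 : F.obj t)
  obtain ⟨s, f, hf⟩ := Concrete.colimit_rep_eq_zero R F t x (Subsingleton.elim _ _)
  refine hx ?_
  have hm : Mono (F.map f) := by
    refine mono_ext_map Y ((localCohomology.ringModIdeals
      (localCohomology.idealPowersDiagram m)).map f.unop) i ?_
    apply precomp_mk₀_injective_of_ker
    · intro x
      obtain ⟨x, rfl⟩ := Submodule.Quotient.mk_surjective _ x
      exact ⟨Submodule.Quotient.mk x, rfl⟩
    · intro j hj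
      refine h j hj _ ⟨s.unop.unop, fun r hr x ↦ Subtype.ext ?_⟩
      exact smul_quotient_eq_zero hr x.1
  exact (ModuleCat.mono_iff_injective (F.map f)).1 hm (hf.trans (map_zero _).symm)

theorem DepthAtLeast.le_sInf [IsNoetherianRing R] {m J : Ideal R} [m.IsMaximal] (hJ : J ≤ m)
    {d : ℕ} (h : DepthAtLeast m d J) :
    d ≤ sInf {i : ℕ | Nontrivial ((localCohomology m i).obj (ModuleCat.of R (R ⧸ J)))} := by
  obtain ⟨i, hi, hn⟩ := exists_ext_nontrivial m J hJ
  refine le_csInf ⟨i, nontrivial_localCohomology hi hn⟩ fun j hj ↦ ?_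
  by_contra! hlt
  exact not_subsingleton_iff_nontrivial.2 hj (subsingleton_localCohomology h hlt)

end Depth

theorem SimpleGraph.IsAcyclic.exists_height {V : Type*} [Finite V] {G : SimpleGraph V}
    (hG : G.IsAcyclic) : ∃ h : V → ℕ, (∀ a b, G.Adj a b → h a ≠ h b) ∧
      ∀ a b c, G.Adj a b → G.Adj a c → h a < h b → h a < h c → b = c := by
  let r : V → V := fun v ↦ (G.connectedComponentMk v).nonempty_supp.some
  have hr : ∀ v, G.Reachable (r v) v := fun v ↦
    SimpleGraph.ConnectedComponent.exact (G.connectedComponentMk v).nonempty_supp.some_mem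
  have hadj : ∀ {a b}, G.Adj a b → r a = r b := fun {a b} hab ↦ by
    simp only [r, SimpleGraph.ConnectedComponent.sound hab.reachable]
  obtain ⟨N, hN⟩ := (Set.finite_range fun v ↦ G.dist (r v) v).bddAbove
  replace hN : ∀ v, G.dist (r v) v ≤ N := fun v ↦ hN ⟨v, rfl⟩
  refine ⟨fun v ↦ N - G.dist (r v) v, fun a b hab ↦ ?_, fun a b c hab hac h₁ h₂ ↦ ?_⟩
  · have h₁ := hG.dist_ne_of_adj hab (hr a)
    have h₂ := hN b
    change N - G.dist (r a) a ≠ N - G.dist (r b) b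
    rw [← hadj hab] at h₂ ⊢
    have := hN a
    omega
  · have key : ∀ b, G.Adj a b → N - G.dist (r a) a < N - G.dist (r b) b →
        ∃ p : G.Walk (r a) a, p.IsPath ∧ p.penultimate = b := by
      intro b hab hlt
      have hrb := hr b
      rw [← hadj hab] at hlt hrb
      obtain ⟨p, hp⟩ := hrb.exists_walk_length_eq_dist
      refine ⟨p.concat hab.symm, ?_, p.penultimate_concat hab.symm⟩
      apply SimpleGraph.Walk.isPath_of_length_eq_dist
      have := hG.dist_eq_dist_add_one_of_adj_of_reachable (r a) hab (hr a)
      rw [SimpleGraph.Walk.length_concat]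
      omega
    obtain ⟨p, hp, rfl⟩ := key b hab h₁
    obtain ⟨q, hq, rfl⟩ := key c hac h₂
    have := hG.subsingleton_path (r a) a
    have hpq : (⟨p, hp⟩ : G.Path (r a) a) = ⟨q, hq⟩ := Subsingleton.elim _ _
    rw [Subtype.mk.inj hpq]

section Covers

variable {V : Type}

/-- The exponent `m` is divisible by a product of `t` edges of `G`. -/
def EdgeCovers (G : SimpleGraph V) : ℕ → (V →₀ ℕ) → Prop
  | 0, _ => True
  | t + 1, m => ∃ a b m', G.Adj a b ∧ EdgeCovers G t m' ∧
      m = m' + Finsupp.single a 1 + Finsupp.single b 1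

variable {G : SimpleGraph V}

theorem EdgeCovers.add {t : ℕ} {m : V →₀ ℕ} (h : EdgeCovers G t m) (c : V →₀ ℕ) :
    EdgeCovers G t (m + c) := by
  induction t generalizing m with
  | zero => trivial
  | succ t ih =>
    obtain ⟨a, b, m', hab, hm', rfl⟩ := h
    exact ⟨a, b, m' + c, hab, ih hm', by abel⟩

theorem EdgeCovers.add_edge {t : ℕ} {m : V →₀ ℕ} (h : EdgeCovers G t m) {a b : V}
    (hab : G.Adj a b) : EdgeCovers G (t + 1) (m + Finsupp.single a 1 + Finsupp.single b 1) :=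
  ⟨a, b, m, hab, h, rfl⟩

theorem exists_eq_add_single {m : V →₀ ℕ} {z : V} (h : 0 < m z) :
    ∃ m', m = m' + Finsupp.single z 1 :=
  ⟨m - Finsupp.single z 1, (tsub_add_cancel_of_le (Finsupp.single_le_iff.2 h)).symm⟩

/-- Moving a factor `y` whose only neighbour off `W` is `x` to another neighbour `b` of `x`. -/
theorem EdgeCovers.exchange {W : Finset V} {x y b : V} (hy : ∀ a, a ∉ W → G.Adj y a → a = x)
    (hyW : y ∉ W) (hb : G.Adj x b) {t : ℕ} {m : V →₀ ℕ} (hm : ∀ w ∈ W, m w = 0)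
    (h : EdgeCovers G t (m + Finsupp.single y 1)) : EdgeCovers G t (m + Finsupp.single b 1) := by
  classical
  induction t generalizing m with
  | zero => trivial
  | succ t ih =>
    obtain ⟨p, q, m', hpq, hm', e⟩ := h
    have hv : ∀ v, m v + (Finsupp.single y 1 : V →₀ ℕ) v =
      m' v + (Finsupp.single p 1 : V →₀ ℕ) v + (Finsupp.single q 1 : V →₀ ℕ) v :=
      fun v ↦ DFunLike.congr_fun e v
    have hpW : p ∉ W := fun hp ↦ by
      have := hv p
      simp [hm p hp, show y ≠ p by rintro rfl; exact hyW hp] at this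
      omega
    have hqW : q ∉ W := fun hq ↦ by
      have := hv q
      simp [hm q hq, show y ≠ q by rintro rfl; exact hyW hq] at this
    by_cases hyp : p = y
    · subst hyp
      obtain rfl := hy q hqW hpq
      obtain rfl : m = m' + Finsupp.single q 1 :=
        add_right_cancel (b := Finsupp.single p 1) (by rw [e]; abel)
      exact hm'.add_edge hb
    by_cases hyq : q = y
    · subst hyq
      obtain rfl := hy p hpW hpq.symm
      obtain rfl : m = m' + Finsupp.single p 1 := add_right_cancel e
      exact hm'.add_edge hb
    obtain ⟨m₀, rfl⟩ : ∃ m₀, m' = m₀ + Finsupp.single y 1 := by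
      apply exists_eq_add_single
      have := hv y
      simp [hyp, hyq] at this
      omega
    obtain rfl : m = m₀ + Finsupp.single p 1 + Finsupp.single q 1 :=
      add_right_cancel (b := Finsupp.single y 1) (by rw [e]; abel)
    have := (ih (m := m₀) (fun w hw ↦ by have := hm w hw; simp at this; omega) hm').add_edge hpq
    convert this using 1
    abel

/-- If `x` is the only neighbour of `y` off `W`, a product of edges covering `m x y` can be
chosen to contain the edge `x y`. -/
theorem EdgeCovers.of_add_edge {W : Finset V} {x y : V} (hy : ∀ a, a ∉ W → G.Adj y a → a = x)
    (hxy : G.Adj x y) (hxW : x ∉ W) (hyW : y ∉ W) {t : ℕ} {m : V →₀ ℕ} (hm : ∀ w ∈ W, m w = 0)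
    (h : EdgeCovers G (t + 1) (m + Finsupp.single x 1 + Finsupp.single y 1)) :
    EdgeCovers G t m := by
  classical
  induction t generalizing m with
  | zero => trivial
  | succ t ih =>
    obtain ⟨p, q, m', hpq, hm', e⟩ := h
    have hv : ∀ v, m v + (Finsupp.single x 1 : V →₀ ℕ) v + (Finsupp.single y 1 : V →₀ ℕ) v =
      m' v + (Finsupp.single p 1 : V →₀ ℕ) v + (Finsupp.single q 1 : V →₀ ℕ) v :=
      fun v ↦ DFunLike.congr_fun e v
    have hpW : p ∉ W := fun hp ↦ by
      have := hv p
      simp [hm p hp, show y ≠ p by rintro rfl; exact hyW hp,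
        show x ≠ p by rintro rfl; exact hxW hp] at this
      omega
    have hqW : q ∉ W := fun hq ↦ by
      have := hv q
      simp [hm q hq, show y ≠ q by rintro rfl; exact hyW hq,
        show x ≠ q by rintro rfl; exact hxW hq] at this
    clear hxW
    wlog hp : p ≠ y ∧ q ≠ y ∧ q ≠ x generalizing p q with H
    · by_cases hp' : q ≠ y ∧ p ≠ y ∧ p ≠ x
      · exact H q p hpq.symm (by rw [e]; abel) (fun v ↦ by rw [hv v]; abel) hqW hpW hp'
      obtain ⟨rfl, rfl⟩ | ⟨rfl, rfl⟩ : (p = x ∧ q = y) ∨ (p = y ∧ q = x) := by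
        by_cases h1 : p = y
        · subst h1
          exact .inr ⟨rfl, hy q hqW hpq⟩
        by_cases h2 : q = y
        · subst h2
          exact .inl ⟨hy p hpW hpq.symm, rfl⟩
        have h3 : p = x := by tauto
        have h4 : q = x := by tauto
        exact absurd (h3.trans h4.symm) hpq.ne
      · obtain rfl : m = m' := add_right_cancel (add_right_cancel e)
        exact hm'
      · obtain rfl : m = m' :=
          add_right_cancel (b := Finsupp.single q 1 + Finsupp.single p 1) (by
            rw [← add_assoc, e]; abel)
        exact hm'
    obtain ⟨hpy, hqy, hqx⟩ := hp
    by_cases hpx : p = x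
    · subst hpx
      obtain ⟨m₀, rfl⟩ : ∃ m₀, m = m₀ + Finsupp.single q 1 := by
        apply exists_eq_add_single
        have := hv q
        simp [hqx.symm, hqy.symm] at this
        omega
      obtain rfl : m' = m₀ + Finsupp.single y 1 :=
        add_right_cancel (b := Finsupp.single p 1 + Finsupp.single q 1) (by
          rw [← add_assoc, ← e]; abel)
      exact hm'.exchange hy hyW hpq (fun w hw ↦ by have := hm w hw; simp at this; omega)
    have hxy' := hxy.ne
    obtain ⟨m₁, rfl⟩ : ∃ m₁, m' = m₁ + Finsupp.single y 1 := by
      apply exists_eq_add_single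
      have := hv y
      simp [hpy, hqy, hxy'] at this
      omega
    obtain ⟨m₀, rfl⟩ : ∃ m₀, m₁ = m₀ + Finsupp.single x 1 := by
      apply exists_eq_add_single
      have := hv x
      simp [hpx, hqx, hxy'.symm] at this
      omega
    obtain rfl : m = m₀ + Finsupp.single p 1 + Finsupp.single q 1 :=
      add_right_cancel (b := Finsupp.single x 1 + Finsupp.single y 1) (by
        rw [← add_assoc, e]; abel)
    exact (ih (m := m₀) (fun w hw ↦ by have := hm w hw; simp at this; omega) hm').add_edge hpq

theorem EdgeCovers.of_add_isolated {W : Finset V} {z : V} (hz : ∀ a, G.Adj z a → a ∈ W)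
    (hzW : z ∉ W) {t : ℕ} {m : V →₀ ℕ} (hm : ∀ w ∈ W, m w = 0)
    (h : EdgeCovers G t (m + Finsupp.single z 1)) : EdgeCovers G t m := by
  classical
  induction t generalizing m with
  | zero => trivial
  | succ t ih =>
    obtain ⟨p, q, m', hpq, hm', e⟩ := h
    have hv : ∀ v, m v + (Finsupp.single z 1 : V →₀ ℕ) v =
      m' v + (Finsupp.single p 1 : V →₀ ℕ) v + (Finsupp.single q 1 : V →₀ ℕ) v :=
      fun v ↦ DFunLike.congr_fun e v
    have hpz : p ≠ z := by
      rintro rfl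
      have := hv q
      simp [hm q (hz q hpq), hpq.ne] at this
    have hqz : q ≠ z := by
      rintro rfl
      have := hv p
      simp [hm p (hz p hpq.symm), hpq.ne.symm] at this
    obtain ⟨m₀, rfl⟩ : ∃ m₀, m' = m₀ + Finsupp.single z 1 := by
      apply exists_eq_add_single
      have := hv z
      simp [hpz, hqz] at this
      omega
    obtain rfl : m = m₀ + Finsupp.single p 1 + Finsupp.single q 1 :=
      add_right_cancel (b := Finsupp.single z 1) (by rw [e]; abel)
    exact (ih (m := m₀) (fun w hw ↦ by have := hm w hw; simp at this; omega) hm').add_edge hpq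

/-- Exponents of the monomials in `I(G) ^ t + (W)`. -/
def powExponents (G : SimpleGraph V) (W : Finset V) (t : ℕ) : Set (V →₀ ℕ) :=
  {m | (∃ w ∈ W, 0 < m w) ∨ EdgeCovers G t m}

theorem powExponents_isUpperSet (G : SimpleGraph V) (W : Finset V) (t : ℕ) :
    IsUpperSet (powExponents G W t) := by
  intro m m' hle hm
  obtain ⟨c, rfl⟩ := exists_add_of_le hle
  refine hm.imp (fun ⟨w, hw, h⟩ ↦ ⟨w, hw, ?_⟩) fun h ↦ h.add c
  simp only [Finsupp.add_apply]
  omega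

theorem powExponents_insert [DecidableEq V] (W : Finset V) (t : ℕ) (z : V) (m : V →₀ ℕ) :
    m ∈ powExponents G (insert z W) t ↔ m ∈ powExponents G W t ∨ 0 < m z := by
  simp only [powExponents, Set.mem_ofPred_eq, Finset.mem_insert]
  constructor
  · rintro (⟨w, rfl | hw, h⟩ | h)
    · exact .inr h
    · exact .inl (.inl ⟨w, hw, h⟩)
    · exact .inl (.inr h)
  · rintro ((⟨w, hw, h⟩ | h) | h)
    · exact .inl ⟨w, .inr hw, h⟩
    · exact .inr h
    · exact .inl ⟨z, .inl rfl, h⟩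

theorem add_edge_mem_powExponents {W : Finset V} {x y : V}
    (hy : ∀ a, a ∉ W → G.Adj y a → a = x) (hxy : G.Adj x y) (hxW : x ∉ W) (hyW : y ∉ W) {t : ℕ}
    (m : V →₀ ℕ) :
    m + Finsupp.single x 1 + Finsupp.single y 1 ∈ powExponents G W (t + 1) ↔
      m ∈ powExponents G W t := by
  classical
  by_cases hm : ∀ w ∈ W, m w = 0
  · have h₁ : ¬ ∃ w ∈ W, 0 < m w := by
      rintro ⟨w, hw, h⟩
      exact h.ne' (hm w hw)
    have h₂ : ¬ ∃ w ∈ W, 0 < (m + Finsupp.single x 1 + Finsupp.single y 1 : V →₀ ℕ) w := by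
      rintro ⟨w, hw, h⟩
      simp [hm w hw, show y ≠ w by rintro rfl; exact hyW hw,
        show x ≠ w by rintro rfl; exact hxW hw] at h
    simp only [powExponents, Set.mem_ofPred_eq, h₁, h₂, false_or]
    exact ⟨.of_add_edge hy hxy hxW hyW hm, fun h ↦ h.add_edge hxy⟩
  · push Not at hm
    obtain ⟨w, hw, h⟩ := hm
    refine iff_of_true (.inl ⟨w, hw, ?_⟩) (.inl ⟨w, hw, by omega⟩)
    simp only [Finsupp.add_apply]
    omega

theorem add_isolated_mem_powExponents {W : Finset V} {z : V} (hz : ∀ a, G.Adj z a → a ∈ W)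
    (hzW : z ∉ W) {t : ℕ} (m : V →₀ ℕ) :
    m + Finsupp.single z 1 ∈ powExponents G W t ↔ m ∈ powExponents G W t := by
  classical
  refine ⟨fun h ↦ ?_, fun h ↦ powExponents_isUpperSet G W t le_self_add h⟩
  by_cases hm : ∀ w ∈ W, m w = 0
  · refine .inr (.of_add_isolated hz hzW hm (h.resolve_left ?_))
    rintro ⟨w, hw, h⟩
    simp [hm w hw, show z ≠ w by rintro rfl; exact hzW hw] at h
  · push Not at hm
    obtain ⟨w, hw, h⟩ := hm
    exact .inl ⟨w, hw, by omega⟩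

end Covers

section MonomialIdeals

variable (k : Type) [Field k] {V : Type}

/-- The monomial ideal spanned by the monomials with exponents in `S`. -/
noncomputable def monomialIdeal (S : Set (V →₀ ℕ)) : Ideal (MvPolynomial V k) :=
  Ideal.span ((fun s ↦ monomial s (1 : k)) '' S)

variable {k}

theorem mem_monomialIdeal {S : Set (V →₀ ℕ)} (hS : IsUpperSet S) {p : MvPolynomial V k} :
    p ∈ monomialIdeal k S ↔ ∀ m ∈ p.support, m ∈ S := by
  rw [monomialIdeal, mem_ideal_span_monomial_image]
  exact forall₂_congr fun m _ ↦ ⟨fun ⟨s, hs, hle⟩ ↦ hS hle hs, fun h ↦ ⟨m, h, le_rfl⟩⟩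

theorem X_mul_mem_monomialIdeal {S : Set (V →₀ ℕ)} (hS : IsUpperSet S) (z : V)
    {p : MvPolynomial V k} :
    X z * p ∈ monomialIdeal k S ↔ ∀ m ∈ p.support, m + Finsupp.single z 1 ∈ S := by
  rw [mem_monomialIdeal hS, support_X_mul]
  simp [add_comm]

theorem isUpperSet_add_single {S : Set (V →₀ ℕ)} (hS : IsUpperSet S) (z : V) :
    IsUpperSet {m | m + Finsupp.single z 1 ∈ S} :=
  fun _ _ hle hm ↦ hS (add_le_add_left hle _) hm

theorem monomialIdeal_sup_span_X {S S' : Set (V →₀ ℕ)} {z : V}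
    (h : ∀ m, m ∈ S' ↔ m ∈ S ∨ 0 < m z) :
    monomialIdeal k S ⊔ Ideal.span {X z} = monomialIdeal k S' := by
  apply le_antisymm
  · refine sup_le (Ideal.span_mono (Set.image_mono fun m hm ↦ (h m).2 (.inl hm))) ?_
    rw [Ideal.span_singleton_le_iff_mem]
    exact Ideal.subset_span ⟨Finsupp.single z 1, (h _).2 (.inr (by simp)), rfl⟩
  · rw [monomialIdeal, Ideal.span_le]
    rintro _ ⟨m, hm, rfl⟩
    obtain hm | hm := (h m).1 hm
    · exact Ideal.mem_sup_left (Ideal.subset_span ⟨m, hm, rfl⟩)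
    · obtain ⟨m, rfl⟩ := exists_eq_add_single hm
      refine Ideal.mem_sup_right (Ideal.mem_span_singleton'.2 ⟨monomial m 1, ?_⟩)
      simp [X, monomial_mul]

theorem monomialIdeal_eq_top {S : Set (V →₀ ℕ)} (h : 0 ∈ S) : monomialIdeal k S = ⊤ :=
  (Ideal.eq_top_iff_one _).2 (Ideal.subset_span ⟨0, h, rfl⟩)

theorem X_mem_maxHomIdeal (z : V) : X z ∈ maxHomIdeal k V := Ideal.subset_span ⟨z, rfl⟩

instance maxHomIdeal_isMaximal : (maxHomIdeal k V).IsMaximal := by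
  have h : maxHomIdeal k V = RingHom.ker (constantCoeff : MvPolynomial V k →+* k) := by
    apply le_antisymm
    · rw [maxHomIdeal, Ideal.span_le]
      rintro _ ⟨z, rfl⟩
      exact constantCoeff_X (R := k) z
    · intro p hp
      rw [maxHomIdeal, ← Set.image_univ, mem_ideal_span_X_image]
      intro m hm
      by_contra! hcon
      obtain rfl : m = 0 := Finsupp.ext fun v ↦ by simpa using hcon v
      exact mem_support_iff.1 hm hp
  rw [h]
  exact RingHom.ker_isMaximal_of_surjective _ fun a ↦ ⟨C a, by simp⟩

/-- The quotient by a monomial ideal has vanishing `Ext` from torsion modules below `d`. -/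
def MonomialDepthAtLeast (k : Type) [Field k] (d : ℕ) (S : Set (V →₀ ℕ)) : Prop :=
  DepthAtLeast (maxHomIdeal k V) d (monomialIdeal k S)

theorem MonomialDepthAtLeast.mono {d e : ℕ} {S : Set (V →₀ ℕ)} (h : MonomialDepthAtLeast k d S)
    (hed : e ≤ d) : MonomialDepthAtLeast k e S :=
  DepthAtLeast.mono h hed

theorem MonomialDepthAtLeast.of_colon {d : ℕ} {S S' : Set (V →₀ ℕ)} (hS : IsUpperSet S) (z : V)
    (hc : MonomialDepthAtLeast k d {m | m + Finsupp.single z 1 ∈ S})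
    (h' : ∀ m, m ∈ S' ↔ m ∈ S ∨ 0 < m z) (hS' : MonomialDepthAtLeast k d S') :
    MonomialDepthAtLeast k d S := by
  refine DepthAtLeast.of_colon (f := X z) (fun p ↦ ?_) hc ?_
  · rw [mem_monomialIdeal (isUpperSet_add_single hS z), X_mul_mem_monomialIdeal hS]
    rfl
  · rwa [monomialIdeal_sup_span_X h']

theorem MonomialDepthAtLeast.succ {d : ℕ} {S S' : Set (V →₀ ℕ)} (hS : IsUpperSet S) (z : V)
    (hc : ∀ m, m + Finsupp.single z 1 ∈ S → m ∈ S)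
    (h' : ∀ m, m ∈ S' ↔ m ∈ S ∨ 0 < m z) (hS' : MonomialDepthAtLeast k d S') :
    MonomialDepthAtLeast k (d + 1) S := by
  refine DepthAtLeast.succ (X_mem_maxHomIdeal z) (fun p ↦ ?_) ?_
  · rw [mem_monomialIdeal hS, X_mul_mem_monomialIdeal hS]
    exact forall₂_congr fun m _ ↦ ⟨hS le_self_add, hc m⟩
  · rwa [monomialIdeal_sup_span_X h']

theorem edgeIdeal_pow_eq (G : SimpleGraph V) (t : ℕ) :
    edgeIdeal k G ^ t = monomialIdeal k (powExponents G ∅ t) := by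
  classical
  have hmem : ∀ t m, m ∈ powExponents G ∅ t ↔ EdgeCovers G t m := fun t m ↦ by simp [powExponents]
  induction t with
  | zero =>
    rw [pow_zero, Ideal.one_eq_top, monomialIdeal_eq_top]
    exact .inr trivial
  | succ t ih =>
    rw [pow_succ, ih]
    have hXX : ∀ a b : V, (X a * X b : MvPolynomial V k) =
        monomial (Finsupp.single a 1 + Finsupp.single b 1) 1 := fun a b ↦ by
      simp [X, monomial_mul]
    apply le_antisymm
    · rw [monomialIdeal, edgeIdeal, Ideal.span_mul_span', Ideal.span_le]
      rintro _ ⟨_, ⟨m, hm, rfl⟩, _, ⟨a, b, hab, rfl⟩, rfl⟩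
      refine Ideal.subset_span ⟨m + Finsupp.single a 1 + Finsupp.single b 1, ?_, ?_⟩
      · exact (hmem _ _).2 (((hmem _ _).1 hm).add_edge hab)
      · simp [hXX, monomial_mul, add_assoc]
    · rw [monomialIdeal, Ideal.span_le]
      rintro _ ⟨m, hm, rfl⟩
      obtain ⟨a, b, m', hab, hm', rfl⟩ := (hmem _ _).1 hm
      have := Ideal.mul_mem_mul (I := monomialIdeal k (powExponents G ∅ t)) (J := edgeIdeal k G)
        (Ideal.subset_span ⟨m', (hmem _ _).2 hm', rfl⟩) (Ideal.subset_span ⟨a, b, hab, rfl⟩)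
      simpa [hXX, monomial_mul, add_assoc] using this

end MonomialIdeals

section Induction

variable {V : Type}

/-- `L` is a set of vertices of degree at most one in the graph obtained from `G` by deleting `W`,
no two of which are adjacent or share a neighbour there. -/
structure IsLeafSet (G : SimpleGraph V) (W L : Finset V) : Prop where
  disjoint : Disjoint L W
  eq_of_adj : ∀ y ∈ L, ∀ a b, a ∉ W → b ∉ W → G.Adj y a → G.Adj y b → a = b
  not_adj : ∀ y ∈ L, ∀ y' ∈ L, ¬ G.Adj y y'
  eq_of_common : ∀ y ∈ L, ∀ y' ∈ L, ∀ c, c ∉ W → G.Adj y c → G.Adj y' c → y = y'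

variable {G : SimpleGraph V} {W L : Finset V}

theorem IsLeafSet.notMem (hL : IsLeafSet G W L) {y : V} (hy : y ∈ L) : y ∉ W :=
  Finset.disjoint_left.1 hL.disjoint hy

theorem IsLeafSet.mono (hL : IsLeafSet G W L) {L' : Finset V} (h : L' ⊆ L) : IsLeafSet G W L' where
  disjoint := Finset.disjoint_of_subset_left h hL.disjoint
  eq_of_adj y hy := hL.eq_of_adj y (h hy)
  not_adj y hy y' hy' := hL.not_adj y (h hy) y' (h hy')
  eq_of_common y hy y' hy' := hL.eq_of_common y (h hy) y' (h hy')

variable [DecidableEq V]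

theorem IsLeafSet.insert_deleted (hL : IsLeafSet G W L) {z : V} (hz : z ∉ L) :
    IsLeafSet G (insert z W) L where
  disjoint := Finset.disjoint_insert_right.2 ⟨hz, hL.disjoint⟩
  eq_of_adj y hy a b ha hb := hL.eq_of_adj y hy a b (fun h ↦ ha (Finset.mem_insert_of_mem h))
    (fun h ↦ hb (Finset.mem_insert_of_mem h))
  not_adj := hL.not_adj
  eq_of_common y hy y' hy' c hc := hL.eq_of_common y hy y' hy' c
    (fun h ↦ hc (Finset.mem_insert_of_mem h))

theorem IsLeafSet.insert_isolated (hL : IsLeafSet G W L) {z : V} (hz : z ∉ W)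
    (hiso : ∀ a, G.Adj z a → a ∈ W) : IsLeafSet G W (insert z L) where
  disjoint := Finset.disjoint_insert_left.2 ⟨hz, hL.disjoint⟩
  eq_of_adj y hy a b ha hb hya hyb := by
    obtain rfl | hy := Finset.mem_insert.1 hy
    · exact absurd (hiso a hya) ha
    · exact hL.eq_of_adj y hy a b ha hb hya hyb
  not_adj y hy y' hy' h := by
    obtain rfl | hyL := Finset.mem_insert.1 hy
    · obtain rfl | hyL' := Finset.mem_insert.1 hy'
      · exact h.ne rfl
      · exact hL.notMem hyL' (hiso y' h)
    · obtain rfl | hyL' := Finset.mem_insert.1 hy'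
      · exact hL.notMem hyL (hiso y h.symm)
      · exact hL.not_adj y hyL y' hyL' h
  eq_of_common y hy y' hy' c hc h h' := by
    obtain rfl | hy := Finset.mem_insert.1 hy
    · exact absurd (hiso c h) hc
    · obtain rfl | hy' := Finset.mem_insert.1 hy'
      · exact absurd (hiso c h') hc
      · exact hL.eq_of_common y hy y' hy' c hc h h'

variable (k : Type) [Field k]

/-- The depth bound for `I(G) ^ t + (W)`. -/
def PowDepthBound (G : SimpleGraph V) (W : Finset V) (t : ℕ) : Prop :=
  ∀ L, IsLeafSet G W L → MonomialDepthAtLeast k (L.card + 1 - t) (powExponents G W t)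

/-- The depth bound for the colon ideals `(I(G) ^ t + (W)) : z`, where all but one of the neighbours
of `z` off `W` are leaves. -/
def ColonDepthBound (G : SimpleGraph V) (W : Finset V) (t : ℕ) : Prop :=
  ∀ z ∉ W, ∀ w₀, (∀ y ∉ W, G.Adj z y → y ≠ w₀ → ∀ a ∉ W, G.Adj y a → a = z) →
    ∀ L, IsLeafSet G W L → z ∉ L → (∀ y ∈ L, ¬ G.Adj z y) →
      MonomialDepthAtLeast k (L.card + 2 - t) {m | m + Finsupp.single z 1 ∈ powExponents G W t}

variable {k}

theorem ColonDepthBound.of_smaller {t : ℕ} (hpow : PowDepthBound k G W t)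
    (hpow' : ∀ z ∉ W, PowDepthBound k G (insert z W) (t + 1))
    (hcolon : ∀ z ∉ W, ColonDepthBound k G (insert z W) (t + 1)) :
    ColonDepthBound k G W (t + 1) := by
  intro z hz w₀ hw₀ L hL hzL hadj
  have hup := powExponents_isUpperSet G W (t + 1)
  by_cases hleaf : ∃ y ∉ W, G.Adj z y ∧ ∀ a ∉ W, G.Adj y a → a = z
  · obtain ⟨y, hyW, hzy, hy⟩ := hleaf
    have hyL : y ∉ L := fun h ↦ hadj y h hzy
    refine MonomialDepthAtLeast.of_colon (isUpperSet_add_single hup z) y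
      (S' := {m | m + Finsupp.single z 1 ∈ powExponents G (insert y W) (t + 1)}) ?_ (fun m ↦ ?_) ?_
    · have e : {m | m + Finsupp.single y 1 ∈
          {m | m + Finsupp.single z 1 ∈ powExponents G W (t + 1)}} = powExponents G W t := by
        ext m
        refine Iff.trans ?_ (add_edge_mem_powExponents hy hzy hz hyW m)
        rw [add_right_comm]
        rfl
      rw [e]
      exact (hpow L hL).mono (by omega)
    · refine (powExponents_insert W (t + 1) y _).trans ?_
      simp [hzy.ne]
    · exact hcolon y hyW z (by simp [hzy.ne, hz]) w₀
        (fun c hc hzc hne a ha ↦ hw₀ c (by simp_all) hzc hne a (by simp_all)) L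
        (hL.insert_deleted hyL) hzL hadj
  have hw₀' : ∀ y ∉ W, G.Adj z y → y = w₀ := by
    intro y hyW hzy
    by_contra hne
    exact hleaf ⟨y, hyW, hzy, hw₀ y hyW hzy hne⟩
  by_cases hw : w₀ ∉ W ∧ G.Adj z w₀
  · obtain ⟨hwW, hzw⟩ := hw
    have hwL : w₀ ∉ L := fun h ↦ hadj w₀ h hzw
    have hiso : ∀ a, G.Adj z a → a ∈ insert w₀ W := by
      intro a ha
      by_cases haW : a ∈ W
      · exact Finset.mem_insert_of_mem haW
      · rw [hw₀' a haW ha]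
        exact Finset.mem_insert_self _ _
    have hzW' : z ∉ insert w₀ W := by simp [hzw.ne, hz]
    refine MonomialDepthAtLeast.of_colon (isUpperSet_add_single hup z) w₀
      (S' := powExponents G (insert w₀ W) (t + 1)) ?_ (fun m ↦ ?_) ?_
    · have e : {m | m + Finsupp.single w₀ 1 ∈
          {m | m + Finsupp.single z 1 ∈ powExponents G W (t + 1)}} = powExponents G W t := by
        ext m
        exact add_edge_mem_powExponents hw₀' hzw.symm hwW hz m
      rw [e]
      exact (hpow L hL).mono (by omega)
    · rw [← add_isolated_mem_powExponents hiso hzW', powExponents_insert]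
      simp [hzw.ne]
    · refine (hpow' w₀ hwW _ ((hL.insert_deleted hwL).insert_isolated hzW' hiso)).mono ?_
      rw [Finset.card_insert_of_notMem hzL]
  · have hiso : ∀ a, G.Adj z a → a ∈ W := by
      intro a ha
      by_contra haW
      obtain rfl := hw₀' a haW ha
      exact hw ⟨haW, ha⟩
    have e : {m | m + Finsupp.single z 1 ∈ powExponents G W (t + 1)} =
        powExponents G W (t + 1) := by
      ext m
      exact add_isolated_mem_powExponents hiso hz m
    rw [e]
    refine (MonomialDepthAtLeast.succ hup z
      (fun m ↦ (add_isolated_mem_powExponents hiso hz m).1) (powExponents_insert W (t + 1) z)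
      (hpow' z hz L (hL.insert_deleted hzL))).mono ?_
    omega

theorem exists_vertex_with_leaves {h : V → ℕ} (hne : ∀ a b, G.Adj a b → h a ≠ h b)
    (hup : ∀ a b c, G.Adj a b → G.Adj a c → h a < h b → h a < h c → b = c)
    (hL : IsLeafSet G W L) (hedge : ∃ a ∉ W, ∃ b ∉ W, G.Adj a b) :
    ∃ z ∉ W, z ∉ L ∧
      ∃ w₀, ∀ y ∉ W, G.Adj z y → y ≠ w₀ → ∀ a ∉ W, G.Adj y a → a = z := by
  have hex : ∃ n z, h z = n ∧ z ∉ W ∧ ∃ y ∉ W, G.Adj z y ∧ h y < h z := by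
    obtain ⟨a, ha, b, hb, hab⟩ := hedge
    obtain hlt | hlt := (hne a b hab).lt_or_gt
    · exact ⟨_, b, rfl, hb, a, ha, hab.symm, hlt⟩
    · exact ⟨_, a, rfl, ha, b, hb, hab, hlt⟩
  classical
  obtain ⟨z, hzn, hz, c, hc, hzc, hcz⟩ := Nat.find_spec hex
  have hleaf : ∀ y ∉ W, G.Adj z y → h y < h z → ∀ a ∉ W, G.Adj y a → a = z := by
    intro y hy hzy hlt a ha hya
    refine hup y a z hya hzy.symm (lt_of_le_of_ne ?_ (hne y a hya)) hlt
    by_contra! hay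
    exact Nat.find_min hex (hzn ▸ hlt) ⟨y, rfl, hy, a, ha, hya, hay⟩
  by_cases hzL : z ∈ L
  · exact ⟨c, hc, fun hcL ↦ hL.not_adj z hzL c hcL hzc, z,
      fun y hy hcy hyz ↦ absurd (hleaf c hc hzc hcz y hy hcy) hyz⟩
  · by_cases hw : ∃ w, G.Adj z w ∧ h z < h w
    · obtain ⟨w, hzw, hlt⟩ := hw
      refine ⟨z, hz, hzL, w, fun y hy hzy hyw ↦ hleaf y hy hzy ?_⟩
      refine lt_of_le_of_ne ?_ (hne z y hzy).symm
      by_contra! hzy'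
      exact hyw (hup z y w hzy hzw hzy' hlt)
    · push Not at hw
      exact ⟨z, hz, hzL, z, fun y hy hzy _ ↦
        hleaf y hy hzy (lt_of_le_of_ne (hw y hzy) (hne z y hzy).symm)⟩

theorem PowDepthBound.of_smaller {h : V → ℕ} (hne : ∀ a b, G.Adj a b → h a ≠ h b)
    (hup : ∀ a b c, G.Adj a b → G.Adj a c → h a < h b → h a < h c → b = c) {t : ℕ}
    (hpow : ∀ z ∉ W, PowDepthBound k G (insert z W) (t + 1))
    (hcolon : ColonDepthBound k G W (t + 1)) : PowDepthBound k G W (t + 1) := by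
  classical
  intro L hL
  have hupper := powExponents_isUpperSet G W (t + 1)
  obtain rfl | ⟨y, hy⟩ := L.eq_empty_or_nonempty
  · exact (DepthAtLeast.zero _ _).mono (by simp)
  by_cases hedge : ∃ a ∉ W, ∃ b ∉ W, G.Adj a b
  · obtain ⟨z, hz, hzL, w₀, hw₀⟩ := exists_vertex_with_leaves hne hup hL hedge
    refine MonomialDepthAtLeast.of_colon hupper z ?_ (powExponents_insert W (t + 1) z)
      (hpow z hz L (hL.insert_deleted hzL))
    have hcard : L.card ≤ (L.filter fun y ↦ ¬ G.Adj z y).card + 1 := by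
      rw [← Finset.card_filter_add_card_filter_not (s := L) (fun y ↦ G.Adj z y), add_comm]
      gcongr
      refine Finset.card_le_one.2 fun a ha b hb ↦ ?_
      rw [Finset.mem_filter] at ha hb
      exact hL.eq_of_common a ha.1 b hb.1 z hz ha.2.symm hb.2.symm
    refine (hcolon z hz w₀ hw₀ (L.filter fun y ↦ ¬ G.Adj z y) (hL.mono (Finset.filter_subset _ _))
      (fun h ↦ hzL (Finset.mem_filter.1 h).1) (fun y h ↦ (Finset.mem_filter.1 h).2)).mono ?_
    omega
  · push Not at hedge
    have hyW := hL.notMem hy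
    have hiso : ∀ a, G.Adj y a → a ∈ W := fun a ha ↦ by
      by_contra haW
      exact hedge y hyW a haW ha
    refine (MonomialDepthAtLeast.succ hupper y
      (fun m ↦ (add_isolated_mem_powExponents hiso hyW m).1) (powExponents_insert W (t + 1) y)
      (hpow y hyW (L.erase y) ((hL.mono (Finset.erase_subset _ _)).insert_deleted
        (Finset.notMem_erase _ _)))).mono ?_
    rw [Finset.card_erase_of_mem hy]
    have := Finset.card_pos.2 ⟨y, hy⟩
    omega

theorem powDepthBound [Fintype V] {h : V → ℕ} (hne : ∀ a b, G.Adj a b → h a ≠ h b)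
    (hup : ∀ a b c, G.Adj a b → G.Adj a c → h a < h b → h a < h c → b = c) (t : ℕ)
    (W : Finset V) : PowDepthBound k G W t := by
  induction t generalizing W with
  | zero =>
    intro L _
    have e : monomialIdeal k (powExponents G W 0) = ⊤ := monomialIdeal_eq_top (.inr trivial)
    rw [MonomialDepthAtLeast, e]
    exact .top _ _
  | succ t ih =>
    suffices PowDepthBound k G W (t + 1) ∧ ColonDepthBound k G W (t + 1) from this.1
    induction hn : Wᶜ.card using Nat.strong_induction_on generalizing W with
    | _ n IH =>
      have hlt : ∀ z ∉ W, PowDepthBound k G (insert z W) (t + 1) ∧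
          ColonDepthBound k G (insert z W) (t + 1) := by
        intro z hz
        refine IH _ ?_ _ rfl
        rw [← hn, Finset.compl_insert]
        exact Finset.card_erase_lt_of_mem (Finset.mem_compl.2 hz)
      have hcolon := ColonDepthBound.of_smaller (ih W) (fun z hz ↦ (hlt z hz).1)
        fun z hz ↦ (hlt z hz).2
      exact ⟨.of_smaller hne hup (fun z hz ↦ (hlt z hz).1) hcolon, hcolon⟩

end Induction

section Whisker

variable {n : ℕ} {T : SimpleGraph (Fin n)} {U : Finset (Fin n)}

theorem whiskerOn_adj_inl_inl {a b : Fin n} :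
    (whiskerOn T U).Adj (Sum.inl a) (Sum.inl b) ↔ T.Adj a b := by
  simp only [whiskerOn, SimpleGraph.fromRel_adj]
  have := T.adj_comm a b
  have : T.Adj a b → a ≠ b := fun h ↦ h.ne
  aesop

theorem whiskerOn_adj_inr {u : {x : Fin n // x ∈ U}} {v : Fin n ⊕ {x : Fin n // x ∈ U}} :
    (whiskerOn T U).Adj (Sum.inr u) v ↔ v = Sum.inl ↑u := by
  simp only [whiskerOn, SimpleGraph.fromRel_adj]
  aesop

theorem whiskerOn_exists_height (hT : T.IsAcyclic) :
    ∃ h : Fin n ⊕ {x : Fin n // x ∈ U} → ℕ, (∀ a b, (whiskerOn T U).Adj a b → h a ≠ h b) ∧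
      ∀ a b c, (whiskerOn T U).Adj a b → (whiskerOn T U).Adj a c → h a < h b → h a < h c →
        b = c := by
  obtain ⟨h, hne, hup⟩ := hT.exists_height
  refine ⟨Sum.elim (fun v ↦ h v + 1) fun _ ↦ 0, ?_, ?_⟩
  · rintro (a | a) (b | b) hab
    · simpa using hne a b (whiskerOn_adj_inl_inl.1 hab)
    · simp
    · simp
    · simp [whiskerOn_adj_inr] at hab
  · rintro (a | a) b c hab hac hb hc
    · obtain b | b := b
      · obtain c | c := c
        · rw [hup a b c (whiskerOn_adj_inl_inl.1 hab) (whiskerOn_adj_inl_inl.1 hac)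
            (by simpa using hb) (by simpa using hc)]
        · simp at hc
      · simp at hb
    · rw [whiskerOn_adj_inr.1 hab, whiskerOn_adj_inr.1 hac]

theorem isLeafSet_whiskers :
    IsLeafSet (whiskerOn T U) ∅ (Finset.univ.map Function.Embedding.inr) where
  disjoint := Finset.disjoint_empty_right _
  eq_of_adj := by
    simp only [Finset.mem_map, Finset.mem_univ, true_and]
    rintro _ ⟨u, rfl⟩ a b - - ha hb
    exact (whiskerOn_adj_inr.1 ha).trans (whiskerOn_adj_inr.1 hb).symm
  not_adj := by
    simp only [Finset.mem_map, Finset.mem_univ, true_and]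
    rintro _ ⟨u, rfl⟩ _ ⟨v, rfl⟩ h
    simp [whiskerOn_adj_inr] at h
  eq_of_common := by
    simp only [Finset.mem_map, Finset.mem_univ, true_and]
    rintro _ ⟨u, rfl⟩ _ ⟨v, rfl⟩ c - hu hv
    have := (whiskerOn_adj_inr.1 hu).symm.trans (whiskerOn_adj_inr.1 hv)
    rw [Subtype.ext (Sum.inl_injective this)]

end Whisker

theorem edgeIdeal_pow_le_maxHomIdeal (k : Type) [Field k] {V : Type} (G : SimpleGraph V) {t : ℕ}
    (ht : t ≠ 0) : edgeIdeal k G ^ t ≤ maxHomIdeal k V := by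
  refine (Ideal.pow_le_self ht).trans (Ideal.span_le.2 ?_)
  rintro _ ⟨a, b, -, rfl⟩
  exact Ideal.mul_mem_right _ _ (X_mem_maxHomIdeal a)

/-- Lower bound for depth of powers of edge ideals of whiskered forests: if `G` is obtained
from a forest `T` on `n` vertices by adding a whisker at each vertex of `U ⊆ V(T)`, then
`depth R/I(G)^t ≥ |U| - t + 1` for all `t ≥ 1`. -/
theorem depth_power_whisker_forest_lower_bound (k : Type) [Field k] (n : ℕ)
    (T : SimpleGraph (Fin n)) (hacyc : T.IsAcyclic) (U : Finset (Fin n)) :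
    ∀ t : ℕ, 1 ≤ t →
      (U.card : ℤ) - t + 1 ≤ depthQuot k ((edgeIdeal k (whiskerOn T U)) ^ t) := by
  intro t ht
  obtain ⟨h, hne, hup⟩ := whiskerOn_exists_height (U := U) hacyc
  have hdepth : DepthAtLeast (maxHomIdeal k (Fin n ⊕ {x : Fin n // x ∈ U})) (U.card + 1 - t)
      (edgeIdeal k (whiskerOn T U) ^ t) := by
    have := powDepthBound (k := k) hne hup t ∅ _ isLeafSet_whiskers
    rw [Finset.card_map, Finset.card_univ, Fintype.card_coe] at this
    rwa [edgeIdeal_pow_eq]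
  have hle : U.card + 1 - t ≤ depthQuot k (edgeIdeal k (whiskerOn T U) ^ t) :=
    hdepth.le_sInf (edgeIdeal_pow_le_maxHomIdeal k _ (by omega))
  omega
end
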